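/- For every field K and every integer s ≥ 1, the Hochschild cohomology ring HH^*(R_s) of the self-injective algebra R_s of tree class E6 is commutative: xy = yx for all (homogeneous) elements x, y ∈ HH^*(R_s). -/

import Mathlib

open scoped TensorProduct

set_option synthInstance.maxHeartbeats 1000000
set_option maxHeartbeats 2000000

universe u v

namespace E6

/-- Generators of the presentation of the path algebra of the quiver `𝒬ₛ`:
trivial paths `e i`, arrows `a i` (the `αᵢ`), `b i` (the `βᵢ`) and `g i` (the `γᵢ`). -/
inductive Gen (s : ℕ) : Type
  | e (i : ZMod (6 * s))
  | a (i : ZMod (3 * s))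
  | b (i : ZMod (3 * s))
  | g (i : ZMod s)

variable (K : Type u) [Field K] (s : ℕ)

/-- The free algebra on the generators. -/
abbrev F : Type u := FreeAlgebra K (Gen s)

/-- Trivial path generators. -/
noncomputable def E (i : ZMod (6 * s)) : F K s := FreeAlgebra.ι K (Gen.e i)
/-- `α` arrow generators. -/
noncomputable def A (i : ZMod (3 * s)) : F K s := FreeAlgebra.ι K (Gen.a i)
/-- `β` arrow generators. -/
noncomputable def B (i : ZMod (3 * s)) : F K s := FreeAlgebra.ι K (Gen.b i)
/-- `γ` arrow generators. -/
noncomputable def G (i : ZMod s) : F K s := FreeAlgebra.ι K (Gen.g i)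

/-- Source vertex of the arrow `αᵢ` : writing `i = 3t + j` with `j < 3`,
`α_{3t} : 6t → 6t+1`, `α_{3t+1} : 6t+1 → 6t+2`, `α_{3t+2} : 6t+2 → 6t+5`. -/
def aSrc (i : ZMod (3 * s)) : ZMod (6 * s) := ((2 * i.val - i.val % 3 : ℕ) : ZMod (6 * s))

/-- Target vertex of the arrow `αᵢ`. -/
def aTgt (i : ZMod (3 * s)) : ZMod (6 * s) :=
  if i.val % 3 = 1 then ((2 * i.val : ℕ) : ZMod (6 * s)) else ((2 * i.val + 1 : ℕ) : ZMod (6 * s))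

/-- Source vertex of the arrow `βᵢ` : `β_{3t} : 6t → 6t+3`, `β_{3t+1} : 6t+3 → 6t+4`,
`β_{3t+2} : 6t+4 → 6t+5`. -/
def bSrc (i : ZMod (3 * s)) : ZMod (6 * s) :=
  if i.val % 3 = 1 then ((2 * i.val + 1 : ℕ) : ZMod (6 * s)) else ((2 * i.val : ℕ) : ZMod (6 * s))

/-- Target vertex of the arrow `βᵢ`. -/
def bTgt (i : ZMod (3 * s)) : ZMod (6 * s) := ((2 * i.val + 3 - i.val % 3 : ℕ) : ZMod (6 * s))

/-- Source vertex of the arrow `γₜ : 6t+5 → 6t+6`. -/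
def gSrc (i : ZMod s) : ZMod (6 * s) := ((6 * i.val + 5 : ℕ) : ZMod (6 * s))

/-- Target vertex of the arrow `γₜ`. -/
def gTgt (i : ZMod s) : ZMod (6 * s) := ((6 * i.val + 6 : ℕ) : ZMod (6 * s))

/-- The set of arrow generators inside the free algebra. -/
noncomputable def arrows : Set (F K s) :=
  Set.range (A K s) ∪ Set.range (B K s) ∪ Set.range (G K s)

/-- The relations presenting `R_s = K[𝒬ₛ]/I₀` as a quotient of the free algebra on the
trivial paths and the arrows.  The first eight families of relations present the path
algebra `K[𝒬ₛ]` (the trivial paths are orthogonal idempotents summing to `1`, and each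
arrow is fixed by multiplication with the trivial paths at its target, resp. source);
the remaining relations generate the ideal `I₀`: all paths of length `5` vanish
(equivalently, all products of five arrows), `α_{3t+2}α_{3t+1}α_{3t} = β_{3t+2}β_{3t+1}β_{3t}`,
and `α_{3t+3}γ_tβ_{3t+2} = 0 = β_{3t+3}γ_tα_{3t+2}`. -/
inductive Rel : F K s → F K s → Prop
  | idem (i j : ZMod (6 * s)) :
      Rel (E K s i * E K s j) (if i = j then E K s i else 0)
  | sum_one :
      Rel (∑ i ∈ Finset.range (6 * s), E K s (i : ZMod (6 * s))) 1
  | a_tgt (i : ZMod (3 * s)) : Rel (E K s (aTgt s i) * A K s i) (A K s i)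
  | a_src (i : ZMod (3 * s)) : Rel (A K s i * E K s (aSrc s i)) (A K s i)
  | b_tgt (i : ZMod (3 * s)) : Rel (E K s (bTgt s i) * B K s i) (B K s i)
  | b_src (i : ZMod (3 * s)) : Rel (B K s i * E K s (bSrc s i)) (B K s i)
  | g_tgt (i : ZMod s) : Rel (E K s (gTgt s i) * G K s i) (G K s i)
  | g_src (i : ZMod s) : Rel (G K s i * E K s (gSrc s i)) (G K s i)
  | len5 (x₁ x₂ x₃ x₄ x₅ : F K s) (h₁ : x₁ ∈ arrows K s) (h₂ : x₂ ∈ arrows K s)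
      (h₃ : x₃ ∈ arrows K s) (h₄ : x₄ ∈ arrows K s) (h₅ : x₅ ∈ arrows K s) :
      Rel (x₁ * x₂ * x₃ * x₄ * x₅) 0
  | comm (t : Fin s) :
      Rel (A K s ((3 * (t : ℕ) + 2 : ℕ) : ZMod (3 * s)) *
             A K s ((3 * (t : ℕ) + 1 : ℕ) : ZMod (3 * s)) *
             A K s ((3 * (t : ℕ) : ℕ) : ZMod (3 * s)))
          (B K s ((3 * (t : ℕ) + 2 : ℕ) : ZMod (3 * s)) *
             B K s ((3 * (t : ℕ) + 1 : ℕ) : ZMod (3 * s)) *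
             B K s ((3 * (t : ℕ) : ℕ) : ZMod (3 * s)))
  | zero_agb (t : Fin s) :
      Rel (A K s ((3 * (t : ℕ) + 3 : ℕ) : ZMod (3 * s)) * G K s (((t : ℕ) : ℕ) : ZMod s) *
             B K s ((3 * (t : ℕ) + 2 : ℕ) : ZMod (3 * s))) 0
  | zero_bga (t : Fin s) :
      Rel (B K s ((3 * (t : ℕ) + 3 : ℕ) : ZMod (3 * s)) * G K s (((t : ℕ) : ℕ) : ZMod s) *
             A K s ((3 * (t : ℕ) + 2 : ℕ) : ZMod (3 * s))) 0

/-- The self-injective algebra `R_s` of tree class `E₆`, i.e. the quotient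
`K[𝒬ₛ]/I₀` of the path algebra of `𝒬ₛ`, presented by generators and relations. -/
abbrev Alg : Type u := RingQuot (Rel K s)

/-- A canonical `Semiring` instance on `R_s`, routed through the `Ring` structure
(this keeps instance paths on `R_s` coherent). -/
noncomputable instance (priority := 1100) : Semiring (Alg K s) :=
  Ring.toSemiring

/-- The images `e_i` in `R_s` of the trivial paths. -/
noncomputable def ee (i : ZMod (6 * s)) : Alg K s :=
  RingQuot.mkAlgHom K (Rel K s) (E K s i)

/-- The images `α_i` in `R_s` of the arrows `α`. -/
noncomputable def aa (i : ZMod (3 * s)) : Alg K s :=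
  RingQuot.mkAlgHom K (Rel K s) (A K s i)

/-- The images `β_i` in `R_s` of the arrows `β`. -/
noncomputable def bb (i : ZMod (3 * s)) : Alg K s :=
  RingQuot.mkAlgHom K (Rel K s) (B K s i)

/-- The images `γ_i` in `R_s` of the arrows `γ`. -/
noncomputable def gg (i : ZMod s) : Alg K s :=
  RingQuot.mkAlgHom K (Rel K s) (G K s i)

/-! ### The enveloping algebra `Λ = R ⊗ₖ Rᵐᵒᵖ` and the outer bimodule structure on `R` -/

/-- The enveloping algebra `Λ = R_s ⊗[K] R_sᵐᵒᵖ`. -/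
abbrev Env : Type u := Alg K s ⊗[K] (Alg K s)ᵐᵒᵖ

/-- A canonical `Semiring` instance on `Λ`, routed through the `Ring` structure
(this keeps instance paths on `Λ` coherent). -/
noncomputable instance (priority := 1100) : Semiring (Env K s) :=
  Ring.toSemiring

/-- `R_s` is a left `Λ`-module via the outer action `(a ⊗ b) • r = a * r * b.unop`. -/
noncomputable instance : Module (Env K s) (Alg K s) :=
  TensorProduct.Algebra.module

instance : SMulCommClass (Env K s) K (Alg K s) where
  smul_comm l k r := by
    induction l using TensorProduct.induction_on with
    | zero => simp
    | tmul a b =>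
        show a • b • (k • r) = k • (a • b • r)
        rw [smul_comm b k r, smul_comm a k (b • r)]
    | add x y hx hy =>
        rw [add_smul, add_smul, smul_add, hx, hy]

instance : IsScalarTower K (Env K s) (Alg K s) where
  smul_assoc k l r := by
    induction l using TensorProduct.induction_on with
    | zero => simp
    | tmul a b =>
        show ((k • a) ⊗ₜ[K] b) • r = k • (a ⊗ₜ[K] b) • r
        show (k • a) • b • r = k • (a • (b • r))
        rw [smul_assoc]
    | add x y hx hy =>
        rw [smul_add, add_smul, add_smul, hx, hy, smul_add]

/-! ### Projective and simple modules -/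

/-- The quotient of a module by a submodule (as a type). -/
def modQuot {R : Type v} [Ring R] {M : Type*} [AddCommGroup M] [Module R M]
    (p : Submodule R M) : Type _ := M ⧸ p

noncomputable instance {R : Type v} [Ring R] {M : Type*} [AddCommGroup M] [Module R M]
    (p : Submodule R M) : AddCommGroup (modQuot p) :=
  inferInstanceAs (AddCommGroup (M ⧸ p))

noncomputable instance {R : Type v} [Ring R] {M : Type*} [AddCommGroup M] [Module R M]
    (p : Submodule R M) : Module R (modQuot p) :=
  inferInstanceAs (Module R (M ⧸ p))

/-- Right multiplication by a fixed element, as an endomorphism of the left regular module. -/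
def rmul (Λ : Type v) [Ring Λ] (x : Λ) : Λ →ₗ[Λ] Λ where
  toFun y := y * x
  map_add' a b := add_mul a b x
  map_smul' r a := mul_assoc r a x

/-- The Jacobson radical of the ring `Λ` times the `Λ`-module `M`, i.e. the submodule
`rad(Λ)·M` generated by all products `r • x` with `r` in the Jacobson radical of `Λ`
(the Jacobson radical being the intersection of all maximal left ideals). -/
def radSMul (Λ : Type v) [Ring Λ] (M : Type w) [AddCommGroup M] [Module Λ M] :
    Submodule Λ M :=
  Submodule.span Λ {z | ∃ r ∈ (⊥ : Ideal Λ).jacobson, ∃ x : M, z = r • x}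

/-- The indecomposable projective left `R_s`-module `P_i = R_s·e_i`. -/
noncomputable def P (i : ZMod (6 * s)) : Submodule (Alg K s) (Alg K s) :=
  LinearMap.range (rmul (Alg K s) (ee K s i))

/-- The simple left `R_s`-module `S_i = P_i / rad(P_i)` at the vertex `i`. -/
noncomputable def S (i : ZMod (6 * s)) : Type u :=
  modQuot (radSMul (Alg K s) ↥(P K s i))

noncomputable instance (i : ZMod (6 * s)) : AddCommGroup (S K s i) :=
  inferInstanceAs (AddCommGroup (modQuot (radSMul (Alg K s) ↥(P K s i))))

noncomputable instance (i : ZMod (6 * s)) : Module (Alg K s) (S K s i) :=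
  inferInstanceAs (Module (Alg K s) (modQuot (radSMul (Alg K s) ↥(P K s i))))

/-- The canonical projection `P_i → S_i`. -/
noncomputable def toS (i : ZMod (6 * s)) : ↥(P K s i) →ₗ[Alg K s] S K s i :=
  (radSMul (Alg K s) ↥(P K s i)).mkQ

/-- Corestriction of right multiplication by `e_i` to `P_i`. -/
noncomputable def toP (i : ZMod (6 * s)) : Alg K s →ₗ[Alg K s] ↥(P K s i) :=
  LinearMap.codRestrict (P K s i) (rmul (Alg K s) (ee K s i))
    (fun c => LinearMap.mem_range_self _ c)

/-- The homomorphism `P_j → P_i` given by right multiplication with (the class of)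
a path `w` from vertex `i` to vertex `j`; concretely it is `x ↦ x * w * e_i`, which
for an actual path `w` from `i` to `j` (so that `w * e_i = w` holds in `R_s`) is just
right multiplication `x ↦ x * w`. -/
noncomputable def pmul (i j : ZMod (6 * s)) (w : Alg K s) :
    ↥(P K s j) →ₗ[Alg K s] ↥(P K s i) :=
  (toP K s i).comp ((rmul (Alg K s) w).comp (P K s j).subtype)

/-- `α`-arrows of `R_s`, indexed by natural numbers. -/
noncomputable def aN (k : ℕ) : Alg K s := aa K s ((k : ℕ) : ZMod (3 * s))

/-- `β`-arrows of `R_s`, indexed by natural numbers. -/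
noncomputable def bN (k : ℕ) : Alg K s := bb K s ((k : ℕ) : ZMod (3 * s))

/-- `γ`-arrows of `R_s`, indexed by natural numbers. -/
noncomputable def gN (k : ℕ) : Alg K s := gg K s ((k : ℕ) : ZMod s)

/-- The homomorphism `P_j → P_i` (vertices given by natural numbers, taken mod `6s`)
induced by right multiplication with `w`. -/
noncomputable def pmulN (i j : ℕ) (w : Alg K s) :
    ↥(P K s ((j : ℕ) : ZMod (6 * s))) →ₗ[Alg K s] ↥(P K s ((i : ℕ) : ZMod (6 * s))) :=
  pmul K s ((i : ℕ) : ZMod (6 * s)) ((j : ℕ) : ZMod (6 * s)) w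

/-- The canonical projection `P_i → S_i` (vertex given by a natural number). -/
noncomputable def toSN (i : ℕ) :
    ↥(P K s ((i : ℕ) : ZMod (6 * s))) →ₗ[Alg K s] S K s ((i : ℕ) : ZMod (6 * s)) :=
  toS K s ((i : ℕ) : ZMod (6 * s))

/-- The simple module `S_i`, for a vertex given by a natural number. -/
noncomputable def SN (i : ℕ) : Type u := S K s ((i : ℕ) : ZMod (6 * s))

noncomputable instance (i : ℕ) : AddCommGroup (SN K s i) :=
  inferInstanceAs (AddCommGroup (S K s ((i : ℕ) : ZMod (6 * s))))

noncomputable instance (i : ℕ) : Module (Alg K s) (SN K s i) :=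
  inferInstanceAs (Module (Alg K s) (S K s ((i : ℕ) : ZMod (6 * s))))

/-! ### Projective resolutions, minimality and syzygies -/

/-- A projective resolution `⋯ → Q 1 → Q 0 → M → 0` of a module `M` over a ring `Λ`. -/
structure ProjRes (Λ : Type v) [Ring Λ] (M : Type w) [AddCommGroup M] [Module Λ M] where
  /-- The terms of the resolution. -/
  Q : ℕ → Type v
  [acg : ∀ n, AddCommGroup (Q n)]
  [mod : ∀ n, Module Λ (Q n)]
  proj : ∀ n, Module.Projective Λ (Q n)
  /-- The differentials. -/
  d : ∀ n, Q (n + 1) →ₗ[Λ] Q n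
  /-- The augmentation. -/
  ε : Q 0 →ₗ[Λ] M
  surj : Function.Surjective ε
  exact₀ : LinearMap.range (d 0) = LinearMap.ker ε
  exact : ∀ n, LinearMap.range (d (n + 1)) = LinearMap.ker (d n)

attribute [instance] ProjRes.acg ProjRes.mod

/-- A projective resolution is minimal if the image of every differential lies in
`rad(Λ)` times the target. -/
def ProjRes.Minimal {Λ : Type v} [Ring Λ] {M : Type w} [AddCommGroup M]
    [Module Λ M] (res : ProjRes Λ M) : Prop :=
  ∀ n, LinearMap.range (res.d n) ≤ radSMul Λ (res.Q n)

/-- `Ω^p(M) ≅ N` : the `p`-th syzygy of `M` with respect to the projective resolution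
`res` is isomorphic to `N` (stated for `p ≥ 1`; here `Ω¹ = ker ε` and
`Ω^p = ker (d (p-2))` for `p ≥ 2`). -/
def ProjRes.SyzygyIso {Λ : Type v} [Ring Λ] {M : Type w} [AddCommGroup M]
    [Module Λ M] (res : ProjRes Λ M) (p : ℕ) (N : Type*) [AddCommGroup N]
    [Module Λ N] : Prop :=
  (p = 1 ∧ Nonempty (↥(LinearMap.ker res.ε) ≃ₗ[Λ] N)) ∨
  (2 ≤ p ∧ Nonempty (↥(LinearMap.ker (res.d (p - 2))) ≃ₗ[Λ] N))

/-! ### The automorphisms `σ` and `τ`, and twisted bimodules -/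

/-- The defining property of the algebra automorphism `σ` of `R_s` :
`σ(e_i) = e_{i+36}` for `i ≡ 0,5 (mod 6)`, `σ(e_i) = e_{i+38}` for `i ≡ 1,2 (mod 6)`,
`σ(e_i) = e_{i+34}` for `i ≡ 3,4 (mod 6)`; `σ(γ_i) = -γ_{i+6}`;
`σ(α_i) = -β_{i+18}` for `i ≡ 0,1 (mod 3)` and `σ(α_i) = β_{i+18}` for `i ≡ 2 (mod 3)`;
`σ(β_i) = -α_{i+18}` for `i ≡ 1,2 (mod 3)` and `σ(β_i) = α_{i+18}` for `i ≡ 0 (mod 3)`. -/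
noncomputable def IsSigma (σ : Alg K s ≃ₐ[K] Alg K s) : Prop :=
  (∀ i : ZMod (6 * s), σ (ee K s i) =
      if i.val % 6 = 0 ∨ i.val % 6 = 5 then ee K s (i + 36)
      else if i.val % 6 = 1 ∨ i.val % 6 = 2 then ee K s (i + 38)
      else ee K s (i + 34)) ∧
  (∀ i : ZMod s, σ (gg K s i) = -gg K s (i + 6)) ∧
  (∀ i : ZMod (3 * s), σ (aa K s i) =
      if i.val % 3 = 2 then bb K s (i + 18) else -bb K s (i + 18)) ∧
  (∀ i : ZMod (3 * s), σ (bb K s i) =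
      if i.val % 3 = 0 then aa K s (i + 18) else -aa K s (i + 18))

/-- The underlying type of the twisted bimodule `₁R_σ` : the linear space `R_s` with
the ordinary left action of `R_s` and the right action twisted by `σ`. -/
def Twisted (_σ : Alg K s ≃ₐ[K] Alg K s) : Type u := Alg K s

variable {K s} in
/-- The identity map `R_s → ₁R_σ`. -/
def Twisted.mk (σ : Alg K s ≃ₐ[K] Alg K s) (x : Alg K s) : Twisted K s σ := x

variable {K s} in
/-- The identity map `₁R_σ → R_s`. -/
def Twisted.un (σ : Alg K s ≃ₐ[K] Alg K s) (x : Twisted K s σ) : Alg K s := x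

section TwistedInstances

variable (σ : Alg K s ≃ₐ[K] Alg K s)

noncomputable instance : AddCommGroup (Twisted K s σ) :=
  inferInstanceAs (AddCommGroup (Alg K s))

noncomputable instance : Module K (Twisted K s σ) :=
  inferInstanceAs (Module K (Alg K s))

noncomputable instance : Module (Alg K s) (Twisted K s σ) :=
  inferInstanceAs (Module (Alg K s) (Alg K s))

/-- The right action on `₁R_σ` : `(op b) • m = m * σ(b)`. -/
noncomputable instance : Module (Alg K s)ᵐᵒᵖ (Twisted K s σ) :=
  Module.compHom (Alg K s) (RingHom.op (σ : Alg K s →+* Alg K s))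

variable {K s σ} in
theorem Twisted.op_smul_def (b : (Alg K s)ᵐᵒᵖ) (m : Twisted K s σ) :
    b • m = Twisted.mk σ (Twisted.un σ m * σ b.unop) :=
  rfl

noncomputable instance : IsScalarTower K (Alg K s) (Twisted K s σ) :=
  inferInstanceAs (IsScalarTower K (Alg K s) (Alg K s))

noncomputable instance : IsScalarTower K (Alg K s)ᵐᵒᵖ (Twisted K s σ) where
  smul_assoc k b m := by
    rw [Twisted.op_smul_def, Twisted.op_smul_def, MulOpposite.unop_smul, map_smul]
    show Twisted.un σ m * k • σ b.unop = k • (Twisted.un σ m * σ b.unop)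
    rw [mul_smul_comm]

noncomputable instance : SMulCommClass (Alg K s) (Alg K s)ᵐᵒᵖ (Twisted K s σ) where
  smul_comm a b m := by
    rw [Twisted.op_smul_def]
    show Twisted.mk σ (a * (Twisted.un σ m * σ b.unop)) =
      b • Twisted.mk σ (a * Twisted.un σ m)
    rw [Twisted.op_smul_def]
    show Twisted.mk σ (a * (Twisted.un σ m * σ b.unop)) =
      Twisted.mk σ ((a * Twisted.un σ m) * σ b.unop)
    rw [mul_assoc]

/-- The twisted bimodule `₁R_σ` as a module over the enveloping algebra `Λ`. -/
noncomputable instance : Module (Env K s) (Twisted K s σ) :=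
  TensorProduct.Algebra.module

end TwistedInstances

/-- The defining property of the automorphism `τ` of `R_s` : `τ` fixes all `e_i`
and all `γ_i`, and `τ(α_i) = -α_i`, `τ(β_i) = -β_i` for `i ≡ 0,2 (mod 3)` while
`τ(α_i) = α_i`, `τ(β_i) = β_i` for `i ≡ 1 (mod 3)`. -/
noncomputable def IsTau (τ : Alg K s ≃ₐ[K] Alg K s) : Prop :=
  (∀ i : ZMod (6 * s), τ (ee K s i) = ee K s i) ∧
  (∀ i : ZMod s, τ (gg K s i) = gg K s i) ∧
  (∀ i : ZMod (3 * s), τ (aa K s i) =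
      if i.val % 3 = 1 then aa K s i else -aa K s i) ∧
  (∀ i : ZMod (3 * s), τ (bb K s i) =
      if i.val % 3 = 1 then bb K s i else -bb K s i)

universe w

section Anticommutation
open CategoryTheory Abelian Limits

variable {Λ : Type u} [Ring Λ]

/-- The two connecting composites around a three-by-three diagram with exact rows
`S₁, S₂, S₃` and exact columns cancel. -/
theorem extClass_comp_extClass_add [HasExt.{w} (ModuleCat.{u} Λ)]
    {S₁ S₂ S₃ : ShortComplex (ModuleCat.{u} Λ)}
    (i : S₁ ⟶ S₂) (p : S₂ ⟶ S₃) (h₁ : S₁.ShortExact) (h₂ : S₂.ShortExact) (h₃ : S₃.ShortExact)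
    (w₁ : i.τ₁ ≫ p.τ₁ = 0) (w₂ : i.τ₂ ≫ p.τ₂ = 0) (w₃ : i.τ₃ ≫ p.τ₃ = 0)
    (c₁ : (ShortComplex.mk _ _ w₁).ShortExact) (c₂ : (ShortComplex.mk _ _ w₂).ShortExact)
    (c₃ : (ShortComplex.mk _ _ w₃).ShortExact) :
    Ext.comp.{w} h₃.extClass c₁.extClass (rfl : 1 + 1 = 2) +
      c₃.extClass.comp h₁.extClass (rfl : 1 + 1 = 2) = 0 := by
  have := h₁.mono_f
  have := h₁.epi_g
  have := h₂.mono_f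
  have := h₂.epi_g
  have := h₃.mono_f
  have : Mono i.τ₁ := c₁.mono_f
  have : Mono i.τ₂ := c₂.mono_f
  have : Mono i.τ₃ := c₃.mono_f
  have : Epi p.τ₁ := c₁.epi_g
  have : Epi p.τ₃ := c₃.epi_g
  let j : S₁.X₁ ⟶ S₂.X₂ := S₁.f ≫ i.τ₂
  have : Mono j := mono_comp _ _
  have hj : j = i.τ₁ ≫ S₂.f := i.comm₁₂.symm
  let π := cokernel.π j
  have hD : (ShortComplex.mk j π (cokernel.condition j)).ShortExact :=
    { exact := ShortComplex.exact_cokernel j }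
  let q : cokernel j ⟶ S₃.X₃ := cokernel.desc j (S₂.g ≫ p.τ₃) (by simp [hj])
  let r₁ : cokernel j ⟶ S₂.X₃ := cokernel.desc j S₂.g (by simp [hj])
  let r₂ : cokernel j ⟶ S₃.X₂ := cokernel.desc j p.τ₂ (by simp [j, w₂])
  let u₁ : S₁.X₃ ⟶ cokernel j := h₁.exact.desc (i.τ₂ ≫ π) (by
    rw [← Category.assoc]; exact cokernel.condition j)
  let u₂ : S₃.X₁ ⟶ cokernel j := c₁.exact.desc (S₂.f ≫ π) (by
    rw [← Category.assoc]; change (i.τ₁ ≫ S₂.f) ≫ π = 0; rw [← hj]; exact cokernel.condition j)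
  have gu₁ : S₁.g ≫ u₁ = i.τ₂ ≫ π := h₁.exact.g_desc _ _
  have gu₂ : p.τ₁ ≫ u₂ = S₂.f ≫ π := c₁.exact.g_desc _ _
  have πq : π ≫ q = S₂.g ≫ p.τ₃ := cokernel.π_desc _ _ _
  have πr₁ : π ≫ r₁ = S₂.g := cokernel.π_desc _ _ _
  have πr₂ : π ≫ r₂ = p.τ₂ := cokernel.π_desc _ _ _
  have ur₁₁ : u₁ ≫ r₁ = i.τ₃ := by
    rw [← cancel_epi S₁.g, reassoc_of% gu₁, πr₁, i.comm₂₃]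
  have ur₁₂ : u₁ ≫ r₂ = 0 := by
    rw [← cancel_epi S₁.g, reassoc_of% gu₁, πr₂, w₂, comp_zero]
  have ur₂₁ : u₂ ≫ r₁ = 0 := by
    rw [← cancel_epi p.τ₁, reassoc_of% gu₂, πr₁, S₂.zero, comp_zero]
  have ur₂₂ : u₂ ≫ r₂ = S₃.f := by
    rw [← cancel_epi p.τ₁, reassoc_of% gu₂, πr₂, p.comm₁₂]
  have rq₁ : r₁ ≫ p.τ₃ = q := by
    rw [← cancel_epi π, reassoc_of% πr₁, πq]
  have rq₂ : r₂ ≫ S₃.g = q := by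
    rw [← cancel_epi π, reassoc_of% πr₂, πq, p.comm₂₃]
  let k : S₁.X₃ ⊞ S₃.X₁ ⟶ cokernel j := biprod.desc u₁ u₂
  have kr₁ : k ≫ r₁ = biprod.fst ≫ i.τ₃ := by
    apply biprod.hom_ext' <;> simp [k, ur₁₁, ur₂₁]
  have kr₂ : k ≫ r₂ = biprod.snd ≫ S₃.f := by
    apply biprod.hom_ext' <;> simp [k, ur₁₂, ur₂₂]
  have kq : k ≫ q = 0 := by
    rw [← rq₁, reassoc_of% kr₁, w₃, comp_zero]
  have : Mono k := Preadditive.mono_of_cancel_zero _ fun g hg => by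
    apply biprod.hom_ext
    · rw [← cancel_mono i.τ₃, Category.assoc, ← kr₁, reassoc_of% hg]; simp
    · rw [← cancel_mono S₃.f, Category.assoc, ← kr₂, reassoc_of% hg]; simp
  have : Epi q := by
    have : Epi (π ≫ q) := by rw [πq]; infer_instance
    exact epi_of_epi π q
  have hE : (ShortComplex.mk k q kq).ShortExact :=
    { exact := by
        rw [ShortComplex.moduleCat_exact_iff]
        intro (d : (cokernel j : ModuleCat Λ)) (hd : q d = 0)
        obtain ⟨b, rfl⟩ := (ModuleCat.epi_iff_surjective π).1 inferInstance d
        have hb : S₃.g (p.τ₂ b) = 0 := by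
          rw [← hd, ← ConcreteCategory.comp_apply, ← ConcreteCategory.comp_apply, p.comm₂₃, πq]
        obtain ⟨c, hc⟩ := (S₃.moduleCat_exact_iff).1 h₃.exact _ hb
        obtain ⟨b', rfl⟩ := (ModuleCat.epi_iff_surjective p.τ₁).1 inferInstance c
        have hb' : p.τ₂ (b - S₂.f b') = 0 := by
          rw [map_sub, ← hc, sub_eq_zero, ← ConcreteCategory.comp_apply,
            ← ConcreteCategory.comp_apply, p.comm₁₂]
        obtain ⟨a, ha⟩ := ((ShortComplex.mk _ _ w₂).moduleCat_exact_iff).1 c₂.exact _ hb'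
        refine ⟨(biprod.inl : S₁.X₃ ⟶ S₁.X₃ ⊞ S₃.X₁) (S₁.g a) +
          (biprod.inr : S₃.X₁ ⟶ S₁.X₃ ⊞ S₃.X₁) (p.τ₁ b'), ?_⟩
        change k _ = π b
        rw [map_add, ← ConcreteCategory.comp_apply, ← ConcreteCategory.comp_apply,
          ← ConcreteCategory.comp_apply, ← ConcreteCategory.comp_apply]
        simp only [k, biprod.inl_desc, biprod.inr_desc]
        rw [gu₁, gu₂, ConcreteCategory.comp_apply, ConcreteCategory.comp_apply]
        change π (i.τ₂ a) + _ = _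
        have ha' : i.τ₂ a = b - S₂.f b' := ha
        rw [ha', ← map_add, sub_add_cancel] }
  have n₁ := ShortComplex.ShortExact.extClass_naturality.{w} hE c₃
    ⟨biprod.fst, r₁, 𝟙 _, kr₁.symm, by simp [rq₁]⟩
  have n₂ := ShortComplex.ShortExact.extClass_naturality.{w} hE h₃
    ⟨biprod.snd, r₂, 𝟙 _, kr₂.symm, by simp [rq₂]⟩
  have m₁ := ShortComplex.ShortExact.extClass_naturality.{w} h₁ hD
    ⟨𝟙 _, i.τ₂, u₁, by simp [j], gu₁.symm⟩
  have m₂ := ShortComplex.ShortExact.extClass_naturality.{w} c₁ hD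
    ⟨𝟙 _, S₂.f, u₂, by simp [hj], gu₂.symm⟩
  have z : ∀ k', k' = k → hE.extClass.comp (Ext.mk₀ k') (add_zero 1) = 0 := by
    rintro _ rfl
    exact hE.extClass_comp
  dsimp only at n₁ n₂ m₁ m₂
  rw [Ext.comp_mk₀_id] at m₁ m₂
  rw [Ext.mk₀_id_comp] at n₁ n₂
  rw [m₁, m₂, ← n₁, ← n₂]
  have hk : k = biprod.fst ≫ u₁ + biprod.snd ≫ u₂ := by
    apply biprod.hom_ext' <;> simp [k]
  replace z := z _ hk.symm
  rw [Ext.mk₀_add, Ext.comp_add, ← Ext.mk₀_comp_mk₀, ← Ext.mk₀_comp_mk₀] at z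
  have := congrArg (fun y => y.comp hD.extClass (rfl : 1 + 1 = 2)) z
  simp only [Ext.add_comp, Ext.zero_comp] at this
  rw [← this]
  refine (add_comm _ _).trans ?_
  congr 1 <;> simp [Ext.comp_assoc_of_second_deg_zero]

end Anticommutation

section GradedNaturality
open CategoryTheory Abelian Limits

variable {C : Type u} [Category.{v} C] [Abelian C] [HasExt.{w} C]

theorem comp_zsmul {X Y Z : C} {a b c : ℕ} (α : Ext.{w} X Y a) (k : ℤ) (β : Ext Y Z b)
    (h : a + b = c) : α.comp (k • β) h = k • α.comp β h :=
  map_zsmul (α.precomp Z h) k β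

theorem zsmul_comp {X Y Z : C} {a b c : ℕ} (k : ℤ) (α : Ext.{w} X Y a) (β : Ext Y Z b)
    (h : a + b = c) : (k • α).comp β h = k • α.comp β h :=
  map_zsmul (β.postcomp X h) k α

/-- Every extension class of positive degree factors through a connecting class. -/
theorem exists_extClass_comp [EnoughProjectives C] {X Y : C} {n : ℕ} (e : Ext.{w} X Y (n + 1)) :
    ∃ (S : ShortComplex C) (hS : S.ShortExact) (hX : S.X₃ = X) (e' : Ext S.X₁ Y n),
      hX ▸ hS.extClass.comp e' (Nat.add_comm 1 n) = e := by
  let S : ShortComplex C := ShortComplex.mk (kernel.ι (Projective.π X)) (Projective.π X)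
    (kernel.condition _)
  have hS : S.ShortExact := { exact := ShortComplex.exact_kernel _ }
  have : Projective S.X₂ := inferInstanceAs (Projective (Projective.over X))
  obtain ⟨e', he'⟩ := Ext.contravariant_sequence_exact₃ hS Y e
    (Ext.eq_zero_of_projective _) (Nat.add_comm 1 n)
  exact ⟨S, hS, rfl, e', he'⟩

/-- An induction principle for extension classes: it suffices to treat morphisms and
compositions with connecting classes. -/
theorem ext_induction [EnoughProjectives C]
    {P : ∀ {X Y : C} {n : ℕ}, Ext.{w} X Y n → Prop}
    (h₀ : ∀ {X Y : C} (f : X ⟶ Y), P (Ext.mk₀ f))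
    (h₁ : ∀ {S : ShortComplex C} (hS : S.ShortExact) {Y : C} {n : ℕ} (e : Ext S.X₁ Y n),
      P e → P (hS.extClass.comp e (Nat.add_comm 1 n)))
    {X Y : C} {n : ℕ} (e : Ext X Y n) : P e := by
  induction n generalizing X with
  | zero =>
    obtain ⟨f, rfl⟩ := Ext.homEquiv₀.symm.surjective e
    exact h₀ f
  | succ n ih =>
    obtain ⟨S, hS, rfl, e', rfl⟩ := exists_extClass_comp e
    exact h₁ hS e' (ih e')

/-- A natural transformation from an exact functor to the identity acts naturally on `Ext`. -/
theorem map_comp_app [EnoughProjectives C] (F : C ⥤ C) [F.Additive] [PreservesFiniteLimits F]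
    [PreservesFiniteColimits F] (t : F ⟶ 𝟭 C) {X Y : C} {n : ℕ} (e : Ext.{w} X Y n) :
    (e.mapExactFunctor F).comp (Ext.mk₀ (t.app Y)) (add_zero n) =
      (Ext.mk₀ (t.app X)).comp e (zero_add n) := by
  induction e using ext_induction with
  | h₀ f =>
    rw [Ext.mapExactFunctor_mk₀, Ext.mk₀_comp_mk₀, Ext.mk₀_comp_mk₀, t.naturality]
    rfl
  | @h₁ S hS Y n e ih =>
    have h : (hS.extClass.mapExactFunctor F).comp (Ext.mk₀ (t.app S.X₁)) (add_zero 1) =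
        (Ext.mk₀ (t.app S.X₃)).comp hS.extClass (zero_add 1) := by
      rw [Ext.mapExactFunctor_extClass]
      exact ShortComplex.ShortExact.extClass_naturality (hS.map_of_exact F) hS
        ⟨t.app S.X₁, t.app S.X₂, t.app S.X₃, (t.naturality _).symm, (t.naturality _).symm⟩
    rw [Ext.mapExactFunctor_comp, Ext.comp_assoc_of_third_deg_zero, ih,
      ← Ext.comp_assoc_of_second_deg_zero, h,
      Ext.comp_assoc _ _ _ (zero_add 1) (Nat.add_comm 1 n) (by omega)]

end GradedNaturality

section Natural
open CategoryTheory Abelian Limits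
variable {Λ : Type u} [Ring Λ] [HasExt.{w} (ModuleCat.{u} Λ)]
  {F F' G : ModuleCat.{u} Λ ⥤ ModuleCat.{u} Λ}
  [F.Additive] [PreservesFiniteLimits F] [PreservesFiniteColimits F]
  [F'.Additive] [PreservesFiniteLimits F'] [PreservesFiniteColimits F']
  [G.Additive] [PreservesFiniteLimits G] [PreservesFiniteColimits G]
  {ι : F' ⟶ G} {π : G ⟶ F} {z : ∀ M, ι.app M ≫ π.app M = 0}

/-- The connecting classes of a natural short exact sequence of exact functors
commute with extension classes up to the expected sign. -/
theorem map_comp_extClass (hS : ∀ M, (ShortComplex.mk _ _ (z M)).ShortExact)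
    {X Y : ModuleCat.{u} Λ} {n p : ℕ} (e : Ext.{w} X Y n) (h : n + 1 = p) (h' : 1 + n = p) :
    (e.mapExactFunctor F).comp (hS Y).extClass h =
      (-1 : ℤ) ^ n • (hS X).extClass.comp (e.mapExactFunctor F') h' := by
  subst h
  induction e using ext_induction with
  | h₀ f =>
    have h := ShortComplex.ShortExact.extClass_naturality (hS _) (hS _)
      ⟨F'.map f, G.map f, F.map f, (ι.naturality _), (π.naturality _)⟩
    rw [Ext.mapExactFunctor_mk₀, Ext.mapExactFunctor_mk₀, pow_zero, one_smul]
    exact h.symm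
  | @h₁ S hT Y n e ih =>
    have key : (hT.extClass.mapExactFunctor F).comp (hS S.X₁).extClass (rfl : 1 + 1 = 2) =
        -(hS S.X₃).extClass.comp (hT.extClass.mapExactFunctor F') rfl := by
      rw [Ext.mapExactFunctor_extClass, Ext.mapExactFunctor_extClass]
      exact eq_neg_of_add_eq_zero_right <|
        extClass_comp_extClass_add.{u, w} (S₁ := .mk _ _ (z S.X₁)) (S₂ := .mk _ _ (z S.X₂))
        (S₃ := .mk _ _ (z S.X₃))
        ⟨F'.map S.f, G.map S.f, F.map S.f, (ι.naturality _), (π.naturality _)⟩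
        ⟨F'.map S.g, G.map S.g, F.map S.g, (ι.naturality _), (π.naturality _)⟩
        (hS _) (hS _) (hS _) (by simp [← Functor.map_comp]) (by simp [← Functor.map_comp])
        (by simp [← Functor.map_comp]) (hT.map_of_exact F') (hT.map_of_exact G)
        (hT.map_of_exact F)
    rw [Ext.mapExactFunctor_comp, Ext.mapExactFunctor_comp,
      Ext.comp_assoc _ _ _ (Nat.add_comm 1 n) rfl (by omega), ih (Nat.add_comm 1 n),
      comp_zsmul, ← Ext.comp_assoc _ _ _ (show 1 + 1 = 2 from rfl) _ (by omega),
      key, Ext.neg_comp,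
      Ext.comp_assoc _ _ _ (show 1 + 1 = 2 from rfl) (Nat.add_comm 1 n) (by omega), pow_succ]
    simp

end Natural

section MatrixFunctor
open CategoryTheory Limits
open scoped Matrix.Module

variable {Λ : Type u} [Ring Λ] {ι κ ν : Type}

section
variable [Fintype ι] [DecidableEq ι]

/-- The functor `M ↦ Mᶥ`, where `Λ` acts through a matrix representation. -/
noncomputable def matFunctor (φ : Λ →+* Matrix ι ι Λ) : ModuleCat.{u} Λ ⥤ ModuleCat.{u} Λ :=
  ModuleCat.toMatrixModCat.{u, 0, u} Λ ι ⋙ ModuleCat.restrictScalars.{u} φ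

instance (φ : Λ →+* Matrix ι ι Λ) : (matFunctor φ).Additive where
  map_add := by intros; rfl

theorem matFunctor_map_exact (φ : Λ →+* Matrix ι ι Λ) (S : ShortComplex (ModuleCat.{u} Λ))
    (h : S.Exact) : (S.map (matFunctor φ)).Exact := by
  rw [ShortComplex.moduleCat_exact_iff] at h ⊢
  intro (v : ι → S.X₂) hv
  choose w hw using fun i => h (v i) (congrFun (show (fun i => S.g (v i)) = (0 : ι → S.X₃) from hv) i)
  exact ⟨(w : ι → S.X₁), funext hw⟩

theorem matFunctor_preserves (φ : Λ →+* Matrix ι ι Λ) :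
    PreservesFiniteLimits (matFunctor φ) ∧ PreservesFiniteColimits (matFunctor φ) :=
  ((Functor.exact_tfae (matFunctor φ)).out 1 3).mp (matFunctor_map_exact φ)

instance (φ : Λ →+* Matrix ι ι Λ) : PreservesFiniteLimits (matFunctor φ) :=
  (matFunctor_preserves φ).1

instance (φ : Λ →+* Matrix ι ι Λ) : PreservesFiniteColimits (matFunctor φ) :=
  (matFunctor_preserves φ).2

end

/-- The action of a rectangular matrix on vectors with entries in a module. -/
def matAct {M : Type*} [AddCommGroup M] [Module Λ M] [Fintype κ]
    (P : Matrix ι κ Λ) : (κ → M) →+ (ι → M) where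
  toFun v i := ∑ j, P i j • v j
  map_zero' := by ext; simp
  map_add' v w := by ext; simp [Finset.sum_add_distrib]

theorem matAct_mul {M : Type*} [AddCommGroup M] [Module Λ M] [Fintype κ] [Fintype ν]
    (P : Matrix ι κ Λ) (Q : Matrix κ ν Λ)
    (v : ν → M) : matAct (P * Q) v = matAct P (matAct Q v) := by
  ext i
  simp only [matAct, AddMonoidHom.coe_mk, ZeroHom.coe_mk, Matrix.mul_apply, Finset.smul_sum,
    Finset.sum_smul, mul_smul]
  rw [Finset.sum_comm]

theorem matAct_one {M : Type*} [AddCommGroup M] [Module Λ M] [Fintype ι] [DecidableEq ι]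
    (v : ι → M) :
    matAct (1 : Matrix ι ι Λ) v = v := by
  ext i
  simp [matAct, Matrix.one_apply]

theorem matAct_add {M : Type*} [AddCommGroup M] [Module Λ M] [Fintype κ]
    (P Q : Matrix ι κ Λ) (v : κ → M) :
    matAct (P + Q) v = matAct P v + matAct Q v := by
  ext i
  simp [matAct, add_smul, Finset.sum_add_distrib]

theorem matAct_zero {M : Type*} [AddCommGroup M] [Module Λ M] [Fintype κ]
    (v : κ → M) :
    matAct (0 : Matrix ι κ Λ) v = 0 := by
  ext i
  simp [matAct]

variable [Fintype ι] [DecidableEq ι] [Fintype κ] [DecidableEq κ] [Fintype ν] [DecidableEq ν]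

/-- An intertwining matrix induces a natural transformation. -/
noncomputable def matTrans {φ : Λ →+* Matrix ι ι Λ} {ψ : Λ →+* Matrix κ κ Λ} (P : Matrix ι κ Λ)
    (h : ∀ l, P * ψ l = φ l * P) : matFunctor ψ ⟶ matFunctor φ where
  app M := ModuleCat.ofHom (X := (matFunctor ψ).obj M) (Y := (matFunctor φ).obj M)
    { toFun := fun v : κ → M => (matAct P v : ι → M)
      map_add' := (matAct P).map_add
      map_smul' := fun l v =>
        (matAct_mul (M := M) P (ψ l) v).symm.trans
          ((congrArg (fun Q => matAct (M := M) Q v) (h l)).trans (matAct_mul (M := M) (φ l) P v)) }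
  naturality M N f := by
    ext v
    funext i
    change ∑ j, P i j • f.hom ((v : κ → M) j) = f.hom (∑ j, P i j • (v : κ → M) j)
    simp

theorem matTrans_zero {φ : Λ →+* Matrix ι ι Λ} {ψ : Λ →+* Matrix κ κ Λ}
    {χ : Λ →+* Matrix ν ν Λ} (P : Matrix ι κ Λ)
    (h : ∀ l, P * ψ l = φ l * P) (Q : Matrix κ ν Λ) (h' : ∀ l, Q * χ l = ψ l * Q) (w : P * Q = 0)
    (M : ModuleCat.{u} Λ) : (matTrans Q h').app M ≫ (matTrans P h).app M = 0 := by
  ext v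
  exact (matAct_mul (M := M) P Q v).symm.trans
    ((congrArg (fun Q => matAct (M := M) Q v) w).trans (matAct_zero (M := M) v))

theorem matTrans_shortExact {φ : Λ →+* Matrix ι ι Λ} {ψ : Λ →+* Matrix κ κ Λ}
    {χ : Λ →+* Matrix ν ν Λ} (P : Matrix ι κ Λ)
    (h : ∀ l, P * ψ l = φ l * P) (Q : Matrix κ ν Λ) (h' : ∀ l, Q * χ l = ψ l * Q) (w : P * Q = 0)
    (R : Matrix ν κ Λ) (S : Matrix κ ι Λ) (hR : R * Q = 1) (hS : P * S = 1)
    (hRS : Q * R + S * P = 1)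
    (M : ModuleCat.{u} Λ) : (ShortComplex.mk _ _ (matTrans_zero P h Q h' w M)).ShortExact where
  exact := by
    rw [ShortComplex.moduleCat_exact_iff]
    intro (x : κ → M) (hx : matAct P x = 0)
    refine ⟨(matAct R x : ν → M), ?_⟩
    change matAct Q (matAct R x) = x
    conv_rhs => rw [← matAct_one (Λ := Λ) x, ← hRS, matAct_add, matAct_mul S, hx, map_zero,
      add_zero, matAct_mul]
  mono_f := by
    rw [ModuleCat.mono_iff_injective]
    refine Function.LeftInverse.injective (g := fun x : κ → M => (matAct R x : ν → M)) ?_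
    intro (x : ν → M)
    change matAct R (matAct Q x) = x
    rw [← matAct_mul, hR, matAct_one]
  epi_g := by
    rw [ModuleCat.epi_iff_surjective]
    refine Function.RightInverse.surjective (g := fun x : ι → M => (matAct S x : κ → M)) ?_
    intro (x : ι → M)
    change matAct P (matAct S x) = x
    rw [← matAct_mul, hS, matAct_one]

end MatrixFunctor

section MatRep
set_option linter.unusedSectionVars false
open Matrix

variable {k : Type u} [Field k] {A : Type u} [Ring A] [Algebra k A]

variable (k) in
/-- The embedding of left multiplications into the enveloping algebra. -/
noncomputable def inL : A →ₐ[k] A ⊗[k] Aᵐᵒᵖ := Algebra.TensorProduct.includeLeft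

variable (k) in
/-- The embedding of right multiplications into the enveloping algebra. -/
noncomputable def inR : Aᵐᵒᵖ →ₐ[k] A ⊗[k] Aᵐᵒᵖ := Algebra.TensorProduct.includeRight

theorem inL_mul_inR (a : A) (b : Aᵐᵒᵖ) : inL k a * inR k b = a ⊗ₜ[k] b := by
  simp [inL, inR]

theorem inR_mul_inL (a : A) (b : Aᵐᵒᵖ) : inR k b * inL k a = a ⊗ₜ[k] b := by
  simp [inL, inR]

theorem inL_comm_inR (a : A) (b : Aᵐᵒᵖ) : inL k a * inR k b = inR k b * inL k a := by
  rw [inL_mul_inR, inR_mul_inL]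

variable (k A) in
/-- The matrix representations of the enveloping algebra describing functors
`M ↦ V ⊗ M` for a bimodule `V` that is free of finite rank on the right. -/
structure IsMatRep {ι : Type} [Fintype ι] [DecidableEq ι] (φ : A ⊗[k] Aᵐᵒᵖ →+* Matrix ι ι (A ⊗[k] Aᵐᵒᵖ)) : Prop where
  right : ∀ b i j, φ (inR k b) i j = if i = j then inR k b else 0
  left : ∀ a i j, φ (inL k a) i j ∈ (inL k (A := A)).range

variable {ι κ : Type} [Fintype ι] [DecidableEq ι] [Fintype κ] [DecidableEq κ]

/-- The left regular representation, tensored with the enveloping algebra. -/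
noncomputable def regL (β : Module.Basis (Option κ) k A) :
    A →ₐ[k] Matrix (Option κ × ι) (Option κ × ι) (A ⊗[k] Aᵐᵒᵖ) where
  toFun a := blockDiagonal fun _ => (Algebra.leftMulMatrix β a).map (algebraMap k (A ⊗[k] Aᵐᵒᵖ))
  map_one' := by
    ext ⟨p, i⟩ ⟨q, j⟩
    by_cases h : p = q <;> by_cases h' : i = j <;> simp [blockDiagonal_apply, one_apply, h, h', Algebra.TensorProduct.one_def]
  map_mul' a b := by
    rw [← blockDiagonal_mul]
    congr
    ext i : 1
    simp [Matrix.map_mul]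
  map_zero' := by
    ext ⟨p, i⟩ ⟨q, j⟩
    simp [blockDiagonal_apply]
  map_add' a b := by
    ext ⟨p, i⟩ ⟨q, j⟩
    by_cases h' : i = j <;> simp [blockDiagonal_apply, h', TensorProduct.add_tmul]
  commutes' c := by
    ext ⟨p, i⟩ ⟨q, j⟩
    by_cases h : p = q <;> by_cases h' : i = j <;>
      simp [blockDiagonal_apply, algebraMap_matrix_apply, h, h']

theorem regL_apply (β : Module.Basis (Option κ) k A) (a : A) (p q : Option κ) (i j : ι) :
    regL β a (p, i) (q, j) =
      if i = j then algebraMap k (A ⊗[k] Aᵐᵒᵖ) (Algebra.leftMulMatrix β a p q) else 0 := rfl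

/-- The representation describing the functor `M ↦ A ⊗ M`. -/
noncomputable def reg (β : Module.Basis (Option κ) k A) (ι : Type) [Fintype ι] [DecidableEq ι] :
    A ⊗[k] Aᵐᵒᵖ →ₐ[k] Matrix (Option κ × ι) (Option κ × ι) (A ⊗[k] Aᵐᵒᵖ) :=
  Algebra.TensorProduct.lift (regL β) ((scalarAlgHom (Option κ × ι) k (α := A ⊗[k] Aᵐᵒᵖ)).comp (inR k))
    fun a b => by
      ext ⟨p, i⟩ ⟨q, j⟩
      by_cases h' : i = j
      · simpa [regL_apply, scalarAlgHom, h'] using Algebra.commutes (Algebra.leftMulMatrix β a p q) (inR k b)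
      · simp [regL_apply, scalarAlgHom, h']

theorem reg_inL (β : Module.Basis (Option κ) k A) (a : A) :
    reg β ι (inL k a) = regL β a := by
  exact (Algebra.TensorProduct.lift_tmul _ _ _ a 1).trans (by rw [map_one, mul_one])

theorem reg_inR (β : Module.Basis (Option κ) k A) (b : Aᵐᵒᵖ) :
    reg β ι (inR k b) = scalar _ (inR k b) := by
  exact (Algebra.TensorProduct.lift_tmul _ _ _ 1 b).trans (by rw [map_one, one_mul]; rfl)

theorem sum_leftMulMatrix_smul (β : Module.Basis (Option κ) k A) (a : A) (q : Option κ) :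
    ∑ p, Algebra.leftMulMatrix β a p q • β p = a * β q := by
  conv_rhs => rw [← β.sum_repr (a * β q)]
  simp [Algebra.leftMulMatrix_eq_repr_mul]

theorem env_induction {P : A ⊗[k] Aᵐᵒᵖ → Prop} (hL : ∀ a, P (inL k a)) (hR : ∀ b, P (inR k b))
    (hm : ∀ x y, P x → P y → P (x * y)) (ha : ∀ x y, P x → P y → P (x + y)) (l : A ⊗[k] Aᵐᵒᵖ) : P l := by
  induction l using TensorProduct.induction_on with
  | zero => simpa using hL 0
  | tmul a b => rw [← inL_mul_inR]; exact hm _ _ (hL a) (hR b)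
  | add x y hx hy => exact ha _ _ hx hy

/-- The matrix of the multiplication map. -/
noncomputable def mulMat (φ : A ⊗[k] Aᵐᵒᵖ →+* Matrix ι ι (A ⊗[k] Aᵐᵒᵖ)) (β : Module.Basis (Option κ) k A) :
    Matrix ι (Option κ × ι) (A ⊗[k] Aᵐᵒᵖ) := of fun i x => φ (inL k (β x.1)) i x.2

variable {φ : A ⊗[k] Aᵐᵒᵖ →+* Matrix ι ι (A ⊗[k] Aᵐᵒᵖ)}

theorem IsMatRep.commute (hφ : IsMatRep k A φ) (a : A) (b : Aᵐᵒᵖ) (i j : ι) :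
    φ (inL k a) i j * inR k b = inR k b * φ (inL k a) i j := by
  obtain ⟨c, hc⟩ := hφ.left a i j
  rw [← hc]
  exact inL_comm_inR c b

theorem mulMat_reg (hφ : IsMatRep k A φ) (β : Module.Basis (Option κ) k A) (l : A ⊗[k] Aᵐᵒᵖ) :
    mulMat φ β * reg β ι l = φ l * mulMat φ β := by
  induction l using env_induction with
  | hL a =>
    ext i ⟨q, j⟩
    rw [reg_inL]
    simp only [mul_apply, Fintype.sum_prod_type, mulMat, of_apply, regL_apply, mul_ite, mul_zero,
      Finset.sum_ite_eq', Finset.mem_univ, if_true]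
    rw [← mul_apply, ← map_mul φ, ← map_mul, ← sum_leftMulMatrix_smul β a q]
    have : ∀ (x : A) (c : k), φ (inL k (c • x)) i j = φ (inL k x) i j * algebraMap k (A ⊗[k] Aᵐᵒᵖ) c := by
      intro x c
      have h := hφ.right (algebraMap k Aᵐᵒᵖ c)
      have e : inL k (c • x) = inL k x * inR k (algebraMap k Aᵐᵒᵖ c) := by
        rw [AlgHom.commutes, map_smul]
        exact (Algebra.smul_def c (inL k x)).trans (Algebra.commutes c _)
      rw [e, map_mul, mul_apply]
      simp only [h, mul_ite, mul_zero, Finset.sum_ite_eq', Finset.mem_univ, if_true]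
      rw [AlgHom.commutes]
    simp only [map_sum, Matrix.sum_apply, this]
  | hR b =>
    ext i ⟨q, j⟩
    rw [reg_inR]
    simp only [scalar_apply, mul_apply, hφ.right, mulMat, of_apply, diagonal_apply, mul_ite, mul_zero,
      ite_mul, zero_mul, Finset.sum_ite_eq, Finset.sum_ite_eq', Finset.mem_univ, if_true]
    exact hφ.commute _ _ _ _
  | hm x y hx hy => rw [map_mul, map_mul, ← Matrix.mul_assoc, hx, Matrix.mul_assoc, hy, Matrix.mul_assoc]
  | ha x y hx hy => rw [map_add, map_add, Matrix.mul_add, Matrix.add_mul, hx, hy]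

/-- The matrix of the inclusion of the kernel of the multiplication map. -/
noncomputable def kerMat (φ : A ⊗[k] Aᵐᵒᵖ →+* Matrix ι ι (A ⊗[k] Aᵐᵒᵖ)) (β : Module.Basis (Option κ) k A) :
    Matrix (Option κ × ι) (κ × ι) (A ⊗[k] Aᵐᵒᵖ) := of fun x y =>
  x.1.elim (-φ (inL k (β (some y.1))) x.2 y.2) fun p => if p = y.1 ∧ x.2 = y.2 then 1 else 0

variable (k A ι κ)

/-- The projection of `A ⊗ V` onto the kernel of the multiplication map. -/
def projMat : Matrix (κ × ι) (Option κ × ι) (A ⊗[k] Aᵐᵒᵖ) := of fun y x =>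
  if x = (some y.1, y.2) then 1 else 0

/-- The section of the multiplication map. -/
def secMat : Matrix (Option κ × ι) ι (A ⊗[k] Aᵐᵒᵖ) := of fun x i => if x = (none, i) then 1 else 0

variable {k A ι κ} (β : Module.Basis (Option κ) k A)

theorem projMat_mul_kerMat : projMat k A ι κ * kerMat φ β = 1 := by
  ext ⟨p, i⟩ ⟨q, j⟩
  simp [projMat, kerMat, mul_apply, one_apply]

theorem mulMat_mul_secMat (h1 : β none = 1) : mulMat φ β * secMat k A ι κ = 1 := by
  ext i j
  simp [mulMat, secMat, mul_apply, h1]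

theorem mulMat_mul_kerMat (h1 : β none = 1) : mulMat φ β * kerMat φ β = 0 := by
  ext i ⟨q, j⟩
  simp [mulMat, kerMat, mul_apply, h1, Fintype.sum_prod_type, Fintype.sum_option, one_apply, ite_and]

theorem kerMat_mul_projMat_add (h1 : β none = 1) :
    kerMat φ β * projMat k A ι κ + secMat k A ι κ * mulMat φ β = 1 := by
  ext ⟨p, i⟩ ⟨q, j⟩
  cases p <;> cases q <;>
  simp [projMat, secMat, mulMat, kerMat, mul_apply, h1, Fintype.sum_prod_type, one_apply, ite_and]

end MatRep

section MatRep
set_option linter.unusedSectionVars false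
open Matrix

variable {k : Type u} [Field k] {A : Type u} [Ring A] [Algebra k A]
variable {ι κ : Type} [Fintype ι] [DecidableEq ι] [Fintype κ] [DecidableEq κ]
variable {φ : A ⊗[k] Aᵐᵒᵖ →+* Matrix ι ι (A ⊗[k] Aᵐᵒᵖ)}

theorem reg_mul_kerMat (hφ : IsMatRep k A φ) (β : Module.Basis (Option κ) k A) (h1 : β none = 1)
    (l : A ⊗[k] Aᵐᵒᵖ) :
    reg β ι l * kerMat φ β = kerMat φ β * (projMat k A ι κ * reg β ι l * kerMat φ β) := by
  have h := congrArg (· * (reg β ι l * kerMat φ β)) (kerMat_mul_projMat_add (φ := φ) β h1)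
  simp only [Matrix.add_mul, Matrix.one_mul] at h
  have h' : secMat k A ι κ * mulMat φ β * (reg β ι l * kerMat φ β) = 0 := by
    rw [Matrix.mul_assoc, ← Matrix.mul_assoc (mulMat φ β), mulMat_reg hφ, Matrix.mul_assoc,
      mulMat_mul_kerMat β h1, Matrix.mul_zero, Matrix.mul_zero]
  rw [h', add_zero] at h
  simpa only [Matrix.mul_assoc] using h.symm

/-- The representation describing the kernel of `A ⊗ V → V`. -/
noncomputable def kerRep (hφ : IsMatRep k A φ) (β : Module.Basis (Option κ) k A) (h1 : β none = 1) :
    A ⊗[k] Aᵐᵒᵖ →+* Matrix (κ × ι) (κ × ι) (A ⊗[k] Aᵐᵒᵖ) where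
  toFun l := projMat k A ι κ * reg β ι l * kerMat φ β
  map_one' := by rw [map_one, Matrix.mul_one, projMat_mul_kerMat]
  map_mul' x y := by
    rw [map_mul, Matrix.mul_assoc _ (_ * _), Matrix.mul_assoc (reg β ι x), reg_mul_kerMat hφ β h1 y]
    simp only [Matrix.mul_assoc]
  map_zero' := by rw [map_zero, Matrix.mul_zero, Matrix.zero_mul]
  map_add' x y := by rw [map_add, Matrix.mul_add, Matrix.add_mul]

theorem reg_mul_kerMat_eq (hφ : IsMatRep k A φ) (β : Module.Basis (Option κ) k A) (h1 : β none = 1)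
    (l : A ⊗[k] Aᵐᵒᵖ) :
    reg β ι l * kerMat φ β = kerMat φ β * kerRep hφ β h1 l :=
  reg_mul_kerMat hφ β h1 l

theorem kerMat_mem (hφ : IsMatRep k A φ) (β : Module.Basis (Option κ) k A)
    (x : Option κ × ι) (y : κ × ι) :
    kerMat φ β x y ∈ (inL k (A := A)).range := by
  obtain ⟨_ | p, i⟩ := x
  · simpa [kerMat] using hφ.left _ _ _
  · simp only [kerMat, of_apply, Option.elim]
    split_ifs
    exacts [one_mem _, zero_mem _]

theorem kerRep_isMatRep (hφ : IsMatRep k A φ) (β : Module.Basis (Option κ) k A) (h1 : β none = 1) :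
    IsMatRep k A (kerRep hφ β h1) where
  right b x y := by
    change (projMat k A ι κ * reg β ι (inR k b) * kerMat φ β) x y = _
    rw [Matrix.mul_assoc, mul_apply]
    simp only [projMat, of_apply, ite_mul, one_mul, zero_mul, Finset.sum_ite_eq', Finset.mem_univ, if_true]
    rw [mul_apply, reg_inR]
    simp only [scalar_apply, diagonal_apply, ite_mul, zero_mul, Finset.sum_ite_eq, Finset.mem_univ, if_true]
    simp only [kerMat, of_apply, Option.elim, mul_ite, mul_one, mul_zero, Prod.ext_iff]
  left a x y := by
    change (projMat k A ι κ * reg β ι (inL k a) * kerMat φ β) x y ∈ _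
    rw [mul_apply, reg_inL]
    refine sum_mem fun z _ => mul_mem ?_ (kerMat_mem hφ β z y)
    rw [mul_apply]
    refine sum_mem fun z' _ => mul_mem ?_ ?_
    · simp only [projMat, of_apply]
      split_ifs
      exacts [one_mem _, zero_mem _]
    · obtain ⟨p, i⟩ := z
      obtain ⟨q, j⟩ := z'
      rw [regL_apply]
      split_ifs
      exacts [Subalgebra.algebraMap_mem _ _, zero_mem _]

end MatRep

section MatRep
set_option linter.unusedSectionVars false
open Matrix CategoryTheory

variable {k : Type u} [Field k] {A : Type u} [Ring A] [Algebra k A]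
variable {ι κ : Type} [Fintype ι] [DecidableEq ι] [Fintype κ] [DecidableEq κ]
variable {φ : A ⊗[k] Aᵐᵒᵖ →+* Matrix ι ι (A ⊗[k] Aᵐᵒᵖ)} (hφ : IsMatRep k A φ)
  (β : Module.Basis (Option κ) k A) (h1 : β none = 1)

attribute [local instance] TensorProduct.Algebra.module

theorem inL_smul (a x : A) : inL k a • x = a * x := by
  change a • (1 : Aᵐᵒᵖ) • x = _
  rw [one_smul]; rfl

theorem inR_smul (b : Aᵐᵒᵖ) (x : A) : inR k b • x = x * b.unop := by
  change (1 : A) • b • x = _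
  rw [one_smul]; rfl

theorem env_zero_smul (x : A) : (0 : A ⊗[k] Aᵐᵒᵖ) • x = 0 :=
  (TensorProduct.Algebra.module : Module (A ⊗[k] Aᵐᵒᵖ) A).zero_smul x

theorem algebraMap_env_smul (c : k) (x : A) : algebraMap k (A ⊗[k] Aᵐᵒᵖ) c • x = c • x := by
  change algebraMap k A c • (1 : Aᵐᵒᵖ) • x = _
  rw [one_smul, algebraMap_smul]

variable (k A) in
/-- The regular bimodule. -/
noncomputable abbrev regBimod : ModuleCat.{u} (A ⊗[k] Aᵐᵒᵖ) := ModuleCat.of (A ⊗[k] Aᵐᵒᵖ) A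

variable (k) in
/-- The representation describing `M ↦ A ⊗ V ⊗ M` as a ring homomorphism. -/
noncomputable abbrev regHom (β : Module.Basis (Option κ) k A) (ι : Type) [Fintype ι] [DecidableEq ι] :
    A ⊗[k] Aᵐᵒᵖ →+* Matrix (Option κ × ι) (Option κ × ι) (A ⊗[k] Aᵐᵒᵖ) :=
  { toFun := reg β ι, map_one' := map_one _, map_mul' := map_mul _, map_zero' := map_zero _, map_add' := map_add _ }

/-- `A ⊗ V` is a free bimodule. -/
noncomputable def regEquiv (β : Module.Basis (Option κ) k A) :
    ((matFunctor (regHom k β ι)).obj (regBimod k A)) ≃+ (ι → A ⊗[k] Aᵐᵒᵖ) where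
  toFun := fun v : Option κ × ι → A => fun i => ∑ p, β p ⊗ₜ MulOpposite.op (v (p, i))
  invFun w := ((fun x => (TensorProduct.equivFinsuppOfBasisLeft β (w x.2) x.1).unop) : Option κ × ι → A)
  left_inv := by
    intro (v : Option κ × ι → A)
    funext x
    simp only [map_sum, Finsupp.coe_finsetSum, Finset.sum_apply,
      TensorProduct.equivFinsuppOfBasisLeft_apply_tmul_apply, Module.Basis.repr_self,
      Finsupp.single_apply, ite_smul, one_smul, zero_smul, Finset.sum_ite_eq', Finset.mem_univ, if_true,
      MulOpposite.unop_op]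
  right_inv w := by
    funext i
    refine Eq.trans ?_ ((TensorProduct.equivFinsuppOfBasisLeft β).symm_apply_apply (w i))
    rw [TensorProduct.equivFinsuppOfBasisLeft_symm_apply, Finsupp.sum_fintype _ _ (by simp)]
    rfl
  map_add' := by
    intro (v : Option κ × ι → A) (w : Option κ × ι → A)
    funext i
    change ∑ p, β p ⊗ₜ MulOpposite.op (v (p, i) + w (p, i)) = _
    simp [TensorProduct.tmul_add, Finset.sum_add_distrib]

theorem regEquiv_smul (β : Module.Basis (Option κ) k A) (l : A ⊗[k] Aᵐᵒᵖ)
    (v : (matFunctor (regHom k β ι)).obj (regBimod k A)) :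
    regEquiv β (l • v) = fun i => l * regEquiv β v i := by
  induction l using env_induction generalizing v with
  | hL a =>
    funext i
    have h : ∀ p, ∑ y, (reg β ι (inL k a) (p, i) y • (v : Option κ × ι → A) y : A) =
        ∑ q, Algebra.leftMulMatrix β a p q • (v : Option κ × ι → A) (q, i) := by
      intro p
      rw [Fintype.sum_prod_type]
      refine Finset.sum_congr rfl fun q _ => (Finset.sum_eq_single i ?_ (by simp)).trans ?_
      · intro y _ hy
        rw [reg_inL, regL_apply, if_neg hy.symm]
        exact env_zero_smul _
      · rw [reg_inL, regL_apply, if_pos rfl]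
        exact algebraMap_env_smul _ _
    refine (Finset.sum_congr rfl fun p _ =>
      congrArg (fun x => β p ⊗ₜ[k] MulOpposite.op x) (h p)).trans ?_
    change _ = inL k a * ∑ p, β p ⊗ₜ MulOpposite.op ((v : Option κ × ι → A) (p, i))
    simp only [Finset.op_sum, MulOpposite.op_smul,
      TensorProduct.tmul_sum, TensorProduct.tmul_smul]
    rw [Finset.sum_comm, Finset.mul_sum]
    refine Finset.sum_congr rfl fun q _ => ?_
    simp only [TensorProduct.smul_tmul']
    rw [← TensorProduct.sum_tmul, sum_leftMulMatrix_smul]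
    simp [inL]
  | hR b =>
    funext i
    have h : ∀ p, ∑ y, (reg β ι (inR k b) (p, i) y • (v : Option κ × ι → A) y : A) =
        (v : Option κ × ι → A) (p, i) * b.unop := by
      intro p
      refine (Finset.sum_eq_single (p, i) ?_ (by simp)).trans ?_
      · intro y _ hy
        rw [reg_inR, scalar_apply, diagonal_apply, if_neg hy.symm]
        exact env_zero_smul _
      · rw [reg_inR, scalar_apply, diagonal_apply, if_pos rfl]
        exact inR_smul _ _
    refine (Finset.sum_congr rfl fun p _ =>
      congrArg (fun x => β p ⊗ₜ[k] MulOpposite.op x) (h p)).trans ?_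
    change _ = inR k b * ∑ p, β p ⊗ₜ MulOpposite.op ((v : Option κ × ι → A) (p, i))
    rw [Finset.mul_sum]
    exact Finset.sum_congr rfl fun p _ => by simp [inR]
  | hm x y hx hy => rw [mul_smul, hx, hy]; exact funext fun i => (mul_assoc x y _).symm
  | ha x y hx hy => rw [add_smul, map_add, hx, hy]; exact funext fun i => (add_mul x y _).symm

theorem projective_of_addEquiv {Λ : Type u} [Ring Λ] {M : Type u} [AddCommGroup M] [Module Λ M]
    (e : M ≃+ (ι → Λ)) (h : ∀ l v, e (l • v) = fun i => l * e v i) : Module.Projective Λ M :=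
  .of_equiv ({ e with map_smul' := h } : M ≃ₗ[Λ] (ι → Λ)).symm

theorem regBimod_projective : Projective ((matFunctor (regHom k β ι)).obj (regBimod k A)) := by
  have h := projective_of_addEquiv (regEquiv β (ι := ι)) (regEquiv_smul β)
  exact ModuleCat.projective_of_categoryTheory_projective _

end MatRep

section MatRep
set_option linter.unusedSectionVars false
open Matrix CategoryTheory Abelian

section
variable {Λ : Type u} [Ring Λ]

/-- A one-dimensional matrix representation does not change a module. -/
noncomputable def unitTrans : matFunctor (scalar Unit : Λ →+* Matrix Unit Unit Λ) ⟶ 𝟭 (ModuleCat.{u} Λ) where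
  app M := ModuleCat.ofHom (X := (matFunctor (scalar Unit : Λ →+* Matrix Unit Unit Λ)).obj M) (Y := M)
    { toFun := fun v : Unit → M => v ()
      map_add' := fun _ _ => rfl
      map_smul' := fun l (v : Unit → M) => by
        change ∑ j, scalar Unit l () j • v j = l • v ()
        simp }

instance (M : ModuleCat.{u} Λ) : IsIso (unitTrans.app M) := by
  refine (ConcreteCategory.isIso_iff_bijective _).mpr ⟨?_, fun m => ⟨(fun _ => m : Unit → M), rfl⟩⟩
  intro (v : Unit → M) (w : Unit → M) (h : v () = w ())
  exact funext fun _ => h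
end

variable {k : Type u} [Field k] {A : Type u} [Ring A] [Algebra k A]
variable {ι κ : Type} [Fintype ι] [DecidableEq ι] [Fintype κ] [DecidableEq κ]

theorem isMatRep_scalar : IsMatRep k A (scalar Unit) where
  right b i j := by rw [scalar_apply, diagonal_apply]
  left a i j := by
    rw [scalar_apply, diagonal_apply]
    split_ifs
    exacts [⟨a, rfl⟩, zero_mem _]

variable {φ : A ⊗[k] Aᵐᵒᵖ →+* Matrix ι ι (A ⊗[k] Aᵐᵒᵖ)}

attribute [local instance] TensorProduct.Algebra.module

/-- A bimodule map `V ⊗ A → A` as a row vector. -/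
noncomputable def rowMat (f : (matFunctor φ).obj (regBimod k A) ⟶ regBimod k A) :
    Matrix Unit ι (A ⊗[k] Aᵐᵒᵖ) :=
  of fun _ j => inL k (f.hom (Pi.single j 1 : ι → A))

theorem sum_hom_single (hφ : IsMatRep k A φ)
    (f : (matFunctor φ).obj (regBimod k A) ⟶ regBimod k A) (v : ι → A) :
    ∑ j, (f.hom (Pi.single j 1 : ι → A) : A) * v j = f.hom v := by
  have h : ∀ j, (f.hom (Pi.single j 1 : ι → A) : A) * v j = f.hom (Pi.single j (v j) : ι → A) := by
    intro j
    refine ((inR_smul (k := k) (MulOpposite.op (v j)) _).symm.trans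
      (f.hom.map_smul (inR k (MulOpposite.op (v j))) _).symm).trans (congrArg _ ?_)
    funext i
    change ∑ l, (φ (inR k (MulOpposite.op (v j))) i l • (Pi.single j 1 : ι → A) l : A) = (Pi.single j (v j) : ι → A) i
    refine (Finset.sum_eq_single i ?_ (by simp)).trans ?_
    · intro l _ hl
      rw [hφ.right, if_neg hl.symm]
      exact env_zero_smul _
    · rw [hφ.right, if_pos rfl]
      refine (inR_smul _ _).trans ?_
      by_cases h : i = j
      · subst h; simp
      · simp [h]
  rw [Finset.sum_congr rfl fun j _ => h j]
  refine (map_sum f.hom (fun j => (Pi.single j (v j) : ι → A)) _).symm.trans (congrArg _ ?_)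
  exact Finset.univ_sum_single v

theorem rowMat_mul (hφ : IsMatRep k A φ)
    (f : (matFunctor φ).obj (regBimod k A) ⟶ regBimod k A)
    (l : A ⊗[k] Aᵐᵒᵖ) : rowMat f * φ l = scalar Unit l * rowMat f := by
  induction l using env_induction with
  | hL a =>
    ext i j
    choose c hc using hφ.left a
    rw [mul_apply, mul_apply]
    have e : ∀ l, rowMat f i l * φ (inL k a) l j = inL k ((f.hom (Pi.single l 1 : ι → A) : A) * c l j) := by
      intro l
      rw [map_mul]
      exact congrArg _ (hc l j).symm
    rw [Finset.sum_congr rfl fun l _ => e l, ← map_sum, sum_hom_single hφ f fun l => c l j]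
    have e' : (fun l => c l j : ι → A) = fun i => ∑ l, (φ (inL k a) i l • (Pi.single j 1 : ι → A) l : A) := by
      funext i
      refine Eq.symm ((Finset.sum_eq_single j ?_ (by simp)).trans ?_)
      · intro l _ hl
        rw [Pi.single_eq_of_ne hl]
        exact smul_zero _
      · rw [Pi.single_eq_same, ← hc]
        exact (inL_smul _ _).trans (mul_one _)
    have e'' : (f.hom (fun l => c l j : ι → A) : A) = a * f.hom (Pi.single j 1 : ι → A) :=
      (congrArg f.hom e').trans ((f.hom.map_smul (inL k a) _).trans (inL_smul _ _))
    refine (congrArg (inL k) e'').trans ((map_mul _ _ _).trans ?_)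
    refine Eq.symm ((Fintype.sum_unique _).trans ?_)
    rw [scalar_apply, diagonal_apply]
    rfl
  | hR b =>
    ext i j
    rw [mul_apply, mul_apply]
    refine (Finset.sum_eq_single j ?_ (by simp)).trans ?_
    · intro l _ hl
      rw [hφ.right, if_neg hl]
      exact mul_zero _
    · rw [hφ.right, if_pos rfl]
      refine Eq.trans ?_ (Fintype.sum_unique _).symm
      rw [scalar_apply, diagonal_apply]
      exact inL_comm_inR _ _
  | hm x y hx hy => rw [map_mul, map_mul, ← Matrix.mul_assoc, hx, Matrix.mul_assoc, hy, Matrix.mul_assoc]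
  | ha x y hx hy => rw [map_add, map_add, Matrix.mul_add, Matrix.add_mul, hx, hy]

theorem rowMat_trans_app (hφ : IsMatRep k A φ)
    (f : (matFunctor φ).obj (regBimod k A) ⟶ regBimod k A) :
   
    (matTrans (rowMat f) (rowMat_mul hφ f) ≫ unitTrans).app (regBimod k A) = f := by
  ext (v : ι → A)
  refine Eq.trans ?_ (sum_hom_single hφ f v)
  exact Finset.sum_congr rfl fun j _ => inL_smul (A := A) _ (v j)

/-- A class in `Ext (V ⊗ A) A` extends to a family of classes in `Ext (V ⊗ M) M` that is natural
up to sign. -/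
theorem exists_extClass_family (hφ : IsMatRep k A φ) (β : Module.Basis (Option κ) k A) (h1 : β none = 1)
    [HasExt.{w} (ModuleCat.{u} (A ⊗[k] Aᵐᵒᵖ))] {m : ℕ}
    (x : Ext.{w} ((matFunctor φ).obj (regBimod k A)) (regBimod k A) m) :
    ∃ X : ∀ M, Ext.{w} ((matFunctor φ).obj M) M m, X (regBimod k A) = x ∧
      ∀ (M N : ModuleCat.{u} (A ⊗[k] Aᵐᵒᵖ)) (n p : ℕ) (e : Ext.{w} M N n) (h : n + m = p) (h' : m + n = p),
        (e.mapExactFunctor (matFunctor φ)).comp (X N) h = (-1 : ℤ) ^ (m * n) • (X M).comp e h' := by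
  induction m generalizing ι φ with
  | zero =>
    obtain ⟨f, rfl⟩ := Ext.homEquiv₀.symm.surjective x
    refine ⟨fun M => Ext.mk₀ ((matTrans (rowMat f) (rowMat_mul hφ f) ≫ unitTrans).app M), ?_, ?_⟩
    · exact congrArg Ext.mk₀ (rowMat_trans_app hφ f)
    · intro M N n p e h h'
      obtain rfl : n = p := by omega
      rw [zero_mul, pow_zero, one_smul]
      exact map_comp_app _ _ e
  | succ m ih =>
    have hS := matTrans_shortExact (mulMat φ β) (fun l => mulMat_reg hφ (β := β) l)
      (φ := φ) (ψ := regHom k β ι) (χ := kerRep hφ β h1) (kerMat φ β) (fun l => (reg_mul_kerMat_eq hφ β h1 l).symm)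
      (mulMat_mul_kerMat β h1) (projMat k A ι κ) (secMat k A ι κ) (projMat_mul_kerMat β)
      (mulMat_mul_secMat β h1) (kerMat_mul_projMat_add β h1)
    obtain ⟨x', rfl⟩ := Ext.contravariant_sequence_exact₃ (hS (regBimod k A)) _ x
      (have := regBimod_projective (k := k) (ι := ι) β
       Ext.eq_zero_of_projective _) (Nat.add_comm 1 m)
    obtain ⟨X, rfl, hX⟩ := ih (kerRep_isMatRep hφ β h1) x'
    refine ⟨fun M => (hS M).extClass.comp (X M) (Nat.add_comm 1 m), rfl, ?_⟩
    intro M N n p e h h'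
    rw [← Ext.comp_assoc _ _ _ (rfl : n + 1 = n + 1) (Nat.add_comm 1 m) (by omega),
      map_comp_extClass hS e rfl (Nat.add_comm 1 n), zsmul_comp,
      Ext.comp_assoc _ _ _ (Nat.add_comm 1 n) (rfl : n + m = n + m) (by omega),
      hX M N n _ e rfl (Nat.add_comm m n), comp_zsmul, smul_smul, ← pow_add,
      ← Ext.comp_assoc _ _ _ (Nat.add_comm 1 m) (Nat.add_comm m n) (by omega)]
    congr 2
    ring

end MatRep

section MatRep
open Matrix CategoryTheory Abelian

variable (k : Type u) [Field k] {A : Type u} [Ring A] [Algebra k A]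

attribute [local instance] TensorProduct.Algebra.module

theorem exists_basis_one [Module.Finite k A] [Nontrivial A] :
    ∃ (n : ℕ) (β : Module.Basis (Option (Fin n)) k A), β none = 1 := by
  obtain ⟨N, hN⟩ := Submodule.exists_isCompl (k ∙ (1 : A))
  have b := Module.finBasis k N
  refine ⟨_, (Module.Basis.mkFinCons (1 : A) b ?_ ?_).reindex (finSuccEquiv _), ?_⟩
  · intro c x hx h
    have h0 := (Submodule.disjoint_def.mp hN.disjoint) x
      (Submodule.mem_span_singleton.mpr ⟨-c, by rw [neg_smul, ← add_eq_zero_iff_neg_eq, h]⟩) hx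
    rw [h0, add_zero] at h
    exact (smul_eq_zero.mp h).resolve_right one_ne_zero
  · intro z
    obtain ⟨y, hy, x, hx, rfl⟩ := Submodule.mem_sup.mp (hN.sup_eq_top ▸ Submodule.mem_top (x := z))
    obtain ⟨c, rfl⟩ := Submodule.mem_span_singleton.mp hy
    exact ⟨-c, by simpa⟩
  · simp [Module.Basis.coe_mkFinCons]

variable {k}

/-- Graded commutativity of the Hochschild cohomology of a finite dimensional algebra. -/
theorem ext_comp_comm [Module.Finite k A] [HasExt.{w} (ModuleCat.{u} (A ⊗[k] Aᵐᵒᵖ))] {m n p : ℕ}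
    (h : m + n = p) (h' : n + m = p)
    (x : Ext.{w} (regBimod k A) (regBimod k A) m) (y : Ext.{w} (regBimod k A) (regBimod k A) n) :
    y.comp x h' = (-1 : ℤ) ^ (m * n) • x.comp y h := by
  cases subsingleton_or_nontrivial A
  · have : Limits.IsZero (regBimod k A) := ModuleCat.isZero_of_subsingleton _
    exact Subsingleton.elim (h := ⟨fun a b => by
      rw [← Ext.mk₀_id_comp a, ← Ext.mk₀_id_comp b, this.eq_of_src (𝟙 _) 0]; simp⟩) _ _
  obtain ⟨_, β, h1⟩ := exists_basis_one k (A := A)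
  obtain ⟨X, hX, hX'⟩ := exists_extClass_family isMatRep_scalar β h1
    ((Ext.mk₀ (unitTrans.app (regBimod k A))).comp x (zero_add m))
  have e := hX' _ _ n p y h' h
  rw [hX, ← Ext.comp_assoc _ _ _ (add_zero n) (zero_add m) (by omega), map_comp_app,
    Ext.comp_assoc _ _ _ (zero_add n) h' (by omega), Ext.comp_assoc _ _ _ (zero_add m) h (by omega),
    ← comp_zsmul] at e
  have e' := congrArg (fun z => (Ext.mk₀ (inv (unitTrans.app (regBimod k A)))).comp z (zero_add p)) e
  simp only [← Ext.comp_assoc _ _ _ (zero_add 0) (zero_add p) (by omega : 0 + 0 + p = p), Ext.mk₀_comp_mk₀, IsIso.inv_hom_id,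
    Ext.mk₀_id_comp] at e'
  simpa using e'

end MatRep

section Paths
set_option linter.unusedSectionVars false
variable (K : Type u) [Field K] (s : ℕ)

theorem mk_rel {x y : F K s} (h : Rel K s x y) :
    RingQuot.mkAlgHom K (Rel K s) x = RingQuot.mkAlgHom K (Rel K s) y :=
  RingQuot.mkAlgHom_rel K h

/-- The trivial path at an integer position. -/
noncomputable def vert (v : ℤ) : Alg K s := ee K s (v : ZMod (6 * s))

/-- The arrow with label `l` (`0, 1, 2` for `α`, `3, 4, 5` for `β`, `6` for `γ`) in block `t`. -/
noncomputable def arrow (t : ℤ) : ℕ → Alg K s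
  | 0 => aa K s ((3 * t : ℤ) : ZMod (3 * s))
  | 1 => aa K s ((3 * t + 1 : ℤ) : ZMod (3 * s))
  | 2 => aa K s ((3 * t + 2 : ℤ) : ZMod (3 * s))
  | 3 => bb K s ((3 * t : ℤ) : ZMod (3 * s))
  | 4 => bb K s ((3 * t + 1 : ℤ) : ZMod (3 * s))
  | 5 => bb K s ((3 * t + 2 : ℤ) : ZMod (3 * s))
  | _ => gg K s ((t : ℤ) : ZMod s)

/-- The source of an arrow, relative to its block. -/
def asrc : ℕ → ℤ
  | 0 => 0 | 1 => 1 | 2 => 2 | 3 => 0 | 4 => 3 | 5 => 4 | _ => 5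

/-- The target of an arrow, relative to its block. -/
def atgt : ℕ → ℤ
  | 0 => 1 | 1 => 2 | 2 => 5 | 3 => 3 | 4 => 4 | 5 => 5 | _ => 6

variable {s}

theorem intCast_eq_of_dvd {n : ℕ} {a b : ℤ} (h : ∃ q, b = a + n * q) : (a : ZMod n) = b := by
  obtain ⟨q, rfl⟩ := h
  simp

theorem exists_val_intCast (n : ℕ) [NeZero n] (a : ℤ) :
    ∃ q : ℤ, a = ((a : ZMod n).val : ℤ) + n * q :=
  ⟨a / n, by rw [ZMod.val_intCast, Int.emod_add_mul_ediv]⟩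

variable [NeZero s]

theorem exists_val_three_mul (t : ℤ) (j : ℕ) (hj : j < 3) :
    ∃ q : ℤ, 3 * t + j = ((((3 * t + j : ℤ) : ZMod (3 * s)).val : ℕ) : ℤ) + 3 * (s * q) ∧
      ((3 * t + j : ℤ) : ZMod (3 * s)).val % 3 = j := by
  obtain ⟨q, hq⟩ := exists_val_intCast (3 * s) (3 * t + j)
  generalize ((3 * t + j : ℤ) : ZMod (3 * s)).val = N at hq ⊢
  have h : ((3 * s : ℕ) : ℤ) * q = 3 * (s * q) := by push_cast; ring
  rw [h] at hq
  exact ⟨q, hq, by omega⟩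

theorem intCast_eq_of_add {a b p : ℤ} (q : ℤ) (hp : p = s * q) (h : b = a + 6 * p) :
    (a : ZMod (6 * s)) = b :=
  intCast_eq_of_dvd ⟨q, by rw [h, hp]; push_cast; ring⟩

theorem aSrc_intCast (t : ℤ) (j : ℕ) (hj : j < 3) :
    aSrc s ((3 * t + j : ℤ) : ZMod (3 * s)) = ((6 * t + j : ℤ) : ZMod (6 * s)) := by
  obtain ⟨q, hq, h⟩ := exists_val_three_mul (s := s) t j hj
  rw [aSrc]
  generalize ((3 * t + j : ℤ) : ZMod (3 * s)).val = N at hq h ⊢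
  rw [← Int.cast_natCast]
  generalize hp : (s : ℤ) * q = p at hq
  refine intCast_eq_of_add q hp.symm ?_
  omega

theorem bSrc_intCast (t : ℤ) (j : ℕ) (hj : j < 3) :
    bSrc s ((3 * t + j : ℤ) : ZMod (3 * s)) =
      ((6 * t + (if j = 0 then 0 else j + 2) : ℤ) : ZMod (6 * s)) := by
  obtain ⟨q, hq, h⟩ := exists_val_three_mul (s := s) t j hj
  rw [bSrc]
  generalize ((3 * t + j : ℤ) : ZMod (3 * s)).val = N at hq h ⊢
  rw [← apply_ite (Nat.cast : ℕ → ZMod (6 * s)), ← Int.cast_natCast]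
  generalize hp : (s : ℤ) * q = p at hq
  refine intCast_eq_of_add q hp.symm ?_
  split_ifs <;> omega

theorem aTgt_intCast (t : ℤ) (j : ℕ) (hj : j < 3) :
    aTgt s ((3 * t + j : ℤ) : ZMod (3 * s)) =
      ((6 * t + (if j = 2 then 5 else j + 1) : ℤ) : ZMod (6 * s)) := by
  obtain ⟨q, hq, h⟩ := exists_val_three_mul (s := s) t j hj
  rw [aTgt]
  generalize ((3 * t + j : ℤ) : ZMod (3 * s)).val = N at hq h ⊢
  rw [← apply_ite (Nat.cast : ℕ → ZMod (6 * s)), ← Int.cast_natCast]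
  generalize hp : (s : ℤ) * q = p at hq
  refine intCast_eq_of_add q hp.symm ?_
  split_ifs <;> omega

theorem bTgt_intCast (t : ℤ) (j : ℕ) (hj : j < 3) :
    bTgt s ((3 * t + j : ℤ) : ZMod (3 * s)) = ((6 * t + j + 3 : ℤ) : ZMod (6 * s)) := by
  obtain ⟨q, hq, h⟩ := exists_val_three_mul (s := s) t j hj
  rw [bTgt]
  generalize ((3 * t + j : ℤ) : ZMod (3 * s)).val = N at hq h ⊢
  rw [← Int.cast_natCast]
  generalize hp : (s : ℤ) * q = p at hq
  refine intCast_eq_of_add q hp.symm ?_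
  omega

theorem gSrc_intCast (t : ℤ) : gSrc s (t : ZMod s) = ((6 * t + 5 : ℤ) : ZMod (6 * s)) := by
  obtain ⟨q, hq⟩ := exists_val_intCast s t
  rw [gSrc]
  generalize (t : ZMod s).val = N at hq ⊢
  rw [← Int.cast_natCast]
  generalize hp : (s : ℤ) * q = p at hq
  refine intCast_eq_of_add q hp.symm ?_
  omega

theorem gTgt_intCast (t : ℤ) : gTgt s (t : ZMod s) = ((6 * t + 6 : ℤ) : ZMod (6 * s)) := by
  obtain ⟨q, hq⟩ := exists_val_intCast s t
  rw [gTgt]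
  generalize (t : ZMod s).val = N at hq ⊢
  rw [← Int.cast_natCast]
  generalize hp : (s : ℤ) * q = p at hq
  refine intCast_eq_of_add q hp.symm ?_
  omega

theorem vert_mul_vert (u v : ℤ) :
    vert K s u * vert K s v = if (u : ZMod (6 * s)) = v then vert K s u else 0 := by
  have h := mk_rel K s (Rel.idem (K := K) (s := s) u v)
  rw [map_mul, apply_ite (RingQuot.mkAlgHom K (Rel K s)), map_zero] at h
  exact h

theorem vert_mul_self (u : ℤ) : vert K s u * vert K s u = vert K s u := by
  rw [vert_mul_vert, if_pos rfl]

theorem vert_mul_arrow (t : ℤ) (l : ℕ) : vert K s (6 * t + atgt l) * arrow K s t l = arrow K s t l := by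
  have ha (j : ℕ) (hj : j < 3) :
      ee K s ((6 * t + (if j = 2 then 5 else j + 1) : ℤ) : ZMod (6 * s)) *
        aa K s ((3 * t + j : ℤ) : ZMod (3 * s)) = aa K s ((3 * t + j : ℤ) : ZMod (3 * s)) := by
    have h := mk_rel K s (Rel.a_tgt (K := K) (s := s) ((3 * t + j : ℤ) : ZMod (3 * s)))
    rw [map_mul, aTgt_intCast t j hj] at h
    exact h
  have hb (j : ℕ) (hj : j < 3) :
      ee K s ((6 * t + j + 3 : ℤ) : ZMod (6 * s)) *
        bb K s ((3 * t + j : ℤ) : ZMod (3 * s)) = bb K s ((3 * t + j : ℤ) : ZMod (3 * s)) := by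
    have h := mk_rel K s (Rel.b_tgt (K := K) (s := s) ((3 * t + j : ℤ) : ZMod (3 * s)))
    rw [map_mul, bTgt_intCast t j hj] at h
    exact h
  match l with
  | 0 => simpa [vert, arrow, atgt] using ha 0 (by lia)
  | 1 => simpa [vert, arrow, atgt] using ha 1 (by lia)
  | 2 => simpa [vert, arrow, atgt] using ha 2 (by lia)
  | 3 => simpa [vert, arrow, atgt] using hb 0 (by lia)
  | 4 => simpa [vert, arrow, atgt, add_assoc] using hb 1 (by lia)
  | 5 => simpa [vert, arrow, atgt, add_assoc] using hb 2 (by lia)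
  | l + 6 =>
    have h := mk_rel K s (Rel.g_tgt (K := K) (s := s) (t : ZMod s))
    rw [map_mul, gTgt_intCast t] at h
    exact h

theorem arrow_mul_vert (t : ℤ) (l : ℕ) : arrow K s t l * vert K s (6 * t + asrc l) = arrow K s t l := by
  have ha (j : ℕ) (hj : j < 3) :
      aa K s ((3 * t + j : ℤ) : ZMod (3 * s)) * ee K s ((6 * t + j : ℤ) : ZMod (6 * s)) =
        aa K s ((3 * t + j : ℤ) : ZMod (3 * s)) := by
    have h := mk_rel K s (Rel.a_src (K := K) (s := s) ((3 * t + j : ℤ) : ZMod (3 * s)))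
    rw [map_mul, aSrc_intCast t j hj] at h
    exact h
  have hb (j : ℕ) (hj : j < 3) :
      bb K s ((3 * t + j : ℤ) : ZMod (3 * s)) *
        ee K s ((6 * t + (if j = 0 then 0 else j + 2) : ℤ) : ZMod (6 * s)) =
        bb K s ((3 * t + j : ℤ) : ZMod (3 * s)) := by
    have h := mk_rel K s (Rel.b_src (K := K) (s := s) ((3 * t + j : ℤ) : ZMod (3 * s)))
    rw [map_mul, bSrc_intCast t j hj] at h
    exact h
  match l with
  | 0 => simpa [vert, arrow, asrc] using ha 0 (by lia)
  | 1 => simpa [vert, arrow, asrc] using ha 1 (by lia)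
  | 2 => simpa [vert, arrow, asrc] using ha 2 (by lia)
  | 3 => simpa [vert, arrow, asrc] using hb 0 (by lia)
  | 4 => simpa [vert, arrow, asrc] using hb 1 (by lia)
  | 5 => simpa [vert, arrow, asrc] using hb 2 (by lia)
  | l + 6 =>
    have h := mk_rel K s (Rel.g_src (K := K) (s := s) (t : ZMod s))
    rw [map_mul, gSrc_intCast t] at h
    exact h

theorem arrow_add (t : ℤ) (l : ℕ) : arrow K s (t + s) l = arrow K s t l := by
  have h (j : ℤ) : ((3 * (t + s) + j : ℤ) : ZMod (3 * s)) = ((3 * t + j : ℤ) : ZMod (3 * s)) :=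
    intCast_eq_of_dvd ⟨-1, by push_cast; ring⟩
  have h0 := h 0
  rw [add_zero, add_zero] at h0
  match l with
  | 0 => exact congrArg (aa K s) h0
  | 1 => exact congrArg (aa K s) (h 1)
  | 2 => exact congrArg (aa K s) (h 2)
  | 3 => exact congrArg (bb K s) h0
  | 4 => exact congrArg (bb K s) (h 1)
  | 5 => exact congrArg (bb K s) (h 2)
  | l + 6 => exact congrArg (gg K s) (intCast_eq_of_dvd ⟨-1, by ring⟩)

theorem arrow_add_mul (t q : ℤ) (l : ℕ) : arrow K s (t + s * q) l = arrow K s t l := by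
  induction q using Int.induction_on with
  | zero => simp
  | succ i ih => rw [← ih, mul_add, mul_one, ← add_assoc, arrow_add]
  | pred i ih => rw [← ih, ← arrow_add K (t + s * (-i - 1)) l]; congr 1; ring

theorem vert_add_mul (v q : ℤ) : vert K s (v + 6 * s * q) = vert K s v :=
  congrArg (ee K s) (intCast_eq_of_dvd ⟨-q, by push_cast; ring⟩)

theorem arrow_of_val (t : ℤ) : ∃ t' : Fin s, ∃ q : ℤ, t = (t' : ℕ) + s * q := by
  obtain ⟨q, hq⟩ := exists_val_intCast s t
  exact ⟨⟨_, ZMod.val_lt _⟩, q, hq⟩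

theorem arrow_comm (t : ℤ) :
    arrow K s t 5 * (arrow K s t 4 * arrow K s t 3) =
      arrow K s t 2 * (arrow K s t 1 * arrow K s t 0) := by
  obtain ⟨t', q, rfl⟩ := arrow_of_val (s := s) t
  simp only [arrow_add_mul]
  have h := mk_rel K s (Rel.comm (K := K) (s := s) t')
  simp only [map_mul] at h
  simp only [← mul_assoc]
  simpa [arrow, aa, bb] using h.symm

theorem arrow_agb (t : ℤ) : arrow K s (t + 1) 0 * (arrow K s t 6 * arrow K s t 5) = 0 := by
  obtain ⟨t', q, rfl⟩ := arrow_of_val (s := s) t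
  rw [add_right_comm]
  simp only [arrow_add_mul]
  have h := mk_rel K s (Rel.zero_agb (K := K) (s := s) t')
  simp only [map_mul, map_zero] at h
  simp only [← mul_assoc]
  simpa [arrow, mul_add, aa, bb, gg] using h

theorem arrow_bga (t : ℤ) : arrow K s (t + 1) 3 * (arrow K s t 6 * arrow K s t 2) = 0 := by
  obtain ⟨t', q, rfl⟩ := arrow_of_val (s := s) t
  rw [add_right_comm]
  simp only [arrow_add_mul]
  have h := mk_rel K s (Rel.zero_bga (K := K) (s := s) t')
  simp only [map_mul, map_zero] at h
  simp only [← mul_assoc]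
  simpa [arrow, mul_add, aa, bb, gg] using h

theorem exists_arrow (t : ℤ) (l : ℕ) :
    ∃ x ∈ arrows K s, RingQuot.mkAlgHom K (Rel K s) x = arrow K s t l := by
  match l with
  | 0 => exact ⟨_, Or.inl (Or.inl ⟨_, rfl⟩), rfl⟩
  | 1 => exact ⟨_, Or.inl (Or.inl ⟨_, rfl⟩), rfl⟩
  | 2 => exact ⟨_, Or.inl (Or.inl ⟨_, rfl⟩), rfl⟩
  | 3 => exact ⟨_, Or.inl (Or.inr ⟨_, rfl⟩), rfl⟩
  | 4 => exact ⟨_, Or.inl (Or.inr ⟨_, rfl⟩), rfl⟩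
  | 5 => exact ⟨_, Or.inl (Or.inr ⟨_, rfl⟩), rfl⟩
  | l + 6 => exact ⟨_, Or.inr ⟨_, rfl⟩, rfl⟩

theorem arrow_len5 (t₁ t₂ t₃ t₄ t₅ : ℤ) (l₁ l₂ l₃ l₄ l₅ : ℕ) :
    arrow K s t₁ l₁ * (arrow K s t₂ l₂ * (arrow K s t₃ l₃ * (arrow K s t₄ l₄ * arrow K s t₅ l₅))) =
      0 := by
  obtain ⟨x₁, h₁, e₁⟩ := exists_arrow (s := s) K t₁ l₁
  obtain ⟨x₂, h₂, e₂⟩ := exists_arrow (s := s) K t₂ l₂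
  obtain ⟨x₃, h₃, e₃⟩ := exists_arrow (s := s) K t₃ l₃
  obtain ⟨x₄, h₄, e₄⟩ := exists_arrow (s := s) K t₄ l₄
  obtain ⟨x₅, h₅, e₅⟩ := exists_arrow (s := s) K t₅ l₅
  have h := mk_rel K s (Rel.len5 x₁ x₂ x₃ x₄ x₅ h₁ h₂ h₃ h₄ h₅)
  simp only [map_mul, map_zero, e₁, e₂, e₃, e₄, e₅] at h
  simpa only [mul_assoc] using h

theorem sum_vert : ∑ i ∈ Finset.range (6 * s), vert K s i = 1 := by
  have h := mk_rel K s (Rel.sum_one (K := K) (s := s))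
  rw [map_one, map_sum] at h
  rw [← h]
  refine Finset.sum_congr rfl fun i _ => ?_
  simp [vert, ee]

/-- The algebra `R_s` is generated by its trivial paths and arrows. -/
theorem gen_induction {p : Alg K s → Prop} (hv : ∀ v, p (vert K s v)) (ha : ∀ t l, l < 7 → p (arrow K s t l))
    (hc : ∀ c : K, p (algebraMap K (Alg K s) c)) (hm : ∀ x y, p x → p y → p (x * y))
    (hadd : ∀ x y, p x → p y → p (x + y)) (x : Alg K s) : p x := by
  obtain ⟨x, rfl⟩ := RingQuot.mkAlgHom_surjective K (Rel K s) x
  have h3 (i : ZMod (3 * s)) : ∃ (t : ℤ) (j : ℕ), j < 3 ∧ i = ((3 * t + j : ℤ) : ZMod (3 * s)) :=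
    ⟨(i.val / 3 : ℕ), i.val % 3, by lia, by
      have h : (3 * (i.val / 3 : ℕ) + (i.val % 3 : ℕ) : ℤ) = (i.val : ℤ) := by lia
      rw [h, Int.cast_natCast, ZMod.natCast_zmod_val]⟩
  induction x using FreeAlgebra.induction with
  | grade0 r => rw [AlgHom.commutes]; exact hc r
  | grade1 g =>
    cases g with
    | e i =>
      have := hv (i.val : ℤ)
      rw [vert, Int.cast_natCast, ZMod.natCast_zmod_val] at this
      exact this
    | a i =>
      obtain ⟨t, j, hj, rfl⟩ := h3 i
      have := ha t j (by lia)
      interval_cases j <;> simpa [arrow, aa, A] using this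
    | b i =>
      obtain ⟨t, j, hj, rfl⟩ := h3 i
      have := ha t (j + 3) (by lia)
      interval_cases j <;> simpa [arrow, bb, B] using this
    | g i =>
      have : p (gg K s ((i.val : ℤ) : ZMod s)) := ha (i.val : ℤ) 6 (by lia)
      rw [ Int.cast_natCast, ZMod.natCast_zmod_val] at this
      exact this
  | mul a b ha hb => rw [map_mul]; exact hm _ _ ha hb
  | add a b ha hb => rw [map_add]; exact hadd _ _ ha hb

end Paths

section PathBasis
set_option linter.unusedSectionVars false

/-- There is a nonzero path from position `x` to position `y` of the universal cover. -/
def con (x y : ℤ) : Prop :=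
  0 ≤ y - x ∧ y - x ≤ 6 ∧ ¬(x % 6 = 1 ∧ 2 ≤ y - x ∧ y - x ≤ 3) ∧
    ¬(x % 6 = 2 ∧ 1 ≤ y - x ∧ y - x ≤ 2) ∧ ¬(x % 6 = 3 ∧ 4 ≤ y - x ∧ y - x ≤ 5) ∧
    ¬(x % 6 = 4 ∧ 3 ≤ y - x ∧ y - x ≤ 4)

instance (x y : ℤ) : Decidable (con x y) := by unfold con; infer_instance

theorem con_add (x y k : ℤ) : con (x + 6 * k) (y + 6 * k) ↔ con x y := by
  unfold con
  have h : (x + 6 * k) % 6 = x % 6 := by omega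
  rw [h, show y + 6 * k - (x + 6 * k) = y - x by ring]

theorem con_add' (x y k : ℤ) : con (6 * k + x) (6 * k + y) ↔ con x y := by
  rw [add_comm, add_comm (6 * k), con_add]

theorem con_self (x : ℤ) : con x x := by
  unfold con
  omega

/-- The arrows, last one first, of a chosen nonzero path from `r` to `y`; the arrow with label `l` in
block `b` has code `7 * b + l`. -/
def word : ℕ → ℕ → List ℕ
  | 0, 1 => [0] | 0, 2 => [1, 0] | 0, 3 => [3] | 0, 4 => [4, 3] | 0, 5 => [2, 1, 0]
  | 0, 6 => [6, 2, 1, 0]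
  | 1, 2 => [1] | 1, 5 => [2, 1] | 1, 6 => [6, 2, 1] | 1, 7 => [7, 6, 2, 1]
  | 2, 5 => [2] | 2, 6 => [6, 2] | 2, 7 => [7, 6, 2] | 2, 8 => [8, 7, 6, 2]
  | 3, 4 => [4] | 3, 5 => [5, 4] | 3, 6 => [6, 5, 4] | 3, 9 => [10, 6, 5, 4]
  | 4, 5 => [5] | 4, 6 => [6, 5] | 4, 9 => [10, 6, 5] | 4, 10 => [11, 10, 6, 5]
  | 5, 6 => [6] | 5, 7 => [7, 6] | 5, 8 => [8, 7, 6] | 5, 9 => [10, 6] | 5, 10 => [11, 10, 6]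
  | 5, 11 => [9, 8, 7, 6]
  | _, _ => []

variable (K : Type u) [Field K] (s : ℕ)

/-- The product of the arrows with the codes in `w`, counted from block `t`. -/
noncomputable def wordPath (t : ℤ) (r : ℕ) (w : List ℕ) : Alg K s :=
  w.foldr (fun m x => arrow K s (t + (m / 7 : ℕ)) (m % 7) * x) (vert K s (6 * t + r))

/-- The nonzero path between two positions of the universal cover, or `0`. -/
noncomputable def ptz (u v : ℤ) : Alg K s :=
  if con u v then wordPath K s (u / 6) (u % 6).toNat
    (word (u % 6).toNat (v - 6 * (u / 6)).toNat) else 0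

theorem ptz_eq (t : ℤ) (r y : ℕ) (hr : r < 6) :
    ptz K s (6 * t + r) (6 * t + y) = if con r y then wordPath K s t r (word r y) else 0 := by
  have h1 : (6 * t + r) / 6 = t := by omega
  have h2 : ((6 * t + r) % 6).toNat = r := by omega
  have h3 : (6 * t + y - 6 * t : ℤ).toNat = y := by omega
  rw [ptz, h1, h2, h3]
  simp only [con_add']

variable {s} in
theorem ptz_of_not {u v : ℤ} (h : ¬con u v) : ptz K s u v = 0 := if_neg h

theorem word_self (r : ℕ) (hr : r < 6) : word r r = [] := by
  interval_cases r <;> rfl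

theorem ptz_self (u : ℤ) : ptz K s u u = vert K s u := by
  have h := ptz_eq K s (u / 6) (u % 6).toNat (u % 6).toNat (by omega)
  rw [show 6 * (u / 6) + ((u % 6).toNat : ℤ) = u by omega, if_pos (con_self _),
    word_self _ (by omega)] at h
  rw [h, wordPath, List.foldr_nil]
  congr 1
  omega

set_option synthInstance.maxSize 2000 in
set_option synthInstance.maxHeartbeats 1000000 in
theorem word_step : ∀ r : ℕ, r < 6 → ∀ l < 7, ∀ b < 2, con r (6 * (b : ℕ) + asrc l) →
    let m := 7 * b + l
    let w := word r (6 * (b : ℕ) + asrc l).toNat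
    let w' := word r (6 * (b : ℕ) + atgt l).toNat
    (con r (6 * (b : ℕ) + atgt l) ∧ (w' = m :: w ∨ ∃ k < 2, m = 7 * k + 5 ∧
      w = (7 * k + 4) :: (7 * k + 3) :: w.drop 2 ∧
      w' = (7 * k + 2) :: (7 * k + 1) :: (7 * k) :: w.drop 2)) ∨
    (¬con r (6 * (b : ℕ) + atgt l) ∧ (w.length = 4 ∨
      (∃ k < 2, m = 7 * (k + 1) ∧ w = (7 * k + 6) :: (7 * k + 5) :: w.drop 2) ∨
      (∃ k < 2, m = 7 * (k + 1) + 3 ∧ w = (7 * k + 6) :: (7 * k + 2) :: w.drop 2))) := by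
  decide

theorem wordPath_cons (t : ℤ) (r k l : ℕ) (hl : l < 7) (w : List ℕ) :
    wordPath K s t r ((7 * k + l) :: w) = arrow K s (t + k) l * wordPath K s t r w := by
  rw [wordPath, List.foldr_cons, show (7 * k + l) / 7 = k by lia, show (7 * k + l) % 7 = l by lia]
  rfl

variable [NeZero s]

theorem arrow_mul_ptz_aux (t : ℤ) (r l b : ℕ) (hr : r < 6) (hl : l < 7) (hb : b < 2)
    (h : con r (6 * (b : ℕ) + asrc l)) :
    arrow K s (t + b) l * wordPath K s t r (word r (6 * (b : ℕ) + asrc l).toNat) =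
      if con r (6 * (b : ℕ) + atgt l) then
        wordPath K s t r (word r (6 * (b : ℕ) + atgt l).toNat) else 0 := by
  have key := word_step r hr l hl b hb h
  rw [← wordPath_cons K s t r b l hl]
  generalize 7 * b + l = m at key ⊢
  generalize word r (6 * (b : ℕ) + asrc l).toNat = w at key ⊢
  generalize word r (6 * (b : ℕ) + atgt l).toNat = w' at key ⊢
  rcases key with ⟨h, h' | ⟨k, -, h1, h2, h3⟩⟩ | ⟨h, h' | ⟨k, -, h1, h2⟩ | ⟨k, -, h1, h2⟩⟩
  · rw [if_pos h, h']
  · generalize w.drop 2 = w₂ at h2 h3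
    rw [if_pos h, h3, h1, h2, wordPath_cons _ _ _ _ _ _ (by lia), wordPath_cons _ _ _ _ _ _ (by lia),
      wordPath_cons _ _ _ _ _ _ (by lia), wordPath_cons _ _ _ _ _ _ (by lia),
      wordPath_cons _ _ _ _ _ _ (by lia), ← add_zero (7 * k), wordPath_cons _ _ _ _ _ _ (by lia)]
    have := congrArg (· * wordPath K s t r w₂) (arrow_comm K (s := s) (t + k))
    simpa only [mul_assoc] using this
  · rw [if_neg h]
    obtain ⟨a, b, c, d, rfl⟩ := List.length_eq_four.mp h'
    simp only [wordPath, List.foldr_cons, List.foldr_nil]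
    have := congrArg (· * vert K s (6 * t + r)) (arrow_len5 K (s := s) (t + (m / 7 : ℕ)) (t + (a / 7 : ℕ))
      (t + (b / 7 : ℕ)) (t + (c / 7 : ℕ)) (t + (d / 7 : ℕ)) (m % 7) (a % 7) (b % 7) (c % 7) (d % 7))
    simpa only [mul_assoc, zero_mul] using this
  · rw [if_neg h, h1, h2, ← add_zero (7 * (k + 1)), wordPath_cons _ _ _ _ _ _ (by lia),
      wordPath_cons _ _ _ _ _ _ (by lia), wordPath_cons _ _ _ _ _ _ (by lia)]
    have := congrArg (· * wordPath K s t r (w.drop 2)) (arrow_agb K (s := s) (t + k))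
    simpa only [mul_assoc, zero_mul, Nat.cast_add, Nat.cast_one, add_assoc] using this
  · rw [if_neg h, h1, h2, wordPath_cons _ _ _ _ _ _ (by lia),
      wordPath_cons _ _ _ _ _ _ (by lia), wordPath_cons _ _ _ _ _ _ (by lia)]
    have := congrArg (· * wordPath K s t r (w.drop 2)) (arrow_bga K (s := s) (t + k))
    simpa only [mul_assoc, zero_mul, Nat.cast_add, Nat.cast_one, add_assoc] using this

theorem asrc_nonneg (l : ℕ) : 0 ≤ asrc l ∧ asrc l < 6 := by
  unfold asrc; split <;> omega

theorem atgt_bound (l : ℕ) : asrc l < atgt l ∧ atgt l ≤ 6 := by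
  unfold asrc atgt; split <;> omega

theorem arrow_mul_ptz (t u : ℤ) (l : ℕ) (hl : l < 7) (h : con u (6 * t + asrc l)) :
    arrow K s t l * ptz K s u (6 * t + asrc l) = ptz K s u (6 * t + atgt l) := by
  obtain ⟨t', r, hr, rfl⟩ : ∃ (t' : ℤ) (r : ℕ), r < 6 ∧ u = 6 * t' + r :=
    ⟨u / 6, (u % 6).toNat, by omega, by omega⟩
  have h0 := asrc_nonneg l
  have h0' := atgt_bound l
  obtain ⟨b, hb, rfl⟩ : ∃ b : ℕ, b < 2 ∧ t = t' + b := by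
    have h1 := h.1
    have h2 := h.2.1
    exact ⟨(t - t').toNat, by omega, by omega⟩
  have e1 : 6 * (t' + b) + asrc l = 6 * t' + (((6 * (b : ℕ) + asrc l).toNat : ℕ) : ℤ) := by omega
  have e2 : 6 * (t' + b) + atgt l = 6 * t' + (((6 * (b : ℕ) + atgt l).toNat : ℕ) : ℤ) := by omega
  have e3 : 6 * (t' + b) + asrc l = 6 * t' + (6 * (b : ℕ) + asrc l) := by ring
  rw [e3, con_add'] at h
  rw [e1, e2, ptz_eq _ _ _ _ _ hr, ptz_eq _ _ _ _ _ hr]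
  rw [Int.toNat_of_nonneg (by omega), Int.toNat_of_nonneg (by omega), if_pos h]
  exact arrow_mul_ptz_aux K s t' r l b hr hl hb h

theorem exists_last_arrow {u v : ℤ} (h : con u v) (hne : u ≠ v) :
    ∃ (t : ℤ) (l : ℕ), l < 7 ∧ v = 6 * t + atgt l ∧ con u (6 * t + asrc l) := by
  have key : ∀ l < 7, (v - atgt l) % 6 = 0 → con u (v - atgt l + asrc l) →
      ∃ (t : ℤ) (l : ℕ), l < 7 ∧ v = 6 * t + atgt l ∧ con u (6 * t + asrc l) := by
    intro l hl h1 h2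
    refine ⟨(v - atgt l) / 6, l, hl, by omega, ?_⟩
    rwa [show 6 * ((v - atgt l) / 6) = v - atgt l by omega]
  have h5 : v % 6 = 0 ∨ v % 6 = 1 ∨ v % 6 = 2 ∨ v % 6 = 3 ∨ v % 6 = 4 ∨
      (v % 6 = 5 ∧ con u (v - 3)) ∨ (v % 6 = 5 ∧ con u (v - 1)) := by
    unfold con at h ⊢; omega
  unfold con at h
  rcases h5 with h5 | h5 | h5 | h5 | h5 | h5 | h5
  · exact key 6 (by lia) (by simp only [atgt]; omega) (by simp only [atgt, asrc, con]; omega)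
  · exact key 0 (by lia) (by simp only [atgt]; omega) (by simp only [atgt, asrc, con]; omega)
  · exact key 1 (by lia) (by simp only [atgt]; omega) (by simp only [atgt, asrc, con]; omega)
  · exact key 3 (by lia) (by simp only [atgt]; omega) (by simp only [atgt, asrc, con]; omega)
  · exact key 4 (by lia) (by simp only [atgt]; omega) (by simp only [atgt, asrc, con]; omega)
  · exact key 2 (by lia) (by simp only [atgt]; omega)
      (by simp only [atgt, asrc]; convert h5.2 using 1; ring)
  · exact key 5 (by lia) (by simp only [atgt]; omega)
      (by simp only [atgt, asrc]; convert h5.2 using 1; ring)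

set_option synthInstance.maxSize 2000 in
set_option synthInstance.maxHeartbeats 1000000 in
theorem con_of_last_aux : ∀ r < 6, ∀ d < 7, ∀ e < 7, ∀ l < 7,
    ((r + d + e : ℕ) - atgt l : ℤ) % 6 = 0 → con (r : ℕ) (r + d : ℕ) →
    con (r + d : ℕ) ((r + d + e : ℕ) - atgt l + asrc l) → con (r : ℕ) (r + d + e : ℕ) →
    con (r + d : ℕ) (r + d + e : ℕ) → con (r : ℕ) ((r + d + e : ℕ) - atgt l + asrc l) := by
  decide +kernel

theorem con_of_last {u v : ℤ} {t : ℤ} {l : ℕ} (hl : l < 7) (h : con u v)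
    (h1 : con v (6 * t + asrc l)) (h2 : con u (6 * t + atgt l)) (h3 : con v (6 * t + atgt l)) :
    con u (6 * t + asrc l) := by
  have b1 := h.1
  have b2 := h.2.1
  have b3 := h3.1
  have b4 := h3.2.1
  have key := con_of_last_aux (u % 6).toNat (by omega) (v - u).toNat (by omega)
    (6 * t + atgt l - v).toNat (by omega) l hl
  have e1 : (((u % 6).toNat : ℕ) : ℤ) = u + 6 * (-(u / 6)) := by omega
  have e2 : (((u % 6).toNat + (v - u).toNat : ℕ) : ℤ) = v + 6 * (-(u / 6)) := by omega
  have e3 : (((u % 6).toNat + (v - u).toNat + (6 * t + atgt l - v).toNat : ℕ) : ℤ) =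
      6 * t + atgt l + 6 * (-(u / 6)) := by omega
  rw [e1, e2, e3, show 6 * t + atgt l + 6 * (-(u / 6)) - atgt l + asrc l =
    6 * t + asrc l + 6 * (-(u / 6)) by ring] at key
  simp only [con_add] at key
  exact key (by omega) h h1 h2 h3

theorem vert_mul_ptz (u v : ℤ) : vert K s v * ptz K s u v = ptz K s u v := by
  by_cases h : con u v
  · rcases eq_or_ne u v with rfl | hne
    · rw [ptz_self, vert_mul_self]
    · obtain ⟨t, l, hl, rfl, h'⟩ := exists_last_arrow h hne
      rw [← arrow_mul_ptz K s t u l hl h', ← mul_assoc, vert_mul_arrow]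
  · rw [ptz_of_not K h, mul_zero]

theorem ptz_mul_ptz {u v : ℤ} (h : con u v) (w : ℤ) (h' : con v w) :
    ptz K s v w * ptz K s u v = ptz K s u w := by
  obtain ⟨n, hn⟩ : ∃ n : ℕ, w - v = n := ⟨(w - v).toNat, by have := h'.1; omega⟩
  induction n using Nat.strong_induction_on generalizing w with
  | _ n ih =>
    rcases eq_or_ne v w with rfl | hne
    · rw [ptz_self, vert_mul_ptz]
    · obtain ⟨t, l, hl, rfl, h1⟩ := exists_last_arrow h' hne
      have h0' := atgt_bound l
      have h2 := ih (6 * t + asrc l - v).toNat (by have := h1.1; omega) (6 * t + asrc l) h1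
        (by have := h1.1; omega)
      rw [← arrow_mul_ptz K s t v l hl h1, mul_assoc, h2]
      by_cases h3 : con u (6 * t + asrc l)
      · exact arrow_mul_ptz K s t u l hl h3
      · rw [ptz_of_not K h3, mul_zero, ptz_of_not]
        exact fun h4 => h3 (con_of_last hl h h1 h4 h')

theorem ptz_mul_vert (u v : ℤ) : ptz K s u v * vert K s u = ptz K s u v := by
  by_cases h : con u v
  · rw [← ptz_self, ptz_mul_ptz K s (con_self u) v h]
  · rw [ptz_of_not K h, zero_mul]

theorem ptz_add (u v q : ℤ) : ptz K s (u + 6 * s * q) (v + 6 * s * q) = ptz K s u v := by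
  have e (x : ℤ) : x + 6 * s * q = x + 6 * (s * q) := by ring
  simp only [ptz, e, con_add]
  have h1 : (u + 6 * (s * q)) / 6 = u / 6 + s * q := by omega
  have h2 : (u + 6 * (s * q)) % 6 = u % 6 := by omega
  have h3 : v + 6 * (s * q) - 6 * (u / 6 + s * q) = v - 6 * (u / 6) := by ring
  rw [h1, h2, h3]
  congr 1
  simp only [wordPath]
  congr 1
  · funext m x
    rw [add_right_comm, arrow_add_mul]
  · rw [← vert_add_mul K (6 * (u / 6) + _) q]
    congr 1
    ring

end PathBasis

section Spanning
set_option linter.unusedSectionVars false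
variable (K : Type u) [Field K] (s : ℕ) [NeZero s]

theorem vert_mul_ptz_eq (a u v : ℤ) :
    vert K s a * ptz K s u v = if (a : ZMod (6 * s)) = v then ptz K s u v else 0 := by
  rw [← vert_mul_ptz, ← mul_assoc, vert_mul_vert]
  split_ifs with h
  · rw [show vert K s a = vert K s v from congrArg (ee K s) h]
  · rw [zero_mul]

theorem exists_eq_add_of_cast_eq {a b : ℤ} (h : (a : ZMod (6 * s)) = b) :
    ∃ q : ℤ, b = a + 6 * s * q := by
  rw [ZMod.intCast_eq_intCast_iff_dvd_sub] at h
  obtain ⟨q, hq⟩ := h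
  push_cast at hq
  exact ⟨q, by rw [← hq]; ring⟩

theorem arrow_mul_ptz_eq (t : ℤ) (l : ℕ) (hl : l < 7) (u v : ℤ) :
    arrow K s t l * ptz K s u v = 0 ∨ ∃ u' v', arrow K s t l * ptz K s u v = ptz K s u' v' := by
  by_cases h : ((6 * t + asrc l : ℤ) : ZMod (6 * s)) = v
  · obtain ⟨q, rfl⟩ := exists_eq_add_of_cast_eq s h
    have h1 := ptz_add K s (u - 6 * s * q) (6 * t + asrc l) q
    rw [sub_add_cancel] at h1
    rw [h1]
    by_cases h2 : con (u - 6 * s * q) (6 * t + asrc l)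
    · exact Or.inr ⟨_, _, arrow_mul_ptz K s t _ l hl h2⟩
    · exact Or.inl (by rw [ptz_of_not K h2, mul_zero])
  · left
    rw [← arrow_mul_vert, mul_assoc, vert_mul_ptz_eq, if_neg h, mul_zero]

theorem span_ptz : Submodule.span K (Set.range fun p : ℤ × ℤ => ptz K s p.1 p.2) = ⊤ := by
  set P := Submodule.span K (Set.range fun p : ℤ × ℤ => ptz K s p.1 p.2) with hP
  have hmem (u v : ℤ) : ptz K s u v ∈ P := Submodule.subset_span ⟨(u, v), rfl⟩
  have hgen (x : Alg K s) (hx : ∀ u v, x * ptz K s u v ∈ P) (y : Alg K s) (hy : y ∈ P) :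
      x * y ∈ P := by
    have : P ≤ P.comap (LinearMap.mulLeft K x) := by
      rw [hP, Submodule.span_le]
      rintro _ ⟨p, rfl⟩
      exact hx p.1 p.2
    exact this hy
  have hmul (x : Alg K s) : ∀ y ∈ P, x * y ∈ P := by
    induction x using gen_induction with
    | hv a =>
      refine hgen _ fun u v => ?_
      rw [vert_mul_ptz_eq]
      split_ifs
      · exact hmem _ _
      · exact zero_mem _
    | ha t l hl =>
      refine hgen _ fun u v => ?_
      rcases arrow_mul_ptz_eq K s t l hl u v with h | ⟨u', v', h⟩
      · rw [h]; exact zero_mem _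
      · rw [h]; exact hmem _ _
    | hc c =>
      intro y hy
      have := P.smul_mem c hy
      rwa [Algebra.smul_def] at this
    | hm x x' h h' => intro y hy; rw [mul_assoc]; exact h _ (h' _ hy)
    | hadd x x' h h' => intro y hy; rw [add_mul]; exact add_mem (h _ hy) (h' _ hy)
  rw [eq_top_iff]
  rintro x -
  rw [← mul_one x]
  refine hmul x _ ?_
  rw [← sum_vert]
  refine sum_mem fun i _ => ?_
  rw [← ptz_self]
  exact hmem _ _

theorem ptz_induction {p : Alg K s → Prop} (h : ∀ u v, con u v → p (ptz K s u v))
    (hc : ∀ (c : K) x, p x → p (c • x)) (h0 : p 0) (hadd : ∀ x y, p x → p y → p (x + y))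
    (x : Alg K s) : p x := by
  have hx : x ∈ Submodule.span K (Set.range fun p : ℤ × ℤ => ptz K s p.1 p.2) := by
    rw [span_ptz]; trivial
  induction hx using Submodule.span_induction with
  | mem x hx =>
    obtain ⟨⟨u, v⟩, rfl⟩ := hx
    by_cases h1 : con u v
    · exact h u v h1
    · simp only [ptz_of_not K h1]; exact h0
  | zero => exact h0
  | add x y _ _ hx hy => exact hadd x y hx hy
  | smul c x _ hx => exact hc c x hx

instance finite_alg : Module.Finite K (Alg K s) := by
  classical
  refine ⟨⟨(Finset.range (6 * s) ×ˢ Finset.range 7).image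
    fun p => ptz K s (p.1 : ℤ) ((p.1 : ℤ) + (p.2 : ℤ)), ?_⟩⟩
  rw [eq_top_iff, ← span_ptz K s, Submodule.span_le]
  rintro _ ⟨⟨u, v⟩, rfl⟩
  by_cases h1 : con u v
  · refine Submodule.subset_span ?_
    have hs : (0 : ℤ) < 6 * s := by have := NeZero.pos s; omega
    have h2 := h1.1
    have h3 := h1.2.1
    have h4 := Int.emod_add_mul_ediv u (6 * s)
    have h5 := Int.emod_nonneg u hs.ne'
    have h6 := Int.emod_lt_of_pos u hs
    simp only [Finset.coe_image, Set.mem_image, Finset.mem_coe, Finset.mem_product,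
      Finset.mem_range]
    refine ⟨((u % (6 * s)).toNat, (v - u).toNat), ⟨by omega, by omega⟩, ?_⟩
    simp only
    rw [← ptz_add K s _ _ (u / (6 * s)), Int.toNat_of_nonneg h5, Int.toNat_of_nonneg h2]
    congr 1; linarith
  · simp only [ptz_of_not K h1]
    exact zero_mem _

end Spanning

section Representation
set_option linter.unusedSectionVars false
variable (K : Type u) [Field K] (s : ℕ)

open Classical in
/-- Move functions along the steps `y - d y → y` that satisfy `m`. -/
noncomputable def stepAct (m : ℤ → Prop) (d : ℤ → ℤ) :
    (ℤ → ℤ → K) →ₗ[K] (ℤ → ℤ → K) where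
  toFun f x y := if m y ∧ con x y ∧ con x (y - d y) then f x (y - d y) else 0
  map_add' f g := by
    funext x y
    simp only [Pi.add_apply]
    split_ifs <;> simp
  map_smul' c f := by
    funext x y
    simp only [Pi.smul_apply, RingHom.id_apply]
    split_ifs <;> simp

/-- Restrict functions to the positions over the vertex `i`. -/
def vertAct (i : ZMod (6 * s)) : (ℤ → ℤ → K) →ₗ[K] (ℤ → ℤ → K) where
  toFun f x y := if (y : ZMod (6 * s)) = i then f x y else 0
  map_add' f g := by
    funext x y
    simp only [Pi.add_apply]
    split_ifs <;> simp
  map_smul' c f := by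
    funext x y
    simp only [Pi.smul_apply, RingHom.id_apply]
    split_ifs <;> simp

/-- `y` is the target of the arrow `αᵢ`. -/
def isATgt (i : ZMod (3 * s)) (y : ℤ) : Prop :=
  ∃ l : ℕ, l < 3 ∧ y % 6 = (if l = 2 then 5 else l + 1) ∧ ((3 * (y / 6) + l : ℤ) : ZMod (3 * s)) = i

/-- `y` is the target of the arrow `βᵢ`. -/
def isBTgt (i : ZMod (3 * s)) (y : ℤ) : Prop :=
  ∃ l : ℕ, l < 3 ∧ y % 6 = l + 3 ∧ ((3 * (y / 6) + l : ℤ) : ZMod (3 * s)) = i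

/-- `y` is the target of the arrow `γᵢ`. -/
def isGTgt (i : ZMod s) (y : ℤ) : Prop := y % 6 = 0 ∧ ((y / 6 - 1 : ℤ) : ZMod s) = i

/-- The action of the generators on functions on pairs of positions. -/
noncomputable def genAct : Gen s → Module.End K (ℤ → ℤ → K)
  | .e i => vertAct K s i
  | .a i => stepAct K (isATgt s i) fun y => if y % 6 = 5 then 3 else 1
  | .b i => stepAct K (isBTgt s i) fun y => if y % 6 = 3 then 3 else 1
  | .g i => stepAct K (isGTgt s i) fun _ => 1

variable {K} in
theorem stepAct_ne_zero {m : ℤ → Prop} {d : ℤ → ℤ} {f : ℤ → ℤ → K} {x y : ℤ}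
    (h : stepAct K m d f x y ≠ 0) :
    m y ∧ con x y ∧ con x (y - d y) ∧ f x (y - d y) ≠ 0 := by
  classical
  have h' : (if m y ∧ con x y ∧ con x (y - d y) then f x (y - d y) else 0) ≠ 0 := h
  split_ifs at h' with h1
  · exact ⟨h1.1, h1.2.1, h1.2.2, h'⟩
  · exact absurd rfl h'

/-- The number of arrows from position `0`. -/
def lev (x : ℤ) : ℤ :=
  4 * (x / 6) + if x % 6 = 0 then 0 else if x % 6 = 1 ∨ x % 6 = 3 then 1 else
    if x % 6 = 5 then 3 else 2

theorem lev_le {x y : ℤ} (h : con x y) : lev x ≤ lev y ∧ lev y ≤ lev x + 4 := by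
  unfold con at h
  unfold lev
  omega

/-- The action of an arrow, extracted from the free algebra. -/
theorem arrows_act {x : F K s} (hx : x ∈ arrows K s) (f : ℤ → ℤ → K) (a y : ℤ)
    (h : FreeAlgebra.lift K (genAct K s) x f a y ≠ 0) :
    ∃ y', con a y ∧ con a y' ∧ lev y' + 1 = lev y ∧ f a y' ≠ 0 := by
  rcases hx with (⟨i, rfl⟩ | ⟨i, rfl⟩) | ⟨i, rfl⟩
  · rw [A, FreeAlgebra.lift_ι_apply] at h
    obtain ⟨⟨l, hl, h1, -⟩, h2, h3, h4⟩ := stepAct_ne_zero h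
    refine ⟨_, h2, h3, ?_, h4⟩
    unfold lev
    split_ifs at h1 ⊢ <;> omega
  · rw [B, FreeAlgebra.lift_ι_apply] at h
    obtain ⟨⟨l, hl, h1, -⟩, h2, h3, h4⟩ := stepAct_ne_zero h
    refine ⟨_, h2, h3, ?_, h4⟩
    unfold lev
    split_ifs <;> omega
  · rw [G, FreeAlgebra.lift_ι_apply] at h
    obtain ⟨⟨h1, -⟩, h2, h3, h4⟩ := stepAct_ne_zero h
    refine ⟨_, h2, h3, ?_, h4⟩
    unfold lev
    split_ifs <;> omega

end Representation

section RepRelations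
set_option linter.unusedSectionVars false
variable (K : Type u) [Field K] (s : ℕ)

theorem vertAct_apply (i : ZMod (6 * s)) (f : ℤ → ℤ → K) (x y : ℤ) :
    vertAct K s i f x y = if (y : ZMod (6 * s)) = i then f x y else 0 := rfl

theorem stepAct_of {m : ℤ → Prop} {d : ℤ → ℤ} (f : ℤ → ℤ → K) {x y : ℤ} (h : m y) (h1 : con x y)
    (h2 : con x (y - d y)) : stepAct K m d f x y = f x (y - d y) :=
  if_pos ⟨h, h1, h2⟩

theorem vertAct_comp_stepAct {m : ℤ → Prop} {d : ℤ → ℤ} {i : ZMod (6 * s)}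
    (h : ∀ y, m y → (y : ZMod (6 * s)) = i) :
    vertAct K s i * stepAct K m d = stepAct K m d := by
  ext f x y
  rw [Module.End.mul_apply, vertAct_apply]
  split_ifs with hy
  · rfl
  · by_contra h0
    exact hy (h y (stepAct_ne_zero (Ne.symm h0)).1)

theorem stepAct_comp_vertAct {m : ℤ → Prop} {d : ℤ → ℤ} {i : ZMod (6 * s)}
    (h : ∀ y, m y → ((y - d y : ℤ) : ZMod (6 * s)) = i) :
    stepAct K m d * vertAct K s i = stepAct K m d := by
  classical
  ext f x y
  rw [Module.End.mul_apply]
  change (if m y ∧ con x y ∧ con x (y - d y) then vertAct K s i f x (y - d y) else 0) =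
    if m y ∧ con x y ∧ con x (y - d y) then f x (y - d y) else 0
  split_ifs with h1
  · rw [vertAct_apply, if_pos (h y h1.1)]
  · rfl

variable {s} in
theorem three_mul_add_cast (a b : ℤ) (l j : ℕ) (hl : l < 3) (hj : j < 3)
    (h : ((3 * a + l : ℤ) : ZMod (3 * s)) = ((3 * b + j : ℤ) : ZMod (3 * s))) :
    l = j ∧ (a : ZMod s) = b := by
  rw [ZMod.intCast_eq_intCast_iff_dvd_sub] at h
  obtain ⟨q, hq⟩ := h
  have e : ((3 * s : ℕ) : ℤ) * q = 3 * (s * q) := by push_cast; ring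
  rw [e] at hq
  have e2 : l = j := by omega
  subst e2
  exact ⟨rfl, intCast_eq_of_dvd ⟨q, by linarith⟩⟩

variable {s} in
theorem three_mul_cast {a b : ℤ} (h : (a : ZMod s) = b) (j : ℤ) :
    ((3 * a + j : ℤ) : ZMod (3 * s)) = ((3 * b + j : ℤ) : ZMod (3 * s)) := by
  rw [ZMod.intCast_eq_intCast_iff_dvd_sub] at h
  obtain ⟨q, hq⟩ := h
  exact intCast_eq_of_dvd ⟨q, by push_cast; linarith⟩

theorem isATgt_iff (b : ℤ) (l : ℕ) (hl : l < 3) (y : ℤ) :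
    isATgt s ((3 * b + l : ℤ) : ZMod (3 * s)) y ↔
      y % 6 = (if l = 2 then 5 else l + 1) ∧ ((y / 6 : ℤ) : ZMod s) = b := by
  constructor
  · rintro ⟨j, hj, h1, h2⟩
    obtain ⟨rfl, h⟩ := three_mul_add_cast _ _ _ _ hj hl h2
    exact ⟨h1, h⟩
  · rintro ⟨h1, h2⟩
    exact ⟨l, hl, h1, three_mul_cast h2 _⟩

theorem isBTgt_iff (b : ℤ) (l : ℕ) (hl : l < 3) (y : ℤ) :
    isBTgt s ((3 * b + l : ℤ) : ZMod (3 * s)) y ↔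
      y % 6 = l + 3 ∧ ((y / 6 : ℤ) : ZMod s) = b := by
  constructor
  · rintro ⟨j, hj, h1, h2⟩
    obtain ⟨rfl, h⟩ := three_mul_add_cast _ _ _ _ hj hl h2
    exact ⟨h1, h⟩
  · rintro ⟨h1, h2⟩
    exact ⟨l, hl, h1, three_mul_cast h2 _⟩

theorem act_a {b : ℤ} (l : ℕ) (hl : l < 3) {f : ℤ → ℤ → K} {x y : ℤ}
    (h1 : y % 6 = if l = 2 then 5 else l + 1) (h2 : ((y / 6 : ℤ) : ZMod s) = b) (h3 : con x y)
    (h4 : con x (y - if l = 2 then 3 else 1)) :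
    genAct K s (.a ((3 * b + l : ℤ) : ZMod (3 * s))) f x y =
      f x (y - if l = 2 then 3 else 1) := by
  have e : (if y % 6 = 5 then 3 else 1 : ℤ) = if l = 2 then 3 else 1 := by
    split_ifs at h1 ⊢ <;> omega
  rw [← e] at h4 ⊢
  exact stepAct_of K f ((isATgt_iff s b l hl y).mpr ⟨h1, h2⟩) h3 h4

theorem act_a_ne {b : ℤ} (l : ℕ) (hl : l < 3) {f : ℤ → ℤ → K} {x y : ℤ}
    (h : genAct K s (.a ((3 * b + l : ℤ) : ZMod (3 * s))) f x y ≠ 0) :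
    y % 6 = (if l = 2 then 5 else l + 1) ∧ ((y / 6 : ℤ) : ZMod s) = b ∧ con x y ∧
      con x (y - if l = 2 then 3 else 1) ∧ f x (y - if l = 2 then 3 else 1) ≠ 0 := by
  obtain ⟨h0, h3, h4, h5⟩ := stepAct_ne_zero h
  obtain ⟨h1, h2⟩ := (isATgt_iff s b l hl y).mp h0
  have e : (if y % 6 = 5 then 3 else 1 : ℤ) = if l = 2 then 3 else 1 := by
    split_ifs at h1 ⊢ <;> omega
  rw [← e]
  exact ⟨h1, h2, h3, h4, h5⟩

theorem act_b {b : ℤ} (l : ℕ) (hl : l < 3) {f : ℤ → ℤ → K} {x y : ℤ}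
    (h1 : y % 6 = l + 3) (h2 : ((y / 6 : ℤ) : ZMod s) = b) (h3 : con x y)
    (h4 : con x (y - if l = 0 then 3 else 1)) :
    genAct K s (.b ((3 * b + l : ℤ) : ZMod (3 * s))) f x y =
      f x (y - if l = 0 then 3 else 1) := by
  have e : (if y % 6 = 3 then 3 else 1 : ℤ) = if l = 0 then 3 else 1 := by
    split_ifs <;> omega
  rw [← e] at h4 ⊢
  exact stepAct_of K f ((isBTgt_iff s b l hl y).mpr ⟨h1, h2⟩) h3 h4

theorem act_b_ne {b : ℤ} (l : ℕ) (hl : l < 3) {f : ℤ → ℤ → K} {x y : ℤ}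
    (h : genAct K s (.b ((3 * b + l : ℤ) : ZMod (3 * s))) f x y ≠ 0) :
    y % 6 = l + 3 ∧ ((y / 6 : ℤ) : ZMod s) = b ∧ con x y ∧
      con x (y - if l = 0 then 3 else 1) ∧ f x (y - if l = 0 then 3 else 1) ≠ 0 := by
  obtain ⟨h0, h3, h4, h5⟩ := stepAct_ne_zero h
  obtain ⟨h1, h2⟩ := (isBTgt_iff s b l hl y).mp h0
  have e : (if y % 6 = 3 then 3 else 1 : ℤ) = if l = 0 then 3 else 1 := by
    split_ifs <;> omega
  rw [← e]
  exact ⟨h1, h2, h3, h4, h5⟩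

theorem act_g_ne {i : ZMod s} {f : ℤ → ℤ → K} {x y : ℤ} (h : genAct K s (.g i) f x y ≠ 0) :
    y % 6 = 0 ∧ ((y / 6 - 1 : ℤ) : ZMod s) = i ∧ con x y ∧ con x (y - 1) ∧ f x (y - 1) ≠ 0 := by
  obtain ⟨⟨h1, h2⟩, h3, h4, h5⟩ := stepAct_ne_zero h
  exact ⟨h1, h2, h3, h4, h5⟩

variable [NeZero s]

/-- The representation of the free algebra on functions on pairs of positions satisfies the relations
of `R_s`. -/
theorem genAct_rel ⦃x y : F K s⦄ (h : Rel K s x y) :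
    FreeAlgebra.lift K (genAct K s) x = FreeAlgebra.lift K (genAct K s) y := by
  have hA (i) : FreeAlgebra.lift K (genAct K s) (A K s i) = genAct K s (.a i) :=
    FreeAlgebra.lift_ι_apply _ _
  have hB (i) : FreeAlgebra.lift K (genAct K s) (B K s i) = genAct K s (.b i) :=
    FreeAlgebra.lift_ι_apply _ _
  have hG (i) : FreeAlgebra.lift K (genAct K s) (G K s i) = genAct K s (.g i) :=
    FreeAlgebra.lift_ι_apply _ _
  have hE (i) : FreeAlgebra.lift K (genAct K s) (E K s i) = genAct K s (.e i) :=
    FreeAlgebra.lift_ι_apply _ _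
  cases h with
  | idem i j =>
    rw [map_mul, hE, hE]
    ext f x y
    rw [Module.End.mul_apply]
    change vertAct K s i (vertAct K s j f) x y = _
    rw [vertAct_apply, vertAct_apply]
    by_cases hij : i = j
    · subst hij
      rw [if_pos rfl, hE]
      change _ = vertAct K s i f x y
      rw [vertAct_apply]
      split_ifs <;> rfl
    · rw [if_neg hij, map_zero]
      split_ifs with h1 h2
      · exact absurd (h1.symm.trans h2) hij
      · rfl
      · rfl
  | sum_one =>
    rw [map_sum, map_one]
    ext f x y
    simp only [hE, LinearMap.sum_apply, Finset.sum_apply]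
    change ∑ i ∈ Finset.range (6 * s), vertAct K s i f x y = f x y
    simp only [vertAct_apply]
    rw [Finset.sum_eq_single_of_mem ((y : ZMod (6 * s)).val)
      (Finset.mem_range.mpr (ZMod.val_lt _))]
    · rw [if_pos (ZMod.natCast_zmod_val _).symm]
    · intro b hb hne
      refine if_neg fun h => hne ?_
      rw [h, ZMod.val_natCast_of_lt (Finset.mem_range.mp hb)]
  | a_tgt i =>
    rw [map_mul, hA, hE]
    refine vertAct_comp_stepAct K s ?_
    rintro y ⟨l, hl, h1, rfl⟩
    rw [aTgt_intCast _ _ hl]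
    congr 1
    split_ifs at h1 ⊢ <;> omega
  | a_src i =>
    rw [map_mul, hA, hE]
    refine stepAct_comp_vertAct K s ?_
    rintro y ⟨l, hl, h1, rfl⟩
    rw [aSrc_intCast _ _ hl]
    congr 1
    split_ifs at h1 ⊢ <;> omega
  | b_tgt i =>
    rw [map_mul, hB, hE]
    refine vertAct_comp_stepAct K s ?_
    rintro y ⟨l, hl, h1, rfl⟩
    rw [bTgt_intCast _ _ hl]
    congr 1
    omega
  | b_src i =>
    rw [map_mul, hB, hE]
    refine stepAct_comp_vertAct K s ?_
    rintro y ⟨l, hl, h1, rfl⟩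
    rw [bSrc_intCast _ _ hl]
    congr 1
    split_ifs <;> omega
  | g_tgt i =>
    rw [map_mul, hG, hE]
    refine vertAct_comp_stepAct K s ?_
    rintro y ⟨h1, rfl⟩
    rw [gTgt_intCast]
    congr 1
    omega
  | g_src i =>
    rw [map_mul, hG, hE]
    refine stepAct_comp_vertAct K s ?_
    rintro y ⟨h1, rfl⟩
    rw [gSrc_intCast]
    congr 1
    omega
  | len5 x₁ x₂ x₃ x₄ x₅ h₁ h₂ h₃ h₄ h₅ =>
    simp only [map_mul, map_zero]
    ext f x y
    by_contra h
    obtain ⟨y₁, c, -, e₁, h⟩ := arrows_act K s h₁ _ _ _ h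
    obtain ⟨y₂, -, -, e₂, h⟩ := arrows_act K s h₂ _ _ _ h
    obtain ⟨y₃, -, -, e₃, h⟩ := arrows_act K s h₃ _ _ _ h
    obtain ⟨y₄, -, -, e₄, h⟩ := arrows_act K s h₄ _ _ _ h
    obtain ⟨y₅, -, c', e₅, h⟩ := arrows_act K s h₅ _ _ _ h
    have := lev_le c
    have := lev_le c'
    omega
  | comm t =>
    have e2 : ((3 * (t : ℕ) + 2 : ℕ) : ZMod (3 * s)) = ((3 * (t : ℤ) + (2 : ℕ) : ℤ) : ZMod (3 * s)) := by
      push_cast; rfl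
    have e1 : ((3 * (t : ℕ) + 1 : ℕ) : ZMod (3 * s)) = ((3 * (t : ℤ) + (1 : ℕ) : ℤ) : ZMod (3 * s)) := by
      push_cast; rfl
    have e0 : ((3 * (t : ℕ) : ℕ) : ZMod (3 * s)) = ((3 * (t : ℤ) + (0 : ℕ) : ℤ) : ZMod (3 * s)) := by
      push_cast; ring
    simp only [map_mul, hA, hB, e2, e1, e0]
    ext f x y
    simp only [Module.End.mul_apply]
    by_cases hy : y % 6 = 5 ∧ ((y / 6 : ℤ) : ZMod s) = (t : ℤ) ∧ con x y ∧ con x (y - 5)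
    · obtain ⟨h1, h2, h3, h4⟩ := hy
      have c1 : con x (y - 1) := by unfold con at h3 h4 ⊢; omega
      have c2 : con x (y - 2) := by unfold con at h3 h4 ⊢; omega
      have c3 : con x (y - 3) := by unfold con at h3 h4 ⊢; omega
      have c4 : con x (y - 4) := by unfold con at h3 h4 ⊢; omega
      have q1 : (y - 1) / 6 = y / 6 := by omega
      have q2 : (y - 2) / 6 = y / 6 := by omega
      have q3 : (y - 3) / 6 = y / 6 := by omega
      have q4 : (y - 4) / 6 = y / 6 := by omega
      have r1 : (y - 1) % 6 = 4 := by omega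
      have r2 : (y - 2) % 6 = 3 := by omega
      have r3 : (y - 3) % 6 = 2 := by omega
      have r4 : (y - 4) % 6 = 1 := by omega
      rw [act_a K s 2 (by lia) (by simpa using h1) h2 h3 (by simpa using c3),
        act_a K s 1 (by lia) (by simpa using r3) (by simpa [q3] using h2) (by simpa using c3)
          (by simpa [sub_sub] using c4),
        act_a K s 0 (by lia) (by simpa [sub_sub] using r4) (by simpa [sub_sub, q4] using h2)
          (by simpa [sub_sub] using c4) (by simpa [sub_sub] using h4),
        act_b K s 2 (by lia) (by simpa using h1) h2 h3 (by simpa using c1),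
        act_b K s 1 (by lia) (by simpa using r1) (by simpa [q1] using h2) (by simpa using c1)
          (by simpa [sub_sub] using c2),
        act_b K s 0 (by lia) (by simpa [sub_sub] using r2) (by simpa [sub_sub, q2] using h2)
          (by simpa [sub_sub] using c2) (by simpa [sub_sub] using h4)]
      simp [sub_sub]
    · trans 0
      · by_contra h
        obtain ⟨h1, h2, h3, -, h⟩ := act_a_ne K s 2 (by lia) h
        obtain ⟨-, -, -, -, h⟩ := act_a_ne K s 1 (by lia) h
        obtain ⟨-, -, -, h4, h⟩ := act_a_ne K s 0 (by lia) h
        exact hy ⟨by simpa using h1, h2, h3, by simpa [sub_sub] using h4⟩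
      · by_contra h
        obtain ⟨h1, h2, h3, -, h⟩ := act_b_ne K s 2 (by lia) (Ne.symm h)
        obtain ⟨-, -, -, -, h⟩ := act_b_ne K s 1 (by lia) h
        obtain ⟨-, -, -, h4, h⟩ := act_b_ne K s 0 (by lia) h
        exact hy ⟨by simpa using h1, h2, h3, by simpa [sub_sub] using h4⟩
  | zero_agb t =>
    have e3 : ((3 * (t : ℕ) + 3 : ℕ) : ZMod (3 * s)) =
        ((3 * ((t : ℤ) + 1) + (0 : ℕ) : ℤ) : ZMod (3 * s)) := by push_cast; ring
    have e2 : ((3 * (t : ℕ) + 2 : ℕ) : ZMod (3 * s)) = ((3 * (t : ℤ) + (2 : ℕ) : ℤ) : ZMod (3 * s)) := by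
      push_cast; rfl
    simp only [map_mul, hA, hB, hG, e2, e3, map_zero]
    ext f x y
    simp only [Module.End.mul_apply]
    by_contra h
    obtain ⟨h1, -, h2, -, h⟩ := act_a_ne K s 0 (by lia) h
    obtain ⟨-, -, h3, h4, h⟩ := act_g_ne K s h
    obtain ⟨-, -, -, h5, h⟩ := act_b_ne K s 2 (by lia) h
    simp only [OfNat.zero_ne_ofNat, OfNat.ofNat_ne_zero, if_false] at h1 h2 h5
    clear h3 h4
    unfold con at h2 h5
    omega
  | zero_bga t =>
    have e3 : ((3 * (t : ℕ) + 3 : ℕ) : ZMod (3 * s)) =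
        ((3 * ((t : ℤ) + 1) + (0 : ℕ) : ℤ) : ZMod (3 * s)) := by push_cast; ring
    have e2 : ((3 * (t : ℕ) + 2 : ℕ) : ZMod (3 * s)) = ((3 * (t : ℤ) + (2 : ℕ) : ℤ) : ZMod (3 * s)) := by
      push_cast; rfl
    simp only [map_mul, hA, hB, hG, e2, e3, map_zero]
    ext f x y
    simp only [Module.End.mul_apply]
    by_contra h
    obtain ⟨h1, -, h2, -, h⟩ := act_b_ne K s 0 (by lia) h
    obtain ⟨-, -, h3, h4, h⟩ := act_g_ne K s h
    obtain ⟨-, -, -, h5, h⟩ := act_a_ne K s 2 (by lia) h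
    simp only [if_true] at h2 h5
    clear h3 h4
    unfold con at h2 h5
    omega

/-- The action of `R_s` on functions on pairs of positions. -/
noncomputable def rep : Alg K s →ₐ[K] Module.End K (ℤ → ℤ → K) :=
  RingQuot.liftAlgHom K ⟨FreeAlgebra.lift K (genAct K s), genAct_rel K s⟩

theorem rep_mk (x : F K s) :
    rep K s (RingQuot.mkAlgHom K (Rel K s) x) = FreeAlgebra.lift K (genAct K s) x :=
  RingQuot.liftAlgHom_mkAlgHom_apply K _ _ _

theorem rep_gen (g : Gen s) :
    rep K s (RingQuot.mkAlgHom K (Rel K s) (FreeAlgebra.ι K g)) = genAct K s g := by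
  rw [rep_mk, FreeAlgebra.lift_ι_apply]

end RepRelations

section Coordinates
set_option linter.unusedSectionVars false
variable (K : Type u) [Field K] (s : ℕ) [NeZero s]

theorem rep_vert (v : ℤ) (f : ℤ → ℤ → K) (x y : ℤ) :
    rep K s (vert K s v) f x y = if (y : ZMod (6 * s)) = v then f x y else 0 := by
  rw [vert, ee, E, rep_gen]
  rfl

theorem cast_block_add (t q : ℤ) : ((t + s * q : ℤ) : ZMod s) = t :=
  intCast_eq_of_dvd ⟨-q, by ring⟩

theorem rep_arrow (t : ℤ) (l : ℕ) (hl : l < 7) (f : ℤ → ℤ → K) (x q : ℤ)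
    (h : con x (6 * t + atgt l + 6 * s * q)) (h' : con x (6 * t + asrc l + 6 * s * q)) :
    rep K s (arrow K s t l) f x (6 * t + atgt l + 6 * s * q) =
      f x (6 * t + asrc l + 6 * s * q) := by
  have e (z : ℤ) : 6 * t + z + 6 * s * q = 6 * (t + s * q) + z := by ring
  rw [e] at h h' ⊢
  rw [e]
  have hc := cast_block_add s t q
  generalize t + s * q = b at h h' hc ⊢
  have hA (j : ℕ) (hj : j < 3) : rep K s (aa K s ((3 * t + j : ℤ) : ZMod (3 * s))) =
      genAct K s (.a ((3 * t + j : ℤ) : ZMod (3 * s))) := rep_gen K s _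
  have hB (j : ℕ) (hj : j < 3) : rep K s (bb K s ((3 * t + j : ℤ) : ZMod (3 * s))) =
      genAct K s (.b ((3 * t + j : ℤ) : ZMod (3 * s))) := rep_gen K s _
  have a0 : arrow K s t 0 = aa K s ((3 * t + (0 : ℕ) : ℤ) : ZMod (3 * s)) := by simp [arrow]
  have b0 : arrow K s t 3 = bb K s ((3 * t + (0 : ℕ) : ℤ) : ZMod (3 * s)) := by simp [arrow]
  have d1 : (6 * b + 1) / 6 = b := by omega
  have d2 : (6 * b + 2) / 6 = b := by omega
  have d3 : (6 * b + 3) / 6 = b := by omega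
  have d4 : (6 * b + 4) / 6 = b := by omega
  have d5 : (6 * b + 5) / 6 = b := by omega
  interval_cases l <;> simp only [asrc, atgt] at h h' ⊢
  · rw [a0, hA 0 (by lia), act_a K s 0 (by lia) (by simp; try omega) (by rwa [d1]) h
      (by simpa using h')]
    simp
  · change (rep K s (aa K s ((3 * t + (1 : ℕ) : ℤ) : ZMod (3 * s))) f) x _ = _
    rw [hA 1 (by lia), act_a K s 1 (by lia) (by simp; try omega) (by rwa [d2]) h
      (by simpa [add_sub_assoc] using h')]
    simp [add_sub_assoc]
  · change (rep K s (aa K s ((3 * t + (2 : ℕ) : ℤ) : ZMod (3 * s))) f) x _ = _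
    rw [hA 2 (by lia), act_a K s 2 (by lia) (by simp; try omega) (by rwa [d5]) h
      (by simpa [add_sub_assoc] using h')]
    simp [add_sub_assoc]
  · rw [b0, hB 0 (by lia), act_b K s 0 (by lia) (by simp; try omega) (by rwa [d3]) h
      (by simpa [add_sub_assoc] using h')]
    simp
  · change (rep K s (bb K s ((3 * t + (1 : ℕ) : ℤ) : ZMod (3 * s))) f) x _ = _
    rw [hB 1 (by lia), act_b K s 1 (by lia) (by simp; try omega) (by rwa [d4]) h
      (by simpa [add_sub_assoc] using h')]
    simp [add_sub_assoc]
  · change (rep K s (bb K s ((3 * t + (2 : ℕ) : ℤ) : ZMod (3 * s))) f) x _ = _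
    rw [hB 2 (by lia), act_b K s 2 (by lia) (by simp; try omega) (by rwa [d5]) h
      (by simpa [add_sub_assoc] using h')]
    simp [add_sub_assoc]
  · have hG : rep K s (arrow K s t 6) = genAct K s (.g (t : ZMod s)) := rep_gen K s _
    rw [hG]
    refine (stepAct_of K f ⟨by omega, ?_⟩ h (by simpa [add_sub_assoc] using h')).trans ?_
    · congr 1; omega
    · have d6 : (6 * b + 6) / 6 = b + 1 := by omega
      simp [d6, hc]

variable {K s} in
theorem rep_arrow_ne {t : ℤ} {l : ℕ} (hl : l < 7) {f : ℤ → ℤ → K} {x y : ℤ}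
    (h : rep K s (arrow K s t l) f x y ≠ 0) :
    ∃ q, y = 6 * t + atgt l + 6 * s * q ∧ f x (6 * t + asrc l + 6 * s * q) ≠ 0 := by
  have key {b : ℤ} (hb : ((b : ℤ) : ZMod s) = (t : ZMod s)) : ∃ q, b = t + s * q := by
    rw [eq_comm, ZMod.intCast_eq_intCast_iff_dvd_sub] at hb
    obtain ⟨q, hq⟩ := hb
    exact ⟨q, by linarith⟩
  suffices ∃ b : ℤ, ((b : ℤ) : ZMod s) = (t : ZMod s) ∧ y = 6 * b + atgt l ∧ f x (6 * b + asrc l) ≠ 0 by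
    obtain ⟨b, hb, h1, h2⟩ := this
    obtain ⟨q, rfl⟩ := key hb
    refine ⟨q, by rw [h1]; ring, ?_⟩
    convert h2 using 2
    ring
  have hA (j : ℕ) (hj : j < 3) : rep K s (aa K s ((3 * t + j : ℤ) : ZMod (3 * s))) =
      genAct K s (.a ((3 * t + j : ℤ) : ZMod (3 * s))) := rep_gen K s _
  have hB (j : ℕ) (hj : j < 3) : rep K s (bb K s ((3 * t + j : ℤ) : ZMod (3 * s))) =
      genAct K s (.b ((3 * t + j : ℤ) : ZMod (3 * s))) := rep_gen K s _
  have a0 : arrow K s t 0 = aa K s ((3 * t + (0 : ℕ) : ℤ) : ZMod (3 * s)) := by simp [arrow]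
  have b0 : arrow K s t 3 = bb K s ((3 * t + (0 : ℕ) : ℤ) : ZMod (3 * s)) := by simp [arrow]
  have fin {z c c' : ℤ} (hf : f x z ≠ 0) (hy : y = 6 * (y / 6) + c) (hz : z = 6 * (y / 6) + c')
      (hb : ((y / 6 : ℤ) : ZMod s) = t) :
      ∃ b : ℤ, ((b : ℤ) : ZMod s) = (t : ZMod s) ∧ y = 6 * b + c ∧ f x (6 * b + c') ≠ 0 :=
    ⟨y / 6, hb, hy, hz ▸ hf⟩
  interval_cases l <;> simp only [asrc, atgt]
  · rw [a0, hA 0 (by lia)] at h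
    obtain ⟨h1, h2, -, -, h3⟩ := act_a_ne K s 0 (by lia) h
    simp at h1
    exact fin h3 (by omega) (by simp; omega) h2
  · change (rep K s (aa K s ((3 * t + (1 : ℕ) : ℤ) : ZMod (3 * s))) f) x _ ≠ 0 at h
    rw [hA 1 (by lia)] at h
    obtain ⟨h1, h2, -, -, h3⟩ := act_a_ne K s 1 (by lia) h
    simp at h1
    exact fin h3 (by omega) (by simp; omega) h2
  · change (rep K s (aa K s ((3 * t + (2 : ℕ) : ℤ) : ZMod (3 * s))) f) x _ ≠ 0 at h
    rw [hA 2 (by lia)] at h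
    obtain ⟨h1, h2, -, -, h3⟩ := act_a_ne K s 2 (by lia) h
    simp at h1
    exact fin h3 (by omega) (by simp; omega) h2
  · rw [b0, hB 0 (by lia)] at h
    obtain ⟨h1, h2, -, -, h3⟩ := act_b_ne K s 0 (by lia) h
    simp at h1
    exact fin h3 (by omega) (by simp; omega) h2
  · change (rep K s (bb K s ((3 * t + (1 : ℕ) : ℤ) : ZMod (3 * s))) f) x _ ≠ 0 at h
    rw [hB 1 (by lia)] at h
    obtain ⟨h1, h2, -, -, h3⟩ := act_b_ne K s 1 (by lia) h
    simp at h1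
    exact fin h3 (by omega) (by simp; omega) h2
  · change (rep K s (bb K s ((3 * t + (2 : ℕ) : ℤ) : ZMod (3 * s))) f) x _ ≠ 0 at h
    rw [hB 2 (by lia)] at h
    obtain ⟨h1, h2, -, -, h3⟩ := act_b_ne K s 2 (by lia) h
    simp at h1
    exact fin h3 (by omega) (by simp; omega) h2
  · have hG : rep K s (arrow K s t 6) = genAct K s (.g (t : ZMod s)) := rep_gen K s _
    rw [hG] at h
    obtain ⟨h1, h2, -, -, h3⟩ := act_g_ne K s h
    exact ⟨y / 6 - 1, h2, by omega, by convert h3 using 2; omega⟩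

theorem rep_ptz {u : ℤ} (f : ℤ → ℤ → K) (x q : ℤ) (v : ℤ) (h : con u v)
    (h1 : con x (v + 6 * s * q)) (h2 : con x (u + 6 * s * q)) :
    rep K s (ptz K s u v) f x (v + 6 * s * q) = f x (u + 6 * s * q) := by
  obtain ⟨n, hn⟩ : ∃ n : ℕ, v - u = n := ⟨(v - u).toNat, by have := h.1; omega⟩
  induction n using Nat.strong_induction_on generalizing v with
  | _ n ih =>
    rcases eq_or_ne u v with rfl | hne
    · rw [ptz_self, rep_vert, if_pos]
      exact intCast_eq_of_dvd ⟨-q, by push_cast; ring⟩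
    · obtain ⟨t, l, hl, rfl, h3⟩ := exists_last_arrow h hne
      have h0' := atgt_bound l
      have e (z : ℤ) : 6 * t + z + 6 * s * q = 6 * (t + s * q) + z := by ring
      have e' (z : ℤ) : z + 6 * s * q = z + 6 * (s * q) := by ring
      have h4 : con x (6 * t + asrc l + 6 * s * q) := by
        rw [e] at h1 ⊢
        refine con_of_last hl h2 ?_ h1 ?_
        · rwa [← e, e', e', con_add]
        · rwa [← e, e', e', con_add]
      rw [← arrow_mul_ptz K s t u l hl h3, map_mul, Module.End.mul_apply,
        rep_arrow K s t l hl _ _ _ h1 h4]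
      exact ih (6 * t + asrc l - u).toNat (by have := h3.1; omega) (6 * t + asrc l) h3 h4
        (by have := h3.1; omega)

variable {K s} in
theorem rep_ptz_ne {u : ℤ} {f : ℤ → ℤ → K} {x y : ℤ} (v : ℤ) (h : con u v)
    (h1 : rep K s (ptz K s u v) f x y ≠ 0) :
    ∃ q, y = v + 6 * s * q ∧ f x (u + 6 * s * q) ≠ 0 := by
  obtain ⟨n, hn⟩ : ∃ n : ℕ, v - u = n := ⟨(v - u).toNat, by have := h.1; omega⟩
  induction n using Nat.strong_induction_on generalizing v y with
  | _ n ih =>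
    rcases eq_or_ne u v with rfl | hne
    · rw [ptz_self, rep_vert] at h1
      split_ifs at h1 with h2
      · obtain ⟨q, rfl⟩ := exists_eq_add_of_cast_eq s h2.symm
        exact ⟨q, rfl, h1⟩
      · exact absurd rfl h1
    · obtain ⟨t, l, hl, rfl, h3⟩ := exists_last_arrow h hne
      have h0' := atgt_bound l
      rw [← arrow_mul_ptz K s t u l hl h3, map_mul, Module.End.mul_apply] at h1
      obtain ⟨q, hy, h2⟩ := rep_arrow_ne hl h1
      obtain ⟨q', hq, h4⟩ := ih (6 * t + asrc l - u).toNat (by have := h3.1; omega)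
        (6 * t + asrc l) h3 h2 (by have := h3.1; omega)
      have hq' : q = q' := by
        have hs := NeZero.pos s
        have : (6 * s : ℤ) * q = 6 * s * q' := by linarith
        exact mul_left_cancel₀ (by positivity) this
      exact ⟨q, hy, hq' ▸ h4⟩

/-- The coefficient of the path from `u` to `v`. -/
noncomputable def coord (u v : ℤ) : Alg K s →ₗ[K] K where
  toFun r := rep K s r (fun x y => if x = u ∧ y = u then 1 else 0) u v
  map_add' r r' := by simp
  map_smul' c r := by simp

theorem coord_ptz_self {u v : ℤ} (h : con u v) : coord K s u v (ptz K s u v) = 1 := by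
  have := rep_ptz K s (fun x y => if x = u ∧ y = u then 1 else 0) u 0 v h (by simpa using h)
    (by simpa using con_self u)
  change rep K s (ptz K s u v) _ u v = 1
  simpa using this

variable {K s} in
theorem coord_ptz_ne {a b u v : ℤ} (h : con u v) (h1 : coord K s a b (ptz K s u v) ≠ 0) :
    ∃ q, a = u + 6 * s * q ∧ b = v + 6 * s * q := by
  obtain ⟨q, h2, h3⟩ := rep_ptz_ne v h h1
  refine ⟨q, ?_, h2⟩
  by_contra h4
  exact h3 (if_neg fun h5 => h4 h5.2.symm)

end Coordinates

section Winding
set_option linter.unusedSectionVars false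
variable (K : Type u) [Field K] (s : ℕ) [NeZero s]

theorem coord_ptz_add {u v : ℤ} (h : con u v) (q : ℤ) :
    coord K s (u + 6 * s * q) (v + 6 * s * q) (ptz K s u v) = 1 := by
  rw [← ptz_add K s u v q]
  apply coord_ptz_self
  rwa [mul_assoc, con_add]

theorem coord_add (a b q : ℤ) (r : Alg K s) :
    coord K s (a + 6 * s * q) (b + 6 * s * q) r = coord K s a b r := by
  induction r using ptz_induction with
  | h u v h =>
    by_cases h1 : ∃ p, a = u + 6 * s * p ∧ b = v + 6 * s * p
    · obtain ⟨p, rfl, rfl⟩ := h1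
      rw [coord_ptz_add K s h, add_assoc, add_assoc, ← mul_add, coord_ptz_add K s h]
    · have h2 : coord K s a b (ptz K s u v) = 0 := by
        by_contra h3
        exact h1 (coord_ptz_ne h h3)
      rw [h2]
      by_contra h3
      obtain ⟨p, h4, h5⟩ := coord_ptz_ne h h3
      exact h1 ⟨p - q, by linarith, by linarith⟩
  | hc c x hx => simp [hx]
  | h0 => simp
  | hadd x y hx hy => simp [hx, hy]

theorem coord_ptz_of_ne {u v a b : ℤ} (h : con u v) (h1 : a = u → b ≠ v) (h2 : a = u ∨ b = v) :
    coord K s a b (ptz K s u v) = 0 := by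
  by_contra h3
  obtain ⟨q, h4, h5⟩ := coord_ptz_ne h h3
  rcases h2 with h2 | h2
  · exact h1 h2 (by linarith)
  · exact h1 (by linarith) h2

/-- Expansion of an element between two vertices in the path basis. -/
theorem vert_mul_mul_vert (u v : ℤ) (S : Finset ℤ) (hS : ∀ q : ℤ, con u (v - 6 * s * q) → q ∈ S)
    (r : Alg K s) : vert K s v * r * vert K s u =
      ∑ q ∈ S, coord K s u (v - 6 * s * q) r • ptz K s u (v - 6 * s * q) := by
  induction r using ptz_induction with
  | h a b h =>
    rw [vert_mul_ptz_eq]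
    by_cases hb : (v : ZMod (6 * s)) = b
    swap
    · rw [if_neg hb, zero_mul, eq_comm]
      refine Finset.sum_eq_zero fun q _ => ?_
      by_cases h3 : coord K s u (v - 6 * s * q) (ptz K s a b) = 0
      · rw [h3, zero_smul]
      · obtain ⟨p, h4, h5⟩ := coord_ptz_ne h h3
        exact absurd (intCast_eq_of_dvd ⟨-(p + q), by push_cast; linarith⟩) hb
    rw [if_pos hb]
    by_cases ha : (a : ZMod (6 * s)) = u
    swap
    · rw [← ptz_mul_vert, mul_assoc, vert_mul_vert, if_neg ha, mul_zero, eq_comm]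
      refine Finset.sum_eq_zero fun q _ => ?_
      rw [ptz_mul_vert]
      by_cases h3 : coord K s u (v - 6 * s * q) (ptz K s a b) = 0
      · rw [h3, zero_smul]
      · obtain ⟨p, h4, h5⟩ := coord_ptz_ne h h3
        exact absurd (intCast_eq_of_dvd ⟨p, by push_cast; linarith⟩) ha
    obtain ⟨p, rfl⟩ := exists_eq_add_of_cast_eq s ha
    clear ha
    rw [← ptz_add K s a b p]
    rw [← con_add a b (s * p), ← mul_assoc] at h
    have hb' : (v : ZMod (6 * s)) = ((b + 6 * s * p : ℤ) : ZMod (6 * s)) :=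
      hb.trans (intCast_eq_of_dvd ⟨p, by push_cast; ring⟩)
    generalize a + 6 * s * p = a at h hS ⊢
    generalize b + 6 * s * p = b at h hb' ⊢
    obtain ⟨p, rfl⟩ := exists_eq_add_of_cast_eq s hb'
    have e : v + 6 * s * p = v - 6 * s * (-p) := by ring
    rw [e] at h ⊢
    rw [Finset.sum_eq_single_of_mem (-p) (hS _ h), coord_ptz_self K s h, one_smul, ptz_mul_vert]
    intro q _ hne
    rw [coord_ptz_of_ne K s h _ (.inl rfl), zero_smul]
    intro _ h5
    have hs : (0 : ℤ) < s := by exact_mod_cast NeZero.pos s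
    exact hne (mul_left_cancel₀ (show (6 * s : ℤ) ≠ 0 by positivity) (by linarith))
  | hc c x hx => simp only [mul_smul_comm, smul_mul_assoc, hx, map_smul, smul_eq_mul, mul_smul,
      Finset.smul_sum]
  | h0 => simp
  | hadd x y hx hy => simp only [mul_add, add_mul, hx, hy, map_add, add_smul, Finset.sum_add_distrib]

/-- The derivation counting how often a path winds around the quiver (with a sign). -/
noncomputable def wind : Alg K s →ₗ[K] Alg K s :=
  ∑ a ∈ Finset.range (6 * s), ∑ d ∈ Finset.range 7,
    (((a : ℤ) / (6 * s) - ((a : ℤ) + d) / (6 * s) : ℤ) : K) •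
      (coord K s a (a + d)).smulRight (ptz K s a (a + d))

theorem add_ediv (x q : ℤ) : (x + 6 * s * q) / (6 * s) = x / (6 * s) + q := by
  have hs : (0 : ℤ) < s := by exact_mod_cast NeZero.pos s
  exact Int.add_mul_ediv_left _ _ (by positivity)

theorem wind_ptz (u v : ℤ) :
    wind K s (ptz K s u v) = ((u / (6 * s) - v / (6 * s) : ℤ) : K) • ptz K s u v := by
  by_cases h : con u v
  swap
  · rw [ptz_of_not K h, map_zero, smul_zero]
  have hs : 0 < 6 * s := Nat.mul_pos (by lia) (NeZero.pos s)
  obtain ⟨q, a, ha, rfl⟩ : ∃ (q : ℤ) (a : ℕ), a < 6 * s ∧ u = a + 6 * s * q := by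
    have hs' : (0 : ℤ) < 6 * s := by exact_mod_cast hs
    refine ⟨u / (6 * s), (u % (6 * s)).toNat, ?_, ?_⟩
    · have := Int.emod_lt_of_pos u hs'
      omega
    · rw [Int.toNat_of_nonneg (Int.emod_nonneg _ hs'.ne'), Int.emod_add_mul_ediv]
  obtain ⟨v, rfl⟩ : ∃ w, v = w + 6 * s * q := ⟨v - 6 * s * q, by ring⟩
  rw [ptz_add, add_ediv, add_ediv, add_sub_add_right_eq_sub]
  rw [mul_assoc, con_add] at h
  obtain ⟨d, rfl⟩ : ∃ d : ℕ, v = a + d := ⟨(v - a).toNat, by have := h.1; omega⟩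
  have h2 := h.2.1
  rw [wind, LinearMap.sum_apply, Finset.sum_eq_single_of_mem a (Finset.mem_range.mpr ha),
    LinearMap.sum_apply,
    Finset.sum_eq_single_of_mem d (Finset.mem_range.mpr (by omega))]
  · rw [LinearMap.smul_apply, LinearMap.smulRight_apply, coord_ptz_self K s h, one_smul]
  · intro d' _ hne
    rw [LinearMap.smul_apply, LinearMap.smulRight_apply,
      coord_ptz_of_ne K s h (fun _ => by simpa using hne) (.inl rfl), zero_smul, smul_zero]
  · intro b hb hne
    rw [LinearMap.sum_apply]
    refine Finset.sum_eq_zero fun d' _ => ?_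
    rw [LinearMap.smul_apply, LinearMap.smulRight_apply]
    by_cases h3 : coord K s b (b + d') (ptz K s a (a + d)) = 0
    · rw [h3, zero_smul, smul_zero]
    · obtain ⟨p, h4, -⟩ := coord_ptz_ne h h3
      rw [Finset.mem_range] at hb
      have e : ((b : ℤ) + 6 * s * 0) / (6 * s) = ((a : ℤ) + 6 * s * p) / (6 * s) := by
        rw [h4, mul_zero, add_zero]
      rw [add_ediv, add_ediv, Int.ediv_eq_zero_of_lt (by positivity) (by exact_mod_cast hb),
        Int.ediv_eq_zero_of_lt (by positivity) (by exact_mod_cast ha)] at e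
      have : p = 0 := by omega
      subst this
      exact absurd (by simpa using h4) hne

theorem wind_mul (x y : Alg K s) : wind K s (x * y) = wind K s x * y + x * wind K s y := by
  induction x using ptz_induction with
  | h a b h =>
    induction y using ptz_induction with
    | h c d h' =>
      by_cases hd : (a : ZMod (6 * s)) = d
      · obtain ⟨q, rfl⟩ := exists_eq_add_of_cast_eq s hd
        obtain ⟨c, rfl⟩ : ∃ w, c = w + 6 * s * q := ⟨c - 6 * s * q, by ring⟩
        rw [ptz_add]
        rw [mul_assoc, con_add] at h'
        rw [ptz_mul_ptz K s h' _ h, wind_ptz, wind_ptz, wind_ptz, smul_mul_assoc, mul_smul_comm,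
          ptz_mul_ptz K s h' _ h, ← add_smul]
        congr 1
        push_cast
        ring
      · have h0 : ptz K s a b * ptz K s c d = 0 := by
          rw [← ptz_mul_vert, mul_assoc, vert_mul_ptz_eq, if_neg hd, mul_zero]
        rw [wind_ptz, wind_ptz, smul_mul_assoc, mul_smul_comm, h0, map_zero, smul_zero, smul_zero, add_zero]
    | hc c x hx => simp only [mul_smul_comm, map_smul, hx, smul_add]
    | h0 => simp
    | hadd x y hx hy => simp only [mul_add, map_add, hx, hy]; abel
  | hc c x hx => simp only [smul_mul_assoc, map_smul, hx, smul_add]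
  | h0 => simp
  | hadd x y hx hy => simp only [add_mul, map_add, hx, hy]; abel

end Winding

section DerivationExtension
open CategoryTheory
variable {k : Type u} [Field k] {A : Type u} [Ring A] [Algebra k A]

attribute [local instance] TensorProduct.Algebra.module

theorem rTensor_deriv (D : A →ₗ[k] A) (hD : ∀ x y, D (x * y) = D x * y + x * D y)
    (x y : A ⊗[k] Aᵐᵒᵖ) : D.rTensor Aᵐᵒᵖ (x * y) =
      D.rTensor Aᵐᵒᵖ x * y + x * D.rTensor Aᵐᵒᵖ y := by
  induction x using TensorProduct.induction_on with
  | zero => simp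
  | add x x' hx hx' => rw [add_mul, map_add, hx, hx', map_add, add_mul, add_mul]; abel
  | tmul a b =>
    induction y using TensorProduct.induction_on with
    | zero => simp
    | add x x' hx hx' => rw [mul_add, map_add, hx, hx', map_add, mul_add, mul_add]; abel
    | tmul c d =>
      simp only [Algebra.TensorProduct.tmul_mul_tmul, LinearMap.rTensor_tmul, hD,
        TensorProduct.add_tmul]

/-- The matrix representation attached to a derivation. -/
noncomputable def derivRep (D : A →ₗ[k] A) (hD : ∀ x y, D (x * y) = D x * y + x * D y) :
    A ⊗[k] Aᵐᵒᵖ →+* Matrix (Fin 2) (Fin 2) (A ⊗[k] Aᵐᵒᵖ) where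
  toFun l := !![l, 0; D.rTensor Aᵐᵒᵖ l, l]
  map_one' := by
    have h : D.rTensor Aᵐᵒᵖ (1 : A ⊗[k] Aᵐᵒᵖ) = 0 := by
      have := rTensor_deriv D hD 1 1
      rw [mul_one, mul_one, one_mul] at this
      simpa using this
    rw [h, Matrix.one_fin_two]
  map_zero' := by
    rw [map_zero]
    ext i j
    fin_cases i <;> fin_cases j <;> rfl
  map_mul' x y := by
    rw [rTensor_deriv D hD, Matrix.mul_fin_two]
    simp
  map_add' x y := by
    rw [map_add]
    ext i j
    fin_cases i <;> fin_cases j <;> simp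

variable (D : A →ₗ[k] A) (hD : ∀ x y, D (x * y) = D x * y + x * D y)

/-- The self-extension of the regular bimodule attached to a derivation. -/
noncomputable def derivExt : ModuleCat.{u} (A ⊗[k] Aᵐᵒᵖ) :=
  (matFunctor (derivRep D hD)).obj (regBimod k A)

/-- Elements of the self-extension are pairs. -/
def derivPair : A × A ≃+ derivExt D hD where
  toFun m := (![m.1, m.2] : Fin 2 → A)
  invFun := fun v : Fin 2 → A => (v 0, v 1)
  left_inv m := rfl
  right_inv := by
    intro (v : Fin 2 → A)
    exact List.ofFn_inj.mp rfl
  map_add' m m' := by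
    refine funext (Fin.forall_fin_two.mpr ⟨rfl, rfl⟩)

theorem derivPair_smul (l : A ⊗[k] Aᵐᵒᵖ) (m : A × A) :
    l • derivPair D hD m = derivPair D hD (l • m.1, D.rTensor Aᵐᵒᵖ l • m.1 + l • m.2) := by
  change (fun i => ∑ j, (!![l, 0; D.rTensor Aᵐᵒᵖ l, l] : Matrix (Fin 2) (Fin 2) _) i j •
    (![m.1, m.2] : Fin 2 → A) j) = (![_, _] : Fin 2 → A)
  funext i
  rw [Fin.sum_univ_two]
  fin_cases i
  · change l • m.1 + (0 : A ⊗[k] Aᵐᵒᵖ) • m.2 = l • m.1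
    rw [env_zero_smul, add_zero]
  · rfl

/-- The inclusion of the regular bimodule into the self-extension. -/
noncomputable def derivInc : regBimod k A ⟶ derivExt D hD :=
  ModuleCat.ofHom (X := regBimod k A) (Y := derivExt D hD)
    { toFun := fun x => derivPair D hD (0, x)
      map_add' := fun x y => by rw [← map_add]; simp
      map_smul' := fun l x => by
        refine Eq.trans ?_ (derivPair_smul D hD l (0, x)).symm
        have h (l : A ⊗[k] Aᵐᵒᵖ) : l • (0 : A) = 0 := smul_zero _
        simp only [h, zero_add] }

/-- The projection of the self-extension onto the regular bimodule. -/
noncomputable def derivProj : derivExt D hD ⟶ regBimod k A :=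
  ModuleCat.ofHom (X := derivExt D hD) (Y := regBimod k A)
    { toFun := fun x => ((derivPair D hD).symm x).1
      map_add' := fun x y => by rw [map_add]; rfl
      map_smul' := fun l x => by
        obtain ⟨m, rfl⟩ := (derivPair D hD).surjective x
        exact congrArg (fun z => ((derivPair D hD).symm z).1) (derivPair_smul D hD l m) }

theorem derivInc_apply (x : A) : (derivInc D hD).hom x = derivPair D hD (0, x) := rfl

theorem derivProj_apply (m : A × A) : (derivProj D hD).hom (derivPair D hD m) = m.1 := rfl

theorem derivInc_comp_derivProj : derivInc D hD ≫ derivProj D hD = 0 := by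
  ext x
  rfl

theorem deriv_shortExact :
    (ShortComplex.mk _ _ (derivInc_comp_derivProj D hD)).ShortExact where
  exact := by
    rw [ShortComplex.moduleCat_exact_iff]
    intro x hx
    obtain ⟨⟨m, m'⟩, rfl⟩ := (derivPair D hD).surjective x
    change m = 0 at hx
    exact ⟨m', by rw [hx]; rfl⟩
  mono_f := by
    rw [ModuleCat.mono_iff_injective]
    intro x y h
    have := (derivPair D hD).injective h
    exact congrArg Prod.snd this
  epi_g := by
    rw [ModuleCat.epi_iff_surjective]
    intro x
    exact ⟨derivPair D hD (x, 0), rfl⟩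

end DerivationExtension

section WindingExtension
set_option linter.unusedSectionVars false
open CategoryTheory
variable (K : Type u) [Field K] (s : ℕ) [NeZero s]

/-- The self-extension of the regular bimodule attached to the winding derivation. -/
noncomputable abbrev WExt : ModuleCat.{u} (Env K s) := derivExt (wind K s) (wind_mul K s)

/-- Pairs in the self-extension. -/
noncomputable abbrev wPair : Alg K s × Alg K s ≃+ WExt K s := derivPair (wind K s) (wind_mul K s)

/-- The basis vector of a path in the self-extension, with coefficients in `K[ε]`. -/
noncomputable def mt (u v : ℤ) : K × K →+ WExt K s where
  toFun f := wPair K s (f.1 • ptz K s u v, (f.2 - (v / (6 * s) : ℤ) * f.1) • ptz K s u v)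
  map_zero' := by simp
  map_add' f g := by
    rw [← map_add]
    simp only [Prod.fst_add, Prod.snd_add, Prod.mk_add_mk, ← add_smul]
    congr 3
    ring

/-- The coefficient of a path in the self-extension. -/
noncomputable def mco (u v : ℤ) : WExt K s →+ K × K where
  toFun m := (coord K s u v ((wPair K s).symm m).1,
    coord K s u v ((wPair K s).symm m).2 + (v / (6 * s) : ℤ) * coord K s u v ((wPair K s).symm m).1)
  map_zero' := by simp
  map_add' f g := by
    simp only [map_add, Prod.fst_add, Prod.snd_add, Prod.mk_add_mk]
    congr 1
    ring

/-- The twist `(1 + ε) ^ q`. -/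
def tw (q : ℤ) : K × K →+ K × K where
  toFun f := (f.1, f.2 + q * f.1)
  map_zero' := by simp
  map_add' f g := by
    simp only [Prod.fst_add, Prod.snd_add, Prod.mk_add_mk]
    congr 1
    ring

theorem mt_of_not {u v : ℤ} (h : ¬ con u v) (f : K × K) : mt K s u v f = 0 := by
  simp only [mt, AddMonoidHom.coe_mk, ZeroHom.coe_mk]
  rw [ptz_of_not K h, smul_zero, smul_zero]
  exact map_zero _

theorem mt_add (u v q : ℤ) (f : K × K) :
    mt K s (u + 6 * s * q) (v + 6 * s * q) (tw K q f) = mt K s u v f := by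
  simp only [mt, tw, AddMonoidHom.coe_mk, ZeroHom.coe_mk]
  rw [ptz_add, add_ediv]
  congr 3
  push_cast
  ring

theorem mco_add (u v q : ℤ) (m : WExt K s) :
    mco K s (u + 6 * s * q) (v + 6 * s * q) m = tw K q (mco K s u v m) := by
  simp only [mco, tw, AddMonoidHom.coe_mk, ZeroHom.coe_mk]
  rw [coord_add, coord_add, add_ediv]
  congr 1
  push_cast
  ring

theorem mco_mt {u v : ℤ} (h : con u v) (f : K × K) : mco K s u v (mt K s u v f) = f := by
  simp only [mt, mco, AddMonoidHom.coe_mk, ZeroHom.coe_mk]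
  rw [AddEquiv.symm_apply_apply, map_smul, map_smul, coord_ptz_self K s h]
  simp

theorem mco_mt_ne {u v w : ℤ} (hne : v ≠ w) (f : K × K) : mco K s u v (mt K s u w f) = 0 := by
  by_cases h : con u w
  · simp only [mt, mco, AddMonoidHom.coe_mk, ZeroHom.coe_mk]
    rw [AddEquiv.symm_apply_apply, map_smul, map_smul,
      coord_ptz_of_ne K s h (fun _ => hne) (.inl rfl)]
    simp
  · rw [mt_of_not K s h, map_zero]

theorem env_smul_wPair (p q : Alg K s) (m : Alg K s × Alg K s) :
    (p ⊗ₜ[K] MulOpposite.op q : Env K s) • wPair K s m =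
      wPair K s (p * m.1 * q, wind K s p * m.1 * q + p * m.2 * q) := by
  refine (derivPair_smul _ _ _ _).trans ?_
  rw [LinearMap.rTensor_tmul]
  have h (p x : Alg K s) : (p ⊗ₜ[K] MulOpposite.op q : Env K s) • x = p * x * q := by
    change p • (x * q) = p * x * q
    rw [smul_eq_mul, mul_assoc]
  congr 2
  · exact h _ _
  · exact congrArg₂ (· + ·) (h _ _) (h _ _)

set_option synthInstance.maxSize 2000 in
set_option synthInstance.maxHeartbeats 1000000 in
theorem con_mid_aux : ∀ r < 6, ∀ d < 7, ∀ e < 7, ∀ f < 7, con (r : ℕ) (r + d : ℕ) →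
    con (r + d : ℕ) (r + d + e : ℕ) → con (r + d + e : ℕ) (r + d + e + f : ℕ) →
    con (r : ℕ) (r + d + e + f : ℕ) → con (r + d : ℕ) (r + d + e + f : ℕ) := by
  decide +kernel

theorem con_mid {x u v w : ℤ} (h1 : con x u) (h2 : con u v) (h3 : con v w) (h4 : con x w) :
    con u w := by
  have b1 := h1.1
  have b1' := h1.2.1
  have b2 := h2.1
  have b2' := h2.2.1
  have b3 := h3.1
  have b3' := h3.2.1
  obtain ⟨k, r, hr, rfl⟩ : ∃ (k : ℤ) (r : ℕ), r < 6 ∧ x = 6 * k + r :=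
    ⟨x / 6, (x % 6).toNat, by omega, by omega⟩
  obtain ⟨d, rfl⟩ : ∃ d : ℕ, u = 6 * k + (r + d : ℕ) := ⟨(u - (6 * k + r)).toNat, by omega⟩
  obtain ⟨e, rfl⟩ : ∃ e : ℕ, v = 6 * k + (r + d + e : ℕ) :=
    ⟨(v - (6 * k + (r + d : ℕ))).toNat, by omega⟩
  obtain ⟨f, rfl⟩ : ∃ f : ℕ, w = 6 * k + (r + d + e + f : ℕ) :=
    ⟨(w - (6 * k + (r + d + e : ℕ))).toNat, by omega⟩
  rw [con_add'] at h1 h2 h3 h4 ⊢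
  exact con_mid_aux r hr d (by omega) e (by omega) f (by omega) h1 h2 h3 h4

theorem ptz_smul_mt {x u v w : ℤ} (h1 : con x u) (h2 : con u v) (h3 : con v w) (f : K × K) :
    (ptz K s v w ⊗ₜ[K] MulOpposite.op (ptz K s x u) : Env K s) • mt K s u v f = mt K s x w f := by
  have h : ptz K s v w * ptz K s u v * ptz K s x u = ptz K s x w := by
    rw [ptz_mul_ptz K s h2 w h3]
    by_cases h4 : con u w
    · exact ptz_mul_ptz K s h1 w h4
    · rw [ptz_of_not K h4, zero_mul, ptz_of_not K fun h5 => h4 (con_mid h1 h2 h3 h5)]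
  simp only [mt, AddMonoidHom.coe_mk, ZeroHom.coe_mk]
  rw [env_smul_wPair]
  simp only [wind_ptz, smul_mul_assoc, mul_smul_comm, h, ← add_smul, smul_smul]
  congr 4
  push_cast
  ring

theorem vert_smul_wext (u v : ℤ) (S : Finset ℤ) (hS : ∀ q : ℤ, con u (v - 6 * s * q) → q ∈ S)
    (m : WExt K s) : (vert K s v ⊗ₜ[K] MulOpposite.op (vert K s u) : Env K s) • m =
      ∑ q ∈ S, mt K s u (v - 6 * s * q) (mco K s u (v - 6 * s * q) m) := by
  obtain ⟨m, rfl⟩ := (wPair K s).surjective m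
  have hw : wind K s (vert K s v) = 0 := by
    rw [← ptz_self, wind_ptz, sub_self, Int.cast_zero, zero_smul]
  rw [env_smul_wPair, hw, zero_mul, zero_mul, zero_add, vert_mul_mul_vert K s u v S hS,
    vert_mul_mul_vert K s u v S hS]
  simp only [mt, mco, AddMonoidHom.coe_mk, ZeroHom.coe_mk]
  rw [← map_sum]
  simp only [AddEquiv.symm_apply_apply, add_sub_cancel_right]
  congr 1
  ext <;> simp [Prod.fst_sum, Prod.snd_sum]

theorem mco_inc (u v : ℤ) (x : Alg K s) :
    mco K s u v ((derivInc (wind K s) (wind_mul K s)).hom x) = (0, coord K s u v x) := by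
  rw [derivInc_apply]
  simp only [mco, AddMonoidHom.coe_mk, ZeroHom.coe_mk]
  rw [AddEquiv.symm_apply_apply]
  simp

end WindingExtension

section FormalLists
set_option linter.unusedSectionVars false

/-- Formal integer combinations of symbols indexed by a generator and a shift. -/
abbrev Row : Type := List (ℤ × ℕ × ℤ)

variable {A B : Type*} [AddCommGroup A] [AddCommGroup B]

/-- Evaluation of a formal combination. -/
def ev (φ : ℕ → ℤ → A) (l : Row) : A := (l.map fun x => x.1 • φ x.2.1 x.2.2).sum

@[simp] lemma ev_nil (φ : ℕ → ℤ → A) : ev φ [] = 0 := rfl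

@[simp] lemma ev_cons (φ : ℕ → ℤ → A) (x) (l : Row) :
    ev φ (x :: l) = x.1 • φ x.2.1 x.2.2 + ev φ l := by simp [ev]

@[simp] lemma ev_append (φ : ℕ → ℤ → A) (l m : Row) : ev φ (l ++ m) = ev φ l + ev φ m := by
  simp [ev]

lemma ev_congr {φ ψ : ℕ → ℤ → A} {l : Row} (h : ∀ x ∈ l, φ x.2.1 x.2.2 = ψ x.2.1 x.2.2) :
    ev φ l = ev ψ l := by
  induction l with
  | nil => rfl
  | cons x l ih =>
    rw [ev_cons, ev_cons, h x (by simp), ih fun y hy => h y (by simp [hy])]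

lemma map_ev (f : A →+ B) (φ : ℕ → ℤ → A) (l : Row) :
    f (ev φ l) = ev (fun i k => f (φ i k)) l := by
  induction l with
  | nil => simp
  | cons x l ih => simp [ih]

lemma ev_add (φ ψ : ℕ → ℤ → A) (l : Row) :
    ev (fun i k => φ i k + ψ i k) l = ev φ l + ev ψ l := by
  induction l with
  | nil => simp
  | cons x l ih => simp only [ev_cons, ih, smul_add]; abel

lemma ev_filter (p : ℤ × ℕ × ℤ → Bool) {φ : ℕ → ℤ → A} {l : Row}
    (h : ∀ x ∈ l, p x = false → φ x.2.1 x.2.2 = 0) : ev φ (l.filter p) = ev φ l := by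
  induction l with
  | nil => rfl
  | cons x l ih =>
    have := ih fun y hy => h y (by simp [hy])
    cases hp : p x
    · rw [List.filter_cons_of_neg (by simp [hp]), this, ev_cons, h x (by simp) hp, smul_zero,
        zero_add]
    · rw [List.filter_cons_of_pos hp, ev_cons, ev_cons, this]

lemma ev_const {φ : ℕ → ℤ → A} {c : A} {l : Row} (h : ∀ x ∈ l, φ x.2.1 x.2.2 = c) :
    ev φ l = (l.map fun x => x.1).sum • c := by
  induction l with
  | nil => simp
  | cons x l ih =>
    rw [ev_cons, ih fun y hy => h y (by simp [hy]), h x (by simp), List.map_cons,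
      List.sum_cons, add_smul]

/-- Substitution of formal combinations. -/
def lbind (f : ℕ → ℤ → Row) (l : Row) : Row :=
  l.flatMap fun x => (f x.2.1 x.2.2).map fun y => (x.1 * y.1, y.2)

lemma ev_lbind (φ : ℕ → ℤ → A) (f : ℕ → ℤ → Row) (l : Row) :
    ev φ (lbind f l) = ev (fun i k => ev φ (f i k)) l := by
  have key : ∀ (c : ℤ) (m : Row), ev φ (m.map fun y => (c * y.1, y.2)) = c • ev φ m := by
    intro c m
    induction m with
    | nil => simp
    | cons y m ih => simp [ih, mul_smul]
  induction l with
  | nil => rfl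
  | cons x l ih =>
    rw [lbind, List.flatMap_cons, ev_append, key, ev_cons]
    exact congrArg _ ih

/-- Shift of a formal combination. -/
def sh (k : ℤ) (l : Row) : Row := l.map fun y => (y.1, y.2.1, y.2.2 + k)

lemma ev_sh (φ : ℕ → ℤ → A) (k : ℤ) (l : Row) :
    ev φ (sh k l) = ev (fun i j => φ i (j + k)) l := by
  induction l with
  | nil => rfl
  | cons x l ih =>
    rw [sh, List.map_cons, ev_cons, ev_cons]
    exact congrArg _ ih

/-- Coefficient of a symbol in a formal combination. -/
def coefAt (i : ℕ) (k : ℤ) : Row → ℤ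
  | [] => 0
  | x :: l => cond (x.2.1 == i && x.2.2 == k) (x.1 + coefAt i k l) (coefAt i k l)

/-- Test that a formal combination vanishes at all symbols satisfying `P`. -/
def isZero (P : ℕ → ℤ → Bool) (l : Row) : Bool :=
  l.all fun x => !(P x.2.1 x.2.2) || coefAt x.2.1 x.2.2 l == 0

lemma ev_eq_sum (φ : ℕ → ℤ → A) (l : Row) (S : Finset (ℕ × ℤ)) (hS : ∀ x ∈ l, x.2 ∈ S) :
    ev φ l = ∑ p ∈ S, coefAt p.1 p.2 l • φ p.1 p.2 := by
  classical
  induction l with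
  | nil => simp [coefAt]
  | cons x l ih =>
    rw [ev_cons, ih fun y hy => hS y (by simp [hy])]
    have : ∀ p ∈ S, coefAt p.1 p.2 (x :: l) • φ p.1 p.2 =
        (if x.2 = p then x.1 • φ p.1 p.2 else 0) + coefAt p.1 p.2 l • φ p.1 p.2 := by
      rintro ⟨i, k⟩ -
      rcases x with ⟨c, i', k'⟩
      by_cases h : i' = i ∧ k' = k
      · simp [coefAt, h, add_smul]
      · have h2 : (i' == i && k' == k) = false := by simpa using h
        simp [coefAt, h2, Prod.ext_iff, h]
    rw [Finset.sum_congr rfl this, Finset.sum_add_distrib, Finset.sum_ite_eq, if_pos (hS x (by simp))]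

lemma ev_eq_zero (P : ℕ → ℤ → Bool) {φ : ℕ → ℤ → A} {l : Row} (h : isZero P l = true)
    (hφ : ∀ i k, P i k = false → φ i k = 0) : ev φ l = 0 := by
  classical
  rw [ev_eq_sum φ l (l.map fun x => x.2).toFinset (fun x hx => by simpa using ⟨_, hx⟩)]
  refine Finset.sum_eq_zero fun p hp => ?_
  obtain ⟨x, hx, rfl⟩ : ∃ x ∈ l, x.2 = p := by simpa using hp
  have := List.all_eq_true.1 h x hx
  rw [Bool.or_eq_true, Bool.not_eq_true', beq_iff_eq] at this
  rcases this with h | h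
  · rw [hφ _ _ h, smul_zero]
  · rw [h, zero_smul]

end FormalLists

section IdempotentModules
set_option linter.unusedSectionVars false
variable {Λ : Type*} [Ring Λ] {ι : Type*} [Fintype ι] [DecidableEq ι] (e : ι → Λ)

/-- The direct sum of the left ideals generated by a family of elements. -/
def Qmod : Submodule Λ (ι → Λ) where
  carrier := {v | ∀ i, v i * e i = v i}
  add_mem' h h' i := by simp [add_mul, h i, h' i]
  zero_mem' i := by simp
  smul_mem' c v h i := by simp [mul_assoc, h i]

variable {M : Type*} [AddCommGroup M] [Module Λ M]

/-- The map out of `Qmod` with prescribed values. -/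
def Qmod.lift (m : ι → M) : Qmod e →ₗ[Λ] M :=
  (∑ i, (LinearMap.toSpanSingleton Λ M (m i)).comp (LinearMap.proj i)).comp (Qmod e).subtype

lemma Qmod.lift_apply (m : ι → M) (v : Qmod e) : Qmod.lift e m v = ∑ i, v.1 i • m i := by
  simp [Qmod.lift]

variable {e} (he : ∀ i, e i * e i = e i)

/-- The generators of `Qmod`. -/
def Qmod.gen (i : ι) : Qmod e := ⟨Pi.single i (e i), fun j => by
  by_cases h : j = i
  · subst h; simp [he]
  · simp [h]⟩

lemma Qmod.smul_gen (i : ι) : e i • Qmod.gen he i = Qmod.gen he i := by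
  refine Subtype.ext (funext fun j => ?_)
  by_cases h : j = i
  · subst h; simp [Qmod.gen, he]
  · simp [Qmod.gen, h]

lemma Qmod.lift_gen (m : ι → M) (i : ι) : Qmod.lift e m (Qmod.gen he i) = e i • m i := by
  rw [Qmod.lift_apply, Finset.sum_eq_single i]
  · simp [Qmod.gen]
  · intro j _ h; simp [Qmod.gen, h]
  · simp

lemma Qmod.eq_sum (v : Qmod e) : v = ∑ i, v.1 i • Qmod.gen he i := by
  refine Subtype.ext (funext fun j => ?_)
  rw [AddSubmonoidClass.coe_finsetSum, Finset.sum_apply, Finset.sum_eq_single j]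
  · simp [Qmod.gen, v.2 j]
  · intro i _ h; simp [Qmod.gen, h.symm]
  · simp

lemma Qmod.projective (he : ∀ i, e i * e i = e i) : Module.Projective Λ (Qmod e) := by
  refine Module.Projective.of_split (Qmod e).subtype
    (∑ i, (LinearMap.toSpanSingleton Λ _ (Qmod.gen he i)).comp (LinearMap.proj i)) ?_
  ext1 v
  rw [LinearMap.comp_apply, ← LinearMap.comp_apply, ← Qmod.lift, Qmod.lift_apply]
  exact (Qmod.eq_sum he v).symm

end IdempotentModules

section IdempotentObjects
set_option linter.unusedSectionVars false
open CategoryTheory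
variable {Λ : Type u} [Ring Λ] {ι : Type} [Fintype ι] [DecidableEq ι] (e : ι → Λ)

/-- `Qmod` as an object of the module category. -/
def qObj : ModuleCat.{u} Λ := ModuleCat.of Λ (Qmod e)

variable {e}

/-- The generators of `qObj`. -/
def qObj.gen (he : ∀ i, e i * e i = e i) (i : ι) : qObj e := Qmod.gen he i

lemma qObj.smul_gen (he : ∀ i, e i * e i = e i) (i : ι) :
    e i • qObj.gen he i = qObj.gen he i := Qmod.smul_gen he i

/-- The coordinates of an element of `qObj`. -/
def qObj.coeff (i : ι) : qObj e →+ Λ where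
  toFun v := (show Qmod e from v).1 i
  map_zero' := rfl
  map_add' _ _ := rfl

lemma qObj.coeff_smul (i : ι) (l : Λ) (v : qObj e) : qObj.coeff i (l • v) = l * qObj.coeff i v := rfl

lemma qObj.coeff_gen (he : ∀ i, e i * e i = e i) (i j : ι) :
    qObj.coeff i (qObj.gen he j) = if i = j then e j else 0 := by
  change (Pi.single j (e j) : ι → Λ) i = _
  rw [Pi.single_apply]

/-- The map out of `qObj` with prescribed values. -/
def qObj.lift {M : ModuleCat.{u} Λ} (m : ι → M) : qObj e ⟶ M := ModuleCat.ofHom (Qmod.lift e m)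

lemma qObj.lift_gen (he : ∀ i, e i * e i = e i) {M : ModuleCat.{u} Λ} (m : ι → M) (i : ι) :
    (qObj.lift m).hom (qObj.gen he i) = e i • m i := Qmod.lift_gen he m i

lemma qObj.induction (he : ∀ i, e i * e i = e i) {p : qObj e → Prop}
    (hadd : ∀ x y, p x → p y → p (x + y)) (h0 : p 0)
    (h : ∀ (l : Λ) i, p (l • qObj.gen he i)) (x : qObj e) : p x := by
  rw [show x = _ from Qmod.eq_sum he x]
  exact Finset.sum_induction (fun i => (show Qmod e from x).1 i • Qmod.gen he i) p hadd h0
    fun i _ => h _ i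

lemma qObj.projective (he : ∀ i, e i * e i = e i) : Projective (qObj e) :=
  have := Qmod.projective he
  inferInstanceAs (Projective (ModuleCat.of Λ (Qmod e)))

end IdempotentObjects

section ResolutionData

/-- Boolean form of `con`. -/
def conb (x y : ℤ) : Bool :=
  match y - x with
  | Int.ofNat d => Nat.ble d 6 && Nat.testBit 4391503297023 ((x % 6).toNat * 7 + d)
  | Int.negSucc _ => false

lemma conb_iff (x y : ℤ) : conb x y = true ↔ con x y := by
  obtain ⟨d, rfl⟩ : ∃ d, y = x + d := ⟨y - x, by ring⟩
  have hx : x + d - x = d := by ring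
  unfold conb con
  rw [hx]
  rcases d with d | d
  · have h0 : 0 ≤ x % 6 := Int.emod_nonneg _ (by norm_num)
    have h1 : x % 6 < 6 := Int.emod_lt_of_pos _ (by norm_num)
    generalize x % 6 = r at h0 h1
    by_cases hd : d ≤ 6
    · interval_cases d <;> interval_cases r <;> decide +kernel
    · have : Nat.ble d 6 = false := by
        rw [Bool.eq_false_iff, ne_eq, Nat.ble_eq]
        exact hd
      simp only [this, Bool.false_and, Bool.false_eq_true, Int.ofNat_eq_natCast, false_iff]
      omega
  · simp only [Bool.false_eq_true, false_iff]
    omega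

lemma conb_eq_false (x y : ℤ) : conb x y = false ↔ ¬con x y := by
  rw [← conb_iff, Bool.not_eq_true]

/-- Decoding of a formal combination from the digits of a number. -/
def decode : ℕ → ℕ → Row
  | 0, _ => []
  | f + 1, v => bif Nat.beq v 0 then [] else
      (bif Nat.beq ((v % 37 - 1) % 2) 0 then 1 else -1, (v % 37 - 1) / 4,
        (((v % 37 - 1) / 2 % 2 : ℕ) : ℤ)) :: decode f (v / 37)

/-- Sources of the generators of the resolution. -/
def gaData : List (List ℕ) :=
  [[0, 1, 2, 3, 4, 5], [0, 0, 1, 2, 3, 4, 5], [0, 2, 4, 1, 3, 5], [0, 0, 1, 2, 3, 4, 5, 5], [0,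
  2, 4, 0, 1, 2, 3, 4, 5], [0, 0, 2, 4, 1, 3, 5, 5], [0, 1, 2, 3, 4, 5, 1, 3, 5], [0, 0, 1, 2, 3,
  4, 5, 5], [0, 2, 4, 1, 3, 5], [0, 1, 2, 3, 4, 5, 5], [0, 1, 2, 3, 4, 5], [0, 1, 2, 3, 4, 5],
  [0, 0, 1, 2, 3, 4, 5], [0, 2, 4, 1, 3, 5], [0, 0, 1, 2, 3, 4, 5, 5], [0, 2, 4, 0, 1, 2, 3, 4,
  5], [0, 0, 2, 4, 1, 3, 5, 5], [0, 1, 2, 3, 4, 5, 1, 3, 5], [0, 0, 1, 2, 3, 4, 5, 5], [0, 2, 4,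
  1, 3, 5], [0, 1, 2, 3, 4, 5, 5], [0, 1, 2, 3, 4, 5]]

/-- Targets of the generators of the resolution. -/
def gbData : List (List ℕ) :=
  [[0, 1, 2, 3, 4, 5], [1, 3, 2, 5, 4, 5, 6], [5, 9, 7, 8, 10, 12], [8, 10, 11, 12, 11, 12, 13,
  15], [11, 13, 15, 12, 15, 16, 13, 14, 17], [13, 15, 17, 17, 18, 18, 20, 22], [18, 19, 20, 21,
  22, 23, 22, 20, 24], [20, 22, 23, 24, 23, 24, 25, 27], [23, 27, 25, 26, 28, 30], [29, 30, 33,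
  30, 31, 32, 34], [30, 33, 34, 31, 32, 35], [36, 39, 40, 37, 38, 41], [37, 39, 40, 41, 38, 41,
  42], [41, 43, 45, 46, 44, 48], [44, 46, 47, 48, 47, 48, 49, 51], [47, 51, 49, 48, 49, 50, 51,
  52, 53], [49, 51, 53, 53, 54, 54, 56, 58], [54, 57, 58, 55, 56, 59, 56, 58, 60], [56, 58, 59,
  60, 59, 60, 61, 63], [59, 61, 63, 64, 62, 66], [65, 66, 67, 66, 69, 68, 70], [66, 67, 68, 69,
  70, 71]]

/-- Encoded rows of the differential. -/
def dData : List (List ℕ) :=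
  [[187, 483, 339, 787, 643, 795, 781], [1488806853, 34751, 35043, 47579969, 47996445, 51902276],
  [18169, 23496, 18023, 783, 23646, 29122, 789, 29048], [873646, 939, 1095, 1088878, 40228,
  40227, 35056, 35043, 1505242], [34712, 880639, 45996, 1711624, 29430, 1758397, 46352, 1704971],
  [40230989, 633, 935, 29238, 40226, 55688630, 40377, 35005, 35129], [1482814, 1291486, 1296818,
  1231, 1498366, 1700967, 1700597, 1236], [873646, 1087, 947, 1285827, 1499691, 2060939597],
  [1203726219, 1081735, 1073521, 29424, 29202, 29316, 1091355], [18020, 339, 935, 643, 795,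
  35042], [55083980844, 39873720, 39928517, 40240871, 40394310, 60573660042], [483, 187, 339,
  786, 643, 794, 781], [1490679645, 34747, 35047, 47579936, 47996404, 51941643], [23496, 18169,
  18022, 28938, 23647, 786, 785, 29197], [873646, 1087, 947, 1083254, 34753, 34747, 40533, 40523,
  1504946], [23801, 1284345, 1700524, 46296, 1747441, 40678, 46084, 1714551], [40236465, 23613,
  40079, 780, 939, 55688629, 34858, 40529, 34939], [1291450, 1482850, 1295450, 1700672, 1499734,
  1239, 1700857, 1229], [873646, 939, 1095, 1488444, 1297076, 2060945185], [1203726256, 29272,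
  29013, 1087360, 1080515, 29496, 1084696], [18021, 339, 787, 643, 943, 35043], [55155146941,
  39823030, 39927148, 40291561, 40395679, 60506239494]]

/-- Encoded rows of the contracting homotopy. -/
def hData : List (List (List ℕ)) :=
  [[[0, 2, 372, 6, 672, 19538, 1285863], [0, 10, 0, 0, 528, 34753, 1285865], [0, 0, 0, 14, 939,
  34747, 1285939], [0, 18, 832, 35057, 0, 0, 1297117], [0, 22, 947, 0, 0, 35047, 1297191], [0,
  25, 929, 34673, 933, 34973, 1288677]], [[0, 0, 0, 0, 0, 0, 372], [0, 0, 1, 1, 0, 0, 223], [0,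
  0, 0, 0, 0, 0, 14], [0, 0, 0, 0, 6, 6, 226], [0, 0, 0, 0, 0, 0, 18], [0, 0, 10, 10, 0, 0, 10],
  [0, 0, 0, 0, 0, 0, 780]], [[0, 0, 0, 2, 0, 5, 335], [0, 0, 0, 14, 0, 0, 1087], [0, 0, 0, 0, 0,
  22, 947], [0, 0, 0, 9, 527, 9, 337], [0, 17, 831, 0, 0, 17, 637], [0, 25, 25, 29, 1081, 25,
  1089]], [[0, 0, 0, 0, 520, 927, 41997], [0, 2, 13, 0, 0, 631, 30749], [0, 0, 0, 0, 17, 831,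
  30750], [0, 6, 6, 0, 22, 6, 830], [0, 0, 25, 1135, 0, 0, 1135], [0, 0, 30, 10, 10, 30, 10], [0,
  0, 0, 0, 0, 1274, 1285], [0, 0, 1225, 0, 0, 0, 45884]], [[0, 0, 0, 0, 0, 0, 672403], [0, 0, 0,
  0, 0, 9, 9], [0, 0, 14, 0, 0, 0, 14], [0, 1, 1, 6, 6, 1, 672], [0, 0, 10, 18, 0, 0, 25020], [0,
  10, 0, 0, 0, 10, 40078], [0, 0, 0, 0, 0, 22, 818], [0, 0, 0, 0, 13, 13, 975], [0, 0, 0, 25, 0,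
  1080, 25]], [[0, 0, 0, 0, 0, 1, 223], [0, 0, 0, 0, 0, 0, 519], [0, 0, 0, 10, 0, 0, 10], [0, 0,
  0, 0, 0, 18, 795], [0, 5, 5, 0, 26, 5, 188], [0, 0, 29, 13, 642, 29, 13], [0, 0, 0, 0, 33, 33,
  825], [0, 21, 45957, 0, 0, 21, 796]], [[0, 0, 2, 0, 5, 2, 1138122], [0, 0, 0, 0, 0, 0, 34752],
  [0, 0, 0, 0, 14, 14, 34746], [0, 0, 18, 0, 0, 0, 41865], [0, 0, 22, 0, 0, 1095, 40522], [0, 0,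
  25, 0, 0, 0, 1554558], [0, 9, 527, 0, 0, 9, 9], [0, 0, 0, 0, 831, 831, 17], [0, 0, 928, 29, 29,
  1092, 29]], [[0, 0, 0, 0, 0, 372, 483], [0, 2, 2, 0, 0, 2, 631], [0, 0, 0, 13, 0, 0, 487], [0,
  0, 0, 6, 6, 6, 6], [0, 0, 10, 0, 0, 17, 23646], [0, 10, 10, 0, 0, 10, 30492], [0, 0, 0, 0, 0,
  818, 825], [0, 0, 0, 0, 0, 0, 29011]], [[0, 0, 0, 0, 0, 0, 2], [0, 0, 0, 0, 0, 0, 10], [0, 0,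
  0, 0, 0, 0, 17], [0, 0, 0, 0, 5, 5, 819], [0, 0, 14, 0, 0, 14, 939], [0, 0, 21, 0, 25, 21,
  785]], [[0, 1, 482, 23755, 223, 13913, 1488756236], [0, 0, 0, 6, 376, 29125, 1077629], [0, 10,
  787, 29123, 0, 0, 1077666], [0, 14, 680, 0, 0, 680, 680], [0, 18, 0, 0, 18, 18, 1139566], [0,
  0, 0, 0, 0, 30676, 1140935], [0, 21, 781, 0, 0, 29012, 1079035]], [[0, 0, 0, 0, 0, 0, 1], [0,
  0, 0, 0, 0, 0, 6], [0, 0, 0, 0, 0, 0, 10], [0, 0, 0, 0, 0, 0, 13], [0, 0, 0, 0, 0, 0, 17], [0,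
  0, 0, 0, 0, 0, 22]], [[0, 2, 668, 6, 376, 29417, 1346395], [0, 10, 491, 36085, 0, 0, 1335152],
  [0, 13, 975, 0, 0, 36082, 1335189], [0, 18, 0, 0, 795, 36389, 1346396], [0, 0, 0, 21, 983,
  36374, 1346433], [0, 25, 929, 34969, 933, 34677, 1298556]], [[0, 0, 0, 0, 0, 0, 187], [0, 0, 1,
  1, 0, 0, 334], [0, 0, 0, 0, 0, 0, 13], [0, 0, 6, 6, 0, 0, 6], [0, 0, 0, 0, 0, 0, 17], [0, 0, 0,
  0, 10, 10, 374], [0, 0, 0, 0, 0, 0, 817]], [[0, 0, 0, 1, 0, 6, 667], [0, 0, 0, 0, 0, 13, 975],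
  [0, 0, 0, 21, 0, 0, 1131], [0, 9, 490, 0, 0, 9, 340], [0, 0, 0, 17, 794, 17, 632], [0, 25, 25,
  29, 1081, 25, 940]], [[0, 0, 0, 0, 520, 668, 29417], [0, 2, 13, 0, 0, 964, 40665], [0, 0, 18,
  795, 0, 0, 795], [0, 0, 22, 6, 6, 22, 30676], [0, 0, 0, 0, 26, 1099, 40667], [0, 10, 10, 0, 30,
  10, 10], [0, 0, 0, 0, 0, 0, 1278], [0, 0, 1225, 1236, 0, 0, 46217]], [[0, 0, 0, 0, 0, 0,
  672365], [0, 0, 10, 10, 0, 0, 10], [0, 0, 0, 0, 0, 0, 13], [0, 2, 2, 5, 5, 2, 25014], [0, 0, 0,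
  0, 0, 676, 669], [0, 0, 0, 0, 0, 9, 971], [0, 0, 14, 828, 0, 0, 30643], [0, 14, 14, 0, 0, 14,
  40227], [0, 0, 0, 25, 0, 1081, 25]], [[0, 0, 0, 0, 0, 0, 519], [0, 0, 0, 1, 0, 0, 223], [0, 0,
  0, 0, 0, 10, 787], [0, 0, 0, 18, 0, 0, 18], [0, 0, 25, 5, 338, 25, 189], [0, 13, 13, 0, 30, 13,
  13], [0, 0, 0, 0, 33, 33, 834], [0, 21, 1242, 0, 0, 21, 789]], [[0, 0, 2, 0, 5, 2, 1083214],
  [0, 0, 10, 0, 0, 0, 41561], [0, 0, 14, 0, 0, 1087, 40227], [0, 0, 0, 0, 0, 0, 35056], [0, 0, 0,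
  0, 22, 22, 35043], [0, 0, 25, 0, 0, 0, 1554226], [0, 0, 0, 0, 527, 527, 9], [0, 17, 831, 0, 0,
  17, 17], [0, 0, 929, 29, 29, 1085, 29]], [[0, 0, 0, 0, 0, 224, 631], [0, 2, 2, 0, 0, 2, 483],
  [0, 0, 6, 0, 0, 13, 18023], [0, 6, 6, 0, 0, 6, 30343], [0, 0, 0, 17, 0, 0, 639], [0, 0, 0, 10,
  10, 10, 10], [0, 0, 0, 0, 0, 817, 822], [0, 0, 0, 0, 0, 0, 29197]], [[0, 0, 0, 0, 0, 0, 2], [0,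
  0, 0, 0, 0, 0, 9], [0, 0, 0, 0, 0, 0, 18], [0, 0, 6, 0, 0, 6, 931], [0, 0, 0, 0, 13, 13, 827],
  [0, 0, 21, 0, 25, 21, 932]], [[0, 2, 187, 12508, 520, 25162, 1490679645], [0, 6, 376, 0, 0,
  376, 1128281], [0, 10, 0, 0, 10, 30491, 1128355], [0, 0, 0, 14, 680, 29429, 680], [0, 18, 795,
  18, 0, 0, 1088951], [0, 0, 0, 0, 817, 30417, 1131093], [0, 21, 0, 0, 0, 29345, 1091689]], [[0,
  0, 0, 0, 0, 0, 2], [0, 0, 0, 0, 0, 0, 5], [0, 0, 0, 0, 0, 0, 9], [0, 0, 0, 0, 0, 0, 14], [0, 0,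
  0, 0, 0, 0, 18], [0, 0, 0, 0, 0, 0, 21]]]

/-- Number of generators of the term of the resolution of degree `n`. -/
def numGens (n : ℕ) : ℕ := (gaData.getD (n % 22) []).length

/-- Source of the `i`th generator of degree `n`. -/
def ga (n i : ℕ) : ℤ := ((gaData.getD (n % 22) []).getD i 0 : ℕ)

/-- Target of the `i`th generator of degree `n`. -/
def gb (n i : ℕ) : ℤ := ((gbData.getD (n % 22) []).getD i 0 + 72 * (n / 22) : ℕ)

/-- Image of the `i`th generator under the differential from degree `n + 1` to degree `n`. -/
def dRow (n i : ℕ) : Row := decode 8 ((dData.getD (n % 22) []).getD i 0)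

/-- Image of the path of length type `d` on the `i`th generator under the homotopy. -/
def hRow (n i d : ℕ) : Row := decode 8 (((hData.getD (n % 22) []).getD i []).getD d 0)

/-- Whether the symbol of the `i`th generator of degree `n` with shift `k` is nonzero when
extended to source `x` and target `y`. -/
def cnb (n : ℕ) (x y : ℤ) (i : ℕ) (k : ℤ) : Bool :=
  conb (gb n i + 6 * k) y && conb x (ga n i + 6 * k) && Nat.blt i (numGens n)

lemma numGens_add (n m : ℕ) : numGens (n + 22 * m) = numGens n := by simp [numGens]

lemma ga_add (n m i : ℕ) : ga (n + 22 * m) i = ga n i := by simp [ga]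

lemma gb_add (n m i : ℕ) : gb (n + 22 * m) i = gb n i + 6 * (12 * m) := by
  have : (n + 22 * m) / 22 = n / 22 + m := by omega
  simp only [gb, Nat.add_mul_mod_self_left, this]
  push_cast
  ring

lemma dRow_add (n m i : ℕ) : dRow (n + 22 * m) i = dRow n i := by simp [dRow]

lemma hRow_add (n m i d : ℕ) : hRow (n + 22 * m) i d = hRow n i d := by simp [hRow]

/-- The rows of the differential are extensions of generators. -/
def dValid (n : ℕ) : Bool :=
  (List.range 9).all fun i => (dRow n i).all fun x =>
    cnb n (ga (n + 1) i) (gb (n + 1) i) x.2.1 x.2.2 && Nat.blt i (numGens (n + 1))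

/-- The square of the differential vanishes. -/
def dSquare (n : ℕ) : Bool :=
  (List.range 9).all fun i => isZero (cnb n (ga (n + 2) i) (gb (n + 2) i))
    (lbind (fun i' k => sh k (dRow n i')) (dRow (n + 1) i))

/-- The rows of the homotopy are extensions of generators. -/
def hValid (n : ℕ) : Bool :=
  (List.range (numGens n)).all fun i => (List.range 7).all fun d =>
    (hRow n i d).all fun x => cnb (n + 1) (ga n i) (gb n i + d) x.2.1 x.2.2

/-- The homotopy identity in positive degrees. -/
def hIdent (n : ℕ) : Bool :=
  (List.range (numGens (n + 1))).all fun i => (List.range 7).all fun d =>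
    !(conb (gb (n + 1) i) (gb (n + 1) i + d)) ||
    isZero (cnb (n + 1) (ga (n + 1) i) (gb (n + 1) i + d))
      (lbind (fun i' k => sh k (dRow (n + 1) i')) (hRow (n + 1) i d) ++
        lbind (fun i' k => sh k (hRow n i' (gb (n + 1) i + d - gb n i' - 6 * k).toNat))
          ((dRow n i).filter fun x => conb (gb n x.2.1 + 6 * x.2.2) (gb (n + 1) i + d)) ++
        [(-1, i, 0)])

/-- The homotopy identity in degree zero. -/
def hIdentZero : Bool :=
  (List.range 6).all fun i => (List.range 7).all fun d =>
    !(conb i (i + d)) ||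
    isZero (cnb 0 i (i + d))
      (lbind (fun i' k => sh k (dRow 0 i')) (hRow 0 i d) ++
        ([(1, (i + d) % 6, ((i + d) / 6 : ℕ)), (-1, i, 0)] : Row))

lemma dValid_lt : ((List.range 22).all dValid) = true := by decide +kernel

lemma dSquare_lt : ((List.range 22).all dSquare) = true := by decide +kernel

lemma hValid_lt : ((List.range 22).all hValid) = true := by decide +kernel

lemma hIdent_lt : ((List.range 22).all hIdent) = true := by decide +kernel

lemma hIdentZero_eq : hIdentZero = true := by decide +kernel

end ResolutionData

section ResolutionTerms
set_option linter.unusedSectionVars false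
open CategoryTheory MulOpposite
variable (K : Type u) [Field K] (s : ℕ) [NeZero s]

lemma exists_eq_mod_add (n : ℕ) : ∃ r m, r < 22 ∧ n = r + 22 * m :=
  ⟨n % 22, n / 22, Nat.mod_lt _ (by norm_num), (Nat.mod_add_div n 22).symm⟩

lemma all_range {m : ℕ} {f : ℕ → Bool} (h : ((List.range m).all f) = true) {i : ℕ} (hi : i < m) :
    f i = true := List.all_eq_true.1 h i (List.mem_range.2 hi)

lemma numGens_le (n : ℕ) : numGens n ≤ 9 := by
  obtain ⟨r, m, hr, rfl⟩ := exists_eq_mod_add n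
  rw [numGens_add]
  interval_cases r <;> decide

lemma cnb_iff (n : ℕ) (x y : ℤ) (i : ℕ) (k : ℤ) : cnb n x y i k = true ↔
    con (gb n i + 6 * k) y ∧ con x (ga n i + 6 * k) ∧ i < numGens n := by
  rw [cnb, Bool.and_eq_true, Bool.and_eq_true, conb_iff, conb_iff, Nat.blt_eq, and_assoc]

/-- The idempotents defining the terms of the resolution. -/
noncomputable def qe (n : ℕ) (σ : Fin 9 × ZMod s) : Env K s :=
  if (σ.1 : ℕ) < numGens n then
    vert K s (6 * (σ.2.val : ℤ) + gb n σ.1) ⊗ₜ[K] op (vert K s (6 * (σ.2.val : ℤ) + ga n σ.1))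
  else 0

lemma qe_mul_self (n : ℕ) (σ : Fin 9 × ZMod s) : qe K s n σ * qe K s n σ = qe K s n σ := by
  unfold qe
  split_ifs
  · rw [Algebra.TensorProduct.tmul_mul_tmul, ← op_mul, vert_mul_self, vert_mul_self]
  · exact zero_mul _

/-- The terms of the resolution. -/
noncomputable abbrev Q (n : ℕ) : ModuleCat.{u} (Env K s) := qObj (qe K s n)

/-- The generators of the terms of the resolution, including the zero ones. -/
noncomputable abbrev qgen (n : ℕ) (σ : Fin 9 × ZMod s) : Q K s n :=
  qObj.gen (e := qe K s n) (qe_mul_self K s n) σ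

lemma qe_smul_qgen (n : ℕ) (σ : Fin 9 × ZMod s) : qe K s n σ • qgen K s n σ = qgen K s n σ :=
  qObj.smul_gen (e := qe K s n) (qe_mul_self K s n) σ

lemma q_projective (n : ℕ) : Projective (Q K s n) := qObj.projective (qe_mul_self K s n)

/-- The generators of the terms of the resolution. -/
noncomputable def gn (n i : ℕ) (t : ℤ) : Q K s n :=
  if h : i < 9 then qgen K s n (⟨i, h⟩, (t : ZMod s)) else 0

lemma gn_add (n i : ℕ) (t q : ℤ) : gn K s n i (t + s * q) = gn K s n i t := by
  have : ((t + s * q : ℤ) : ZMod s) = t := by simp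
  simp only [gn, this]

lemma vert_cast (t x : ℤ) : vert K s (6 * (((t : ZMod s).val : ℕ) : ℤ) + x) = vert K s (6 * t + x) := by
  obtain ⟨q, hq⟩ := exists_val_intCast s t
  rw [show 6 * t + x = 6 * (((t : ZMod s).val : ℕ) : ℤ) + x + 6 * s * q by rw [hq]; simp; ring,
    vert_add_mul]

lemma qe_cast (n i : ℕ) (h : i < numGens n) (h9 : i < 9) (t : ℤ) :
    qe K s n (⟨i, h9⟩, (t : ZMod s)) =
      vert K s (6 * t + gb n i) ⊗ₜ[K] op (vert K s (6 * t + ga n i)) := by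
  rw [qe, if_pos h, vert_cast, vert_cast]

lemma vert_smul_gn (n i : ℕ) (t : ℤ) :
    (vert K s (6 * t + gb n i) ⊗ₜ[K] op (vert K s (6 * t + ga n i)) : Env K s) • gn K s n i t =
      gn K s n i t := by
  unfold gn
  split_ifs with h
  · by_cases hi : i < numGens n
    · rw [← qe_cast K s n i hi h]
      exact qe_smul_qgen K s n _
    · have : qgen K s n (⟨i, h⟩, (t : ZMod s)) = 0 := by
        rw [← qe_smul_qgen, qe, if_neg hi]
        exact zero_smul _ _
      rw [this, smul_zero]
  · rw [smul_zero]

lemma gn_of_not (n i : ℕ) (t : ℤ) (hi : ¬i < numGens n) : gn K s n i t = 0 := by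
  unfold gn
  split_ifs with h
  · rw [← qe_smul_qgen, qe, if_neg hi]
    exact zero_smul _ _
  · rfl

/-- Paths from position `6t+x` to position `6t+y` through a generator. -/
noncomputable def tm (n : ℕ) (t x y : ℤ) (i : ℕ) (k : ℤ) : Q K s n :=
  (ptz K s (6 * (t + k) + gb n i) (6 * t + y) ⊗ₜ[K]
    op (ptz K s (6 * t + x) (6 * (t + k) + ga n i)) : Env K s) • gn K s n i (t + k)

lemma tm_add (n : ℕ) (t x y : ℤ) (i : ℕ) (k q : ℤ) :
    tm K s n (t + s * q) x y i k = tm K s n t x y i k := by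
  unfold tm
  rw [show t + s * q + k = t + k + s * q by ring, gn_add,
    show 6 * (t + k + s * q) + gb n i = 6 * (t + k) + gb n i + 6 * s * q by ring,
    show 6 * (t + k + s * q) + ga n i = 6 * (t + k) + ga n i + 6 * s * q by ring,
    show 6 * (t + s * q) + x = 6 * t + x + 6 * s * q by ring,
    show 6 * (t + s * q) + y = 6 * t + y + 6 * s * q by ring, ptz_add, ptz_add]

lemma tm_of_cnb (n : ℕ) (t x y : ℤ) (i : ℕ) (k : ℤ) (h : cnb n x y i k = false) :
    tm K s n t x y i k = 0 := by
  rw [← Bool.not_eq_true, cnb_iff] at h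
  unfold tm
  by_cases h1 : con (gb n i + 6 * k) y
  · by_cases h2 : con x (ga n i + 6 * k)
    · rw [gn_of_not K s n i _ fun hi => h ⟨h1, h2, hi⟩, smul_zero]
    · rw [ptz_of_not K (u := 6 * t + x), op_zero, TensorProduct.tmul_zero]
      · exact zero_smul _ _
      · rwa [show 6 * (t + k) + ga n i = 6 * t + (ga n i + 6 * k) by ring, con_add']
  · rw [ptz_of_not K (v := 6 * t + y), TensorProduct.zero_tmul]
    · exact zero_smul _ _
    · rwa [show 6 * (t + k) + gb n i = 6 * t + (gb n i + 6 * k) by ring, con_add']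

lemma smul_tm (n : ℕ) (t x y x' y' l : ℤ) (i : ℕ) (k : ℤ) (h : cnb n x' y' i k = true)
    (hy : con (y' + 6 * l) y) (hx : con x (x' + 6 * l)) :
    (ptz K s (6 * (t + l) + y') (6 * t + y) ⊗ₜ[K] op (ptz K s (6 * t + x) (6 * (t + l) + x')) :
      Env K s) • tm K s n (t + l) x' y' i k = tm K s n t x y i (k + l) := by
  rw [cnb_iff] at h
  have e1 : con (6 * (t + l + k) + gb n i) (6 * (t + l) + y') := by
    rw [show 6 * (t + l + k) + gb n i = 6 * (t + l) + (gb n i + 6 * k) by ring, con_add']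
    exact h.1
  have e2 : con (6 * (t + l) + y') (6 * t + y) := by
    rw [show 6 * (t + l) + y' = 6 * t + (y' + 6 * l) by ring, con_add']
    exact hy
  have e3 : con (6 * (t + l) + x') (6 * (t + l + k) + ga n i) := by
    rw [show 6 * (t + l + k) + ga n i = 6 * (t + l) + (ga n i + 6 * k) by ring, con_add']
    exact h.2.1
  have e4 : con (6 * t + x) (6 * (t + l) + x') := by
    rw [show 6 * (t + l) + x' = 6 * t + (x' + 6 * l) by ring, con_add']
    exact hx
  unfold tm
  rw [← mul_smul, Algebra.TensorProduct.tmul_mul_tmul, ← op_mul, ptz_mul_ptz K s e1 _ e2,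
    ptz_mul_ptz K s e4 _ e3, show t + l + k = t + (k + l) by ring]

lemma smul_ev_tm (n : ℕ) (t x y x' y' l : ℤ) (r : Row)
    (h : ∀ z ∈ r, cnb n x' y' z.2.1 z.2.2 = true)
    (hy : con (y' + 6 * l) y) (hx : con x (x' + 6 * l)) :
    (ptz K s (6 * (t + l) + y') (6 * t + y) ⊗ₜ[K] op (ptz K s (6 * t + x) (6 * (t + l) + x')) :
      Env K s) • ev (tm K s n (t + l) x' y') r = ev (tm K s n t x y) (sh l r) := by
  rw [ev_sh, ← DistribSMul.toAddMonoidHom_apply, map_ev]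
  exact ev_congr fun z hz => smul_tm K s n t x y x' y' l z.2.1 z.2.2 (h z hz) hy hx

/-- The differential of the resolution. -/
noncomputable def qd (n : ℕ) : Q K s (n + 1) ⟶ Q K s n :=
  qObj.lift fun σ => ev (tm K s n σ.2.val (ga (n + 1) σ.1) (gb (n + 1) σ.1)) (dRow n σ.1)

lemma dRow_of_not (n i : ℕ) (hi : ¬i < numGens (n + 1)) : dRow n i = [] := by
  have h : (dData.getD (n % 22) []).length = numGens (n + 1) := by
    obtain ⟨r, m, hr, rfl⟩ := exists_eq_mod_add n
    rw [add_right_comm, numGens_add, Nat.add_mul_mod_self_left]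
    interval_cases r <;> rfl
  rw [dRow, List.getD_eq_default _ _ (by rw [h]; omega)]
  rfl

lemma dRow_valid (n i : ℕ) : ∀ z ∈ dRow n i,
    cnb n (ga (n + 1) i) (gb (n + 1) i) z.2.1 z.2.2 = true := by
  by_cases hi : i < numGens (n + 1)
  · obtain ⟨r, m, hr, rfl⟩ := exists_eq_mod_add n
    intro z hz
    rw [dRow_add] at hz
    have := List.all_eq_true.1 (all_range (all_range dValid_lt hr)
      (hi.trans_le (numGens_le _))) z hz
    rw [Bool.and_eq_true, cnb_iff] at this
    rw [cnb_iff, show r + 22 * m + 1 = r + 1 + 22 * m by ring, ga_add, ga_add, gb_add, gb_add,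
      numGens_add, add_right_comm, con_add]
    exact this.1
  · simp [dRow_of_not n i hi]

lemma cnb_add (n m : ℕ) (x y : ℤ) (i : ℕ) (k : ℤ) :
    cnb (n + 22 * m) x (y + 6 * (12 * m)) i k = cnb n x y i k := by
  rw [Bool.eq_iff_iff, cnb_iff, cnb_iff, ga_add, gb_add, numGens_add, add_right_comm, con_add]

lemma dSquare_eq (n i : ℕ) : isZero (cnb n (ga (n + 2) i) (gb (n + 2) i))
    (lbind (fun i' k => sh k (dRow n i')) (dRow (n + 1) i)) = true := by
  by_cases hi : i < numGens (n + 1 + 1)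
  · obtain ⟨r, m, hr, rfl⟩ := exists_eq_mod_add n
    have := all_range (all_range dSquare_lt hr) (hi.trans_le (numGens_le _))
    simp only [dRow_add, show r + 22 * m + 2 = r + 2 + 22 * m by ring,
      show r + 22 * m + 1 = r + 1 + 22 * m by ring, ga_add, gb_add]
    rw [show cnb (r + 22 * m) (ga (r + 2) i) (gb (r + 2) i + 6 * (12 * m)) = _ from
      funext fun _ => funext fun _ => cnb_add r m _ _ _ _]
    exact this
  · rw [dRow_of_not _ _ hi]
    rfl

lemma ev_tm_cast (n : ℕ) (t x y : ℤ) (r : Row) :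
    ev (tm K s n (((t : ZMod s).val : ℕ) : ℤ) x y) r = ev (tm K s n t x y) r := by
  obtain ⟨q, hq⟩ := exists_val_intCast s t
  refine ev_congr fun z _ => ?_
  conv_rhs => rw [hq, tm_add]

lemma qd_gn (n i : ℕ) (t : ℤ) : (qd K s n).hom (gn K s (n + 1) i t) =
    ev (tm K s n t (ga (n + 1) i) (gb (n + 1) i)) (dRow n i) := by
  by_cases hi : i < numGens (n + 1)
  · have h9 := hi.trans_le (numGens_le _)
    rw [gn, dif_pos h9, qgen, qd, qObj.lift_gen, ev_tm_cast, qe_cast K s (n + 1) i hi h9]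
    have := smul_ev_tm K s n t (ga (n + 1) i) (gb (n + 1) i) (ga (n + 1) i) (gb (n + 1) i) 0
      (dRow n i) (dRow_valid n i) (by simpa using con_self _) (by simpa using con_self _)
    simpa [ptz_self, ev_sh] using this
  · rw [gn_of_not _ _ _ _ _ hi, map_zero, dRow_of_not _ _ hi, ev_nil]

lemma qd_tm (n : ℕ) (t x y : ℤ) (i : ℕ) (k : ℤ) (h : cnb (n + 1) x y i k = true) :
    (qd K s n).hom (tm K s (n + 1) t x y i k) = ev (tm K s n t x y) (sh k (dRow n i)) := by
  rw [cnb_iff] at h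
  rw [tm, map_smul, qd_gn]
  exact smul_ev_tm K s n t x y _ _ k _ (dRow_valid n i) h.1 h.2.1

lemma qd_ev_tm (n : ℕ) (t x y : ℤ) (r : Row)
    (h : ∀ z ∈ r, cnb (n + 1) x y z.2.1 z.2.2 = true) :
    (qd K s n).hom (ev (tm K s (n + 1) t x y) r) =
      ev (tm K s n t x y) (lbind (fun i k => sh k (dRow n i)) r) := by
  rw [ev_lbind, ← LinearMap.toAddMonoidHom_coe (qd K s n).hom, map_ev]
  exact ev_congr fun z hz => qd_tm K s n t x y z.2.1 z.2.2 (h z hz)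

lemma qd_comp_gn (n i : ℕ) (t : ℤ) : (qd K s n).hom ((qd K s (n + 1)).hom (gn K s (n + 2) i t)) = 0 := by
  rw [qd_gn, qd_ev_tm K s n t _ _ _ (dRow_valid (n + 1) i)]
  exact ev_eq_zero _ (dSquare_eq n i) fun i k h => tm_of_cnb K s n t _ _ i k h

variable {K s} in
lemma qgen_eq_gn (n : ℕ) (σ : Fin 9 × ZMod s) : qgen K s n σ = gn K s n σ.1 σ.2.val := by
  rw [gn, dif_pos σ.1.2]
  congr 2
  simp

variable {K s} in
lemma q_hom_ext {n : ℕ} {M : ModuleCat.{u} (Env K s)} {f g : Q K s n ⟶ M}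
    (h : ∀ i t, f.hom (gn K s n i t) = g.hom (gn K s n i t)) : f = g := by
  ext v
  induction v using qObj.induction (e := qe K s n) (he := qe_mul_self K s n) with
  | hadd x y hx hy => rw [map_add, map_add, hx, hy]
  | h0 => rw [map_zero, map_zero]
  | h l σ => rw [map_smul, map_smul, show qObj.gen (e := qe K s n) _ σ = _ from qgen_eq_gn n σ, h]

lemma qd_comp (n : ℕ) : qd K s (n + 1) ≫ qd K s n = 0 :=
  q_hom_ext fun i t => qd_comp_gn K s n i t

end ResolutionTerms

section Homotopy
set_option linter.unusedSectionVars false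
open CategoryTheory MulOpposite
variable (K : Type u) [Field K] (s : ℕ) [NeZero s]

/-- The coefficient of a path in the left factor of the enveloping algebra. -/
noncomputable def cE (u v : ℤ) : Env K s →+ Env K s :=
  (((LinearMap.toSpanSingleton K (Alg K s) 1).comp (coord K s u v)).rTensor
    (Alg K s)ᵐᵒᵖ).toAddMonoidHom

lemma cE_tmul (u v : ℤ) (r : Alg K s) (z : (Alg K s)ᵐᵒᵖ) :
    cE K s u v (r ⊗ₜ z) = (coord K s u v r • (1 : Alg K s)) ⊗ₜ z := rfl

lemma cE_mul (u v : ℤ) (z : (Alg K s)ᵐᵒᵖ) (e : Env K s) :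
    cE K s u v ((1 ⊗ₜ z : Env K s) * e) = (1 ⊗ₜ z : Env K s) * cE K s u v e := by
  induction e using TensorProduct.induction_on with
  | zero => rw [mul_zero, map_zero, mul_zero]
  | tmul r y =>
    rw [Algebra.TensorProduct.tmul_mul_tmul, cE_tmul, cE_tmul,
      Algebra.TensorProduct.tmul_mul_tmul, one_mul, one_mul]
  | add x y hx hy => rw [mul_add, map_add, hx, hy, map_add, mul_add]

/-- The value of the homotopy on a path of type `d` times a generator. -/
noncomputable def hel (n i : ℕ) (t : ℤ) (d : ℕ) : Q K s (n + 1) :=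
  ev (tm K s (n + 1) t (ga n i) (gb n i + d)) (hRow n i d)

/-- The contracting homotopy of the resolution. -/
noncomputable def qh (n : ℕ) : Q K s n →+ Q K s (n + 1) :=
  ∑ σ : Fin 9 × ZMod s, ∑ d ∈ Finset.range 7,
    ((smulAddHom (Env K s) (Q K s (n + 1))).flip (hel K s n σ.1 σ.2.val d)).comp
      ((cE K s (6 * σ.2.val + gb n σ.1) (6 * σ.2.val + gb n σ.1 + d)).comp (qObj.coeff σ))

lemma qh_apply (n : ℕ) (v : Q K s n) : qh K s n v =
    ∑ σ : Fin 9 × ZMod s, ∑ d ∈ Finset.range 7,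
      cE K s (6 * σ.2.val + gb n σ.1) (6 * σ.2.val + gb n σ.1 + d) (qObj.coeff σ v) •
        hel K s n σ.1 σ.2.val d := by
  simp [qh]

lemma qh_smul (n : ℕ) (z : (Alg K s)ᵐᵒᵖ) (v : Q K s n) :
    qh K s n ((1 ⊗ₜ z : Env K s) • v) = (1 ⊗ₜ z : Env K s) • qh K s n v := by
  rw [qh_apply, qh_apply, Finset.smul_sum]
  refine Finset.sum_congr rfl fun σ _ => ?_
  rw [Finset.smul_sum]
  refine Finset.sum_congr rfl fun d _ => ?_
  rw [qObj.coeff_smul, ← mul_smul]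
  exact congrArg (· • _) (cE_mul K s _ _ z _)

lemma hRow_valid (n i d : ℕ) (hi : i < numGens n) (hd : d < 7) : ∀ z ∈ hRow n i d,
    cnb (n + 1) (ga n i) (gb n i + d) z.2.1 z.2.2 = true := by
  obtain ⟨r, m, hr, rfl⟩ := exists_eq_mod_add n
  intro z hz
  rw [hRow_add] at hz
  rw [numGens_add] at hi
  have := List.all_eq_true.1 (all_range (all_range (all_range hValid_lt hr) hi) hd) z hz
  rw [ga_add, gb_add, add_right_comm, show gb r i + 6 * (12 * (m : ℤ)) + d =
    gb r i + d + 6 * (12 * m) by ring, cnb_add]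
  exact this

lemma rsmul_tm (n : ℕ) (t x y x' l : ℤ) (i : ℕ) (k : ℤ) (h : con x' (ga n i + 6 * k))
    (hx : con x (x' + 6 * l)) :
    ((1 : Alg K s) ⊗ₜ[K] op (ptz K s (6 * t + x) (6 * (t + l) + x')) : Env K s) •
      tm K s n (t + l) x' (y - 6 * l) i k = tm K s n t x y i (k + l) := by
  have e3 : con (6 * (t + l) + x') (6 * (t + l + k) + ga n i) := by
    rw [show 6 * (t + l + k) + ga n i = 6 * (t + l) + (ga n i + 6 * k) by ring, con_add']
    exact h
  have e4 : con (6 * t + x) (6 * (t + l) + x') := by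
    rw [show 6 * (t + l) + x' = 6 * t + (x' + 6 * l) by ring, con_add']
    exact hx
  unfold tm
  rw [← mul_smul, Algebra.TensorProduct.tmul_mul_tmul, ← op_mul, ptz_mul_ptz K s e4 _ e3, one_mul,
    show t + l + k = t + (k + l) by ring, show 6 * (t + l) + (y - 6 * l) = 6 * t + y by ring]

lemma rsmul_ev_tm (n : ℕ) (t x y x' l : ℤ) (r : Row)
    (h : ∀ z ∈ r, con x' (ga n z.2.1 + 6 * z.2.2)) (hx : con x (x' + 6 * l)) :
    ((1 : Alg K s) ⊗ₜ[K] op (ptz K s (6 * t + x) (6 * (t + l) + x')) : Env K s) •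
      ev (tm K s n (t + l) x' (y - 6 * l)) r = ev (tm K s n t x y) (sh l r) := by
  rw [ev_sh, ← DistribSMul.toAddMonoidHom_apply, map_ev]
  exact ev_congr fun z hz => rsmul_tm K s n t x y x' l z.2.1 z.2.2 (h z hz) hx

lemma qh_tm_zero (n i d : ℕ) (t : ℤ) (hi : i < numGens n) (hd : d < 7)
    (hc : con (gb n i) (gb n i + d)) :
    qh K s n (tm K s n t (ga n i) (gb n i + d) i 0) = hel K s n i t d := by
  have h9 := hi.trans_le (numGens_le n)
  obtain ⟨q, hq⟩ := exists_val_intCast s t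
  generalize hσ : ((t : ZMod s)) = τ at hq
  have ht : hel K s n i t d = hel K s n i τ.val d := by
    unfold hel
    exact ev_congr fun z _ => by rw [hq, tm_add]
  have hg : tm K s n t (ga n i) (gb n i + d) i 0 =
      (ptz K s (6 * τ.val + gb n i) (6 * τ.val + (gb n i + d)) ⊗ₜ[K]
        op (vert K s (6 * τ.val + ga n i)) : Env K s) • qgen K s n (⟨i, h9⟩, τ) := by
    rw [hq, tm_add, tm, add_zero, ptz_self, qgen_eq_gn]
  have hE : ∀ d' : ℕ, cE K s (6 * τ.val + gb n i) (6 * τ.val + gb n i + d')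
      ((ptz K s (6 * τ.val + gb n i) (6 * τ.val + (gb n i + d)) ⊗ₜ[K]
        op (vert K s (6 * τ.val + ga n i)) : Env K s) * qe K s n (⟨i, h9⟩, τ)) =
      if d' = d then (1 ⊗ₜ op (vert K s (6 * τ.val + ga n i)) : Env K s) else 0 := by
    intro d'
    rw [qe, if_pos hi, Algebra.TensorProduct.tmul_mul_tmul, ptz_mul_vert, ← op_mul, vert_mul_self,
      cE_tmul]
    have hc' : con (6 * τ.val + gb n i) (6 * τ.val + (gb n i + d)) := by rwa [con_add']
    split_ifs with h
    · rw [h, add_assoc, coord_ptz_self K s hc', one_smul]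
    · rw [coord_ptz_of_ne K s hc' (fun _ h' => h (by omega)) (Or.inl rfl), zero_smul,
        TensorProduct.zero_tmul]
  rw [hg, qh_apply, Finset.sum_eq_single (⟨i, h9⟩, τ), Finset.sum_eq_single d, ht]
  · rw [qObj.coeff_smul, qObj.coeff_gen, if_pos rfl]
    refine (congrArg (· • _) ((hE d).trans (if_pos rfl))).trans ?_
    have := rsmul_ev_tm K s (n + 1) τ.val (ga n i) (gb n i + d) (ga n i) 0 (hRow n i d)
      (fun z hz => ((cnb_iff _ _ _ _ _).1 (hRow_valid n i d hi hd z hz)).2.1)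
      (by simpa using con_self _)
    simp only [add_zero, mul_zero, sub_zero, ptz_self, ev_sh] at this
    exact this
  · intro d' _ h
    rw [qObj.coeff_smul, qObj.coeff_gen, if_pos rfl]
    refine (congrArg (· • _) ((hE d').trans (if_neg h))).trans (zero_smul _ _)
  · simp [hd]
  · intro σ _ h
    refine Finset.sum_eq_zero fun d' _ => ?_
    rw [qObj.coeff_smul, qObj.coeff_gen, if_neg h, mul_zero, map_zero, zero_smul]
  · simp

lemma con_toNat {x y : ℤ} (h : con x y) : (y - x).toNat < 7 ∧ y = x + (y - x).toNat := by
  have h1 := h.1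
  have h2 := h.2.1
  omega

lemma qh_tm (n : ℕ) (t x y : ℤ) (i : ℕ) (k : ℤ) (h : cnb n x y i k = true) :
    qh K s n (tm K s n t x y i k) =
      ev (tm K s (n + 1) t x y) (sh k (hRow n i (y - gb n i - 6 * k).toNat)) := by
  rw [cnb_iff] at h
  obtain ⟨h1, h2, h3⟩ := h
  obtain ⟨hd, hy⟩ := con_toNat h1
  rw [← sub_sub] at hd hy
  generalize (y - gb n i - 6 * k).toNat = d at hd hy
  have hc : con (gb n i) (gb n i + d) := by
    rwa [hy, show gb n i + 6 * k + d = gb n i + d + 6 * k by ring, con_add] at h1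
  have e : gb n i + d = y - 6 * k := by rw [hy]; ring
  have := rsmul_tm K s n t x y (ga n i) k i 0 (by simpa using con_self _) h2
  rw [zero_add] at this
  rw [← this, qh_smul, ← e, qh_tm_zero K s n i d (t + k) h3 hd hc, hel, e]
  exact rsmul_ev_tm K s (n + 1) t x y (ga n i) k _
    (fun z hz => ((cnb_iff _ _ _ _ _).1 (hRow_valid n i d h3 hd z hz)).2.1) h2

lemma qh_ev_tm (n : ℕ) (t x y : ℤ) (r : Row) (h : ∀ z ∈ r, cnb n x y z.2.1 z.2.2 = true) :
    qh K s n (ev (tm K s n t x y) r) = ev (tm K s (n + 1) t x y)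
      (lbind (fun i k => sh k (hRow n i (y - gb n i - 6 * k).toNat)) r) := by
  rw [ev_lbind, map_ev]
  exact ev_congr fun z hz => qh_tm K s n t x y z.2.1 z.2.2 (h z hz)

/-- Extensions of generators to the left span the terms of the resolution as right modules. -/
lemma q_induction {n : ℕ} {p : Q K s n → Prop} (hadd : ∀ x y, p x → p y → p (x + y)) (h0 : p 0)
    (h : ∀ (z : (Alg K s)ᵐᵒᵖ) (i d : ℕ) (t : ℤ), i < numGens n → d < 7 →
      con (gb n i) (gb n i + d) →
      p ((1 ⊗ₜ z : Env K s) • tm K s n t (ga n i) (gb n i + d) i 0)) (v : Q K s n) : p v := by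
  have key : ∀ (i : ℕ) (t : ℤ) (r : Alg K s) (z : (Alg K s)ᵐᵒᵖ),
      p ((r ⊗ₜ z : Env K s) • gn K s n i t) := by
    intro i t r z
    by_cases hi : i < numGens n
    · induction r using ptz_induction (K := K) generalizing z with
      | h u v hc =>
        by_cases hu : (u : ZMod (6 * s)) = (6 * t + gb n i : ℤ)
        · obtain ⟨q, hq⟩ := exists_eq_add_of_cast_eq s hu
          have hc' : con (6 * t + gb n i) (v + 6 * s * q) := by
            rw [hq, mul_assoc, con_add]; exact hc
          obtain ⟨hd, hy⟩ := con_toNat hc'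
          generalize (v + 6 * s * q - (6 * t + gb n i)).toNat = d at hd hy
          rw [add_assoc] at hy
          rw [hy, con_add'] at hc'
          have := h z i d t hi hd hc'
          rw [tm, add_zero, ptz_self, ← hy, hq, ptz_add, ← mul_smul,
            Algebra.TensorProduct.tmul_mul_tmul, one_mul] at this
          rw [← vert_smul_gn, ← mul_smul, Algebra.TensorProduct.tmul_mul_tmul, hq, vert_add_mul,
            ptz_mul_vert]
          exact this
        · rw [← vert_smul_gn, ← mul_smul, Algebra.TensorProduct.tmul_mul_tmul, ← ptz_mul_vert,
            mul_assoc, vert_mul_vert, if_neg hu, mul_zero, TensorProduct.zero_tmul]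
          exact (zero_smul (Env K s) (gn K s n i t)).symm ▸ h0
      | hc c x hx =>
        rw [TensorProduct.smul_tmul]
        exact hx _
      | h0 =>
        rw [TensorProduct.zero_tmul]
        exact (zero_smul (Env K s) (gn K s n i t)).symm ▸ h0
      | hadd x y hx hy =>
        rw [TensorProduct.add_tmul]
        exact (add_smul (R := Env K s) _ _ (gn K s n i t)).symm ▸ hadd _ _ (hx z) (hy z)
    · rw [gn_of_not K s n i t hi, smul_zero]
      exact h0
  induction v using qObj.induction (e := qe K s n) (he := qe_mul_self K s n) with
  | hadd x y hx hy => exact hadd x y hx hy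
  | h0 => exact h0
  | h l σ =>
    rw [show qObj.gen (e := qe K s n) _ σ = _ from qgen_eq_gn n σ]
    induction l using TensorProduct.induction_on with
    | zero => exact (zero_smul (Env K s) (gn K s n σ.1 σ.2.val)).symm ▸ h0
    | tmul r z => exact key _ _ r z
    | add x y hx hy =>
      exact (add_smul (R := Env K s) x y (gn K s n σ.1 σ.2.val)).symm ▸ hadd _ _ hx hy

end Homotopy

section Exactness
set_option linter.unusedSectionVars false
open CategoryTheory MulOpposite
variable (K : Type u) [Field K] (s : ℕ) [NeZero s]

lemma cnb_add_fun (n m : ℕ) (x y : ℤ) : cnb (n + 22 * m) x (y + 6 * (12 * m)) = cnb n x y :=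
  funext fun _ => funext fun _ => cnb_add n m _ _ _ _

lemma hIdent_eq (n i d : ℕ) (hi : i < numGens (n + 1)) (hd : d < 7)
    (hc : con (gb (n + 1) i) (gb (n + 1) i + d)) :
    isZero (cnb (n + 1) (ga (n + 1) i) (gb (n + 1) i + d))
      (lbind (fun i' k => sh k (dRow (n + 1) i')) (hRow (n + 1) i d) ++
        lbind (fun i' k => sh k (hRow n i' (gb (n + 1) i + d - gb n i' - 6 * k).toNat))
          ((dRow n i).filter fun x => conb (gb n x.2.1 + 6 * x.2.2) (gb (n + 1) i + d)) ++
        [(-1, i, 0)]) = true := by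
  obtain ⟨r, m, hr, rfl⟩ := exists_eq_mod_add n
  rw [add_right_comm] at hi hc ⊢
  rw [numGens_add] at hi
  rw [gb_add, add_right_comm, con_add] at hc
  have := all_range (all_range (all_range hIdent_lt hr) hi) hd
  rw [(conb_iff _ _).2 hc, Bool.not_true, Bool.false_or] at this
  rw [← this]
  simp only [dRow_add, hRow_add, ga_add, gb_add]
  rw [add_right_comm _ (6 * (12 * (m : ℤ))), cnb_add_fun]
  congr 4
  · funext i' k
    congr 3
    ring
  · congr 1
    funext x
    rw [Bool.eq_iff_iff, conb_iff, conb_iff, add_right_comm, con_add]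

lemma qd_qh (n : ℕ) (v : Q K s (n + 1)) :
    (qd K s (n + 1)).hom (qh K s (n + 1) v) + qh K s n ((qd K s n).hom v) = v := by
  induction v using q_induction with
  | hadd x y hx hy =>
    simp only [map_add]
    conv_rhs => rw [← hx, ← hy]
    abel
  | h0 => simp
  | h z i d t hi hd hc =>
    rw [qh_smul, map_smul, map_smul, qh_smul, ← smul_add]
    congr 1
    have hself : cnb (n + 1) (ga (n + 1) i) (gb (n + 1) i + d) i 0 = true := by
      rw [cnb_iff]
      simpa [hi, con_self] using hc
    have hv : ∀ z ∈ dRow n i, con (ga (n + 1) i) (ga n z.2.1 + 6 * z.2.2) ∧ z.2.1 < numGens n :=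
      fun z hz => ((cnb_iff _ _ _ _ _).1 (dRow_valid n i z hz)).2
    rw [qh_tm_zero K s (n + 1) i d t hi hd hc, hel, qd_ev_tm K s (n + 1) _ _ _ _
      (hRow_valid (n + 1) i d hi hd), qd_tm K s n _ _ _ _ _ hself, ev_sh]
    simp only [add_zero]
    rw [← ev_filter (fun x => conb (gb n x.2.1 + 6 * x.2.2) (gb (n + 1) i + d))
      (l := dRow n i), qh_ev_tm]
    · have := ev_eq_zero _ (hIdent_eq n i d hi hd hc)
        fun i' k h => tm_of_cnb K s (n + 1) t _ _ i' k h
      rw [ev_append, ev_append, ev_cons, ev_nil, add_zero, neg_one_smul, add_neg_eq_zero] at this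
      exact this
    · intro x hx
      rw [List.mem_filter, conb_iff] at hx
      exact (cnb_iff _ _ _ _ _).2 ⟨hx.2, hv x hx.1⟩
    · intro x _ hx
      refine tm_of_cnb K s n t _ _ _ _ ?_
      rw [cnb, hx, Bool.false_and, Bool.false_and]

/-- The augmentation of the resolution. -/
noncomputable def qaug : Q K s 0 ⟶ regBimod K (Alg K s) :=
  qObj.lift fun σ => (vert K s (6 * σ.2.val + gb 0 σ.1) : Alg K s)

attribute [local instance] TensorProduct.Algebra.module

lemma tmul_smul_alg (r z x : Alg K s) : ((r ⊗ₜ op z : Env K s) • x : Alg K s) = r * x * z := by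
  rw [← inL_mul_inR]
  exact (mul_smul (inL K r) (inR K (op z)) x).trans ((congrArg _ (inR_smul _ _)).trans
    ((inL_smul _ _).trans (mul_assoc _ _ _).symm))

lemma ga_zero (i : ℕ) (hi : i < numGens 0) : ga 0 i = i ∧ gb 0 i = i := by
  have : i < 6 := hi
  interval_cases i <;> decide

lemma qaug_gn (i : ℕ) (t : ℤ) (hi : i < numGens 0) :
    (qaug K s).hom (gn K s 0 i t) = (vert K s (6 * t + i) : Alg K s) := by
  have h9 := hi.trans_le (numGens_le 0)
  have h := ga_zero i hi
  rw [gn, dif_pos h9, qaug, qObj.lift_gen, qe_cast K s 0 i hi h9, vert_cast, h.1, h.2]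
  refine (tmul_smul_alg K s _ _ _).trans ?_
  rw [vert_mul_self, vert_mul_self]

lemma qaug_tm (t x y : ℤ) (i : ℕ) (k : ℤ) (h : cnb 0 x y i k = true) :
    (qaug K s).hom (tm K s 0 t x y i k) = (ptz K s (6 * t + x) (6 * t + y) : Alg K s) := by
  rw [cnb_iff] at h
  obtain ⟨h1, h2, hi⟩ := h
  have h3 := ga_zero i hi
  rw [h3.2] at h1
  rw [h3.1] at h2
  rw [tm, map_smul, qaug_gn _ _ _ _ hi, h3.1, h3.2]
  refine (tmul_smul_alg K s _ _ _).trans ?_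
  rw [ptz_mul_vert, ptz_mul_ptz]
  · rwa [show 6 * (t + k) + i = 6 * t + (i + 6 * k) by ring, con_add']
  · rwa [show 6 * (t + k) + i = 6 * t + (i + 6 * k) by ring, con_add']

/-- The homotopy in degree `-1`. -/
noncomputable def qhAug : Alg K s →+ Q K s 0 where
  toFun r := ∑ σ ∈ Finset.range 6 ×ˢ Finset.univ (α := ZMod s),
    ((1 : Alg K s) ⊗ₜ[K] op (vert K s (6 * σ.2.val + σ.1) * r) : Env K s) •
      gn K s 0 σ.1 σ.2.val
  map_zero' := Finset.sum_eq_zero fun σ _ => by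
    rw [mul_zero, op_zero, TensorProduct.tmul_zero]
    exact zero_smul (Env K s) (gn K s 0 σ.1 σ.2.val)
  map_add' x y := by
    rw [← Finset.sum_add_distrib]
    refine Finset.sum_congr rfl fun σ _ => ?_
    rw [mul_add, MulOpposite.op_add, TensorProduct.tmul_add]
    exact add_smul (R := Env K s) _ _ (gn K s 0 σ.1 σ.2.val)

lemma qhAug_apply (r : Alg K s) : qhAug K s r = ∑ σ ∈ Finset.range 6 ×ˢ Finset.univ (α := ZMod s),
    ((1 : Alg K s) ⊗ₜ[K] op (vert K s (6 * σ.2.val + σ.1) * r) : Env K s) •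
      gn K s 0 σ.1 σ.2.val := rfl

lemma qhAug_mul (r z : Alg K s) :
    qhAug K s (r * z) = ((1 : Alg K s) ⊗ₜ[K] op z : Env K s) • qhAug K s r := by
  rw [qhAug_apply, qhAug_apply, Finset.smul_sum]
  refine Finset.sum_congr rfl fun σ _ => ?_
  rw [← mul_smul, Algebra.TensorProduct.tmul_mul_tmul, one_mul, ← op_mul, mul_assoc]

lemma one_tmul_smul_gn (i : ℕ) (t x : ℤ) (hi : i < numGens 0) :
    ((1 : Alg K s) ⊗ₜ[K] op (ptz K s x (6 * t + i)) : Env K s) • gn K s 0 i t =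
      (vert K s (6 * t + i) ⊗ₜ[K] op (ptz K s x (6 * t + i)) : Env K s) • gn K s 0 i t := by
  have h := ga_zero i hi
  conv_lhs => rw [← vert_smul_gn, ← mul_smul, Algebra.TensorProduct.tmul_mul_tmul, h.1, h.2,
    one_mul, ← op_mul, vert_mul_ptz]

lemma qhAug_ptz (t x : ℤ) (y : ℕ) :
    qhAug K s (ptz K s (6 * t + x) (6 * t + y)) = tm K s 0 t x y (y % 6) (y / 6 : ℕ) := by
  have hi : y % 6 < numGens 0 := Nat.mod_lt _ (by norm_num)
  have hy : (6 * (t + (y / 6 : ℕ)) + (y % 6 : ℕ) : ℤ) = 6 * t + y := by omega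
  have h0 := ga_zero _ hi
  obtain ⟨q, hq⟩ := exists_val_intCast s (t + (y / 6 : ℕ))
  generalize hτ : ((t + (y / 6 : ℕ) : ℤ) : ZMod s) = τ at hq
  rw [qhAug_apply, Finset.sum_eq_single (y % 6, τ)]
  · have e : vert K s (6 * τ.val + (y % 6 : ℕ)) = vert K s (6 * t + y) := by
      rw [← hy, hq, ← vert_add_mul K (6 * τ.val + (y % 6 : ℕ)) q]
      congr 1
      ring
    rw [e, vert_mul_ptz, ← gn_add K s 0 _ _ q, ← hq, tm, h0.1, h0.2, hy, ptz_self]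
    have h1 := one_tmul_smul_gn K s (y % 6) (t + (y / 6 : ℕ)) (6 * t + x) hi
    rw [hy] at h1
    exact h1
  · rintro ⟨i, τ'⟩ hσ hne
    rw [vert_mul_ptz_eq]
    split_ifs with h
    · exfalso
      apply hne
      obtain ⟨q', hq'⟩ := exists_eq_add_of_cast_eq s h
      have hi6 : i < 6 := by simpa using hσ
      have e1 : i = y % 6 := by
        have : (6 * t + y : ℤ) = 6 * (τ'.val + s * q') + i := by rw [hq']; ring
        omega
      have e2 : t + (y / 6 : ℕ) = τ'.val + s * q' := by
        have : (6 * t + y : ℤ) = 6 * (τ'.val + s * q') + i := by rw [hq']; ring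
        omega
      rw [e1, ← hτ, e2]
      simp
    · rw [op_zero, TensorProduct.tmul_zero]
      exact zero_smul (Env K s) (gn K s 0 i τ'.val)
  · intro h
    refine (h ?_).elim
    simp [Nat.mod_lt]

lemma qd_qh_zero (v : Q K s 0) :
    (qd K s 0).hom (qh K s 0 v) + qhAug K s ((qaug K s).hom v) = v := by
  induction v using q_induction with
  | hadd x y hx hy =>
    simp only [map_add]
    conv_rhs => rw [← hx, ← hy]
    abel
  | h0 => simp
  | h z i d t hi hd hc =>
    have h0 := ga_zero i hi
    have hself : cnb 0 (ga 0 i) (gb 0 i + d) i 0 = true := by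
      rw [cnb_iff]
      simpa [hi, con_self] using hc
    have e : (qaug K s).hom ((1 ⊗ₜ z : Env K s) • tm K s 0 t (ga 0 i) (gb 0 i + d) i 0) =
        (ptz K s (6 * t + ga 0 i) (6 * t + (gb 0 i + d)) * z.unop : Alg K s) := by
      rw [map_smul, qaug_tm K s _ _ _ _ _ hself]
      exact (tmul_smul_alg K s 1 z.unop _).trans (by rw [one_mul])
    rw [e, qh_smul, map_smul, qhAug_mul, op_unop, ← smul_add]
    congr 1
    rw [qh_tm_zero K s 0 i d t hi hd hc, hel, qd_ev_tm K s 0 _ _ _ _ (hRow_valid 0 i d hi hd),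
      h0.1, h0.2]
    have h1 := all_range (all_range hIdentZero_eq hi) hd
    rw [h0.2] at hc
    rw [(conb_iff _ _).2 hc, Bool.not_true, Bool.false_or] at h1
    have := ev_eq_zero _ h1 fun i' k h => tm_of_cnb K s 0 t _ _ i' k h
    have h2 := qhAug_ptz K s t i (i + d)
    rw [Nat.cast_add] at h2
    rw [h2]
    simp only [ev_append, ev_cons, ev_nil, add_zero, neg_one_smul, one_smul,
      ← sub_eq_add_neg] at this
    rw [← sub_eq_zero, ← this, add_sub_assoc]

/-- The augmentation kills the boundaries. -/
def augCheck : Bool :=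
  (List.range 9).all fun i => ((dRow 0 i).map fun x => x.1).sum == 0

lemma augCheck_eq : augCheck = true := by decide +kernel

lemma qd_qaug : qd K s 0 ≫ qaug K s = 0 := by
  refine q_hom_ext fun i t => ?_
  change (qaug K s).hom ((qd K s 0).hom _) = 0
  by_cases hi : i < 9
  · rw [qd_gn, ← LinearMap.toAddMonoidHom_coe (qaug K s).hom, map_ev]
    have := all_range augCheck_eq hi
    rw [beq_iff_eq] at this
    refine (ev_const fun z hz => qaug_tm K s t _ _ _ _ (dRow_valid 0 i z hz)).trans ?_
    rw [this]
    exact zero_smul ℤ _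
  · rw [gn_of_not K s 1 i t fun h => hi (h.trans_le (numGens_le 1)), map_zero, map_zero]

lemma qaug_surjective : Function.Surjective (qaug K s).hom := by
  intro (r : Alg K s)
  refine ⟨(r ⊗ₜ 1 : Env K s) • ∑ i ∈ Finset.range (6 * s), gn K s 0 (i % 6) (i / 6 : ℕ), ?_⟩
  rw [map_smul, map_sum]
  have : ∀ i ∈ Finset.range (6 * s), (qaug K s).hom (gn K s 0 (i % 6) (i / 6 : ℕ)) =
      (vert K s i : Alg K s) := fun i _ => by
    rw [qaug_gn K s _ _ (show i % 6 < numGens 0 from Nat.mod_lt _ (by norm_num))]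
    congr 1
    omega
  rw [Finset.sum_congr rfl this]
  refine (congrArg ((r ⊗ₜ 1 : Env K s) • ·) (sum_vert K)).trans ?_
  exact (tmul_smul_alg K s r 1 1).trans (by rw [mul_one, mul_one])

/-- The periodic complex of projective bimodules. -/
noncomputable def qComplex : ChainComplex (ModuleCat.{u} (Env K s)) ℕ :=
  ChainComplex.of (Q K s) (qd K s) (qd_comp K s)

lemma qComplex_d (n : ℕ) : (qComplex K s).d (n + 1) n = qd K s n := ChainComplex.of_d _ _ _

lemma qd_exact (n : ℕ) : ((qComplex K s).sc' (n + 2) (n + 1) n).Exact := by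
  rw [ShortComplex.moduleCat_exact_iff]
  intro (x : Q K s (n + 1)) hx
  have h := qd_qh K s n x
  have h1 : (qd K s n).hom x = 0 :=
    (congrArg (fun f : Q K s (n + 1) ⟶ Q K s n => f.hom x) (qComplex_d K s n)).symm.trans hx
  rw [h1, map_zero, add_zero] at h
  exact ⟨qh K s (n + 1) x, (congrArg (fun f : Q K s (n + 2) ⟶ Q K s (n + 1) =>
    f.hom (qh K s (n + 1) x)) (qComplex_d K s (n + 1))).trans h⟩

lemma qaug_exact : (ShortComplex.mk (qd K s 0) (qaug K s) (qd_qaug K s)).Exact := by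
  rw [ShortComplex.moduleCat_exact_iff]
  intro x hx
  refine ⟨qh K s 0 x, ?_⟩
  have h := qd_qh_zero K s x
  rwa [show (qaug K s).hom x = 0 from hx, map_zero, add_zero] at h

/-- The periodic projective resolution. -/
noncomputable def qRes : ProjectiveResolution (regBimod K (Alg K s)) where
  complex := qComplex K s
  projective := q_projective K s
  π := (ChainComplex.toSingle₀Equiv _ _).symm ⟨qaug K s, by
    rw [qComplex_d]
    exact qd_qaug K s⟩
  quasiIso := ⟨fun n => by
    cases n with
    | zero =>
      rw [ChainComplex.quasiIsoAt₀_iff, ShortComplex.quasiIso_iff_of_zeros']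
      · refine (ShortComplex.exact_and_epi_g_iff_of_iso ?_).2
          ⟨qaug_exact K s, (ModuleCat.epi_iff_surjective _).2 (qaug_surjective K s)⟩
        exact ShortComplex.isoMk (Iso.refl _) (Iso.refl _) (Iso.refl _)
          ((Category.id_comp _).trans ((qComplex_d K s 0).symm.trans (Category.comp_id _).symm))
          ((Category.id_comp _).trans (Category.comp_id _).symm)
      all_goals rfl
    | succ n =>
      rw [quasiIsoAt_iff_exactAt']
      · rw [HomologicalComplex.exactAt_iff' _ (n + 2) (n + 1) n (by simp) (by simp)]
        exact qd_exact K s n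
      · apply ChainComplex.exactAt_succ_single_obj⟩

end Exactness

section Sequences
set_option linter.unusedSectionVars false
variable (K : Type u) [Field K] (s : ℕ) [NeZero s]

/-- Sequences of pairs of scalars. -/
abbrev Sq : Type u := ℤ → K × K

/-- Translation of sequences. -/
def shf (k : ℤ) : Module.End K (Sq K) := LinearMap.funLeft K (K × K) (fun t => t + k)

/-- The nilpotent operator `(a, b) ↦ (0, a)`. -/
def eps : Module.End K (Sq K) :=
  ((LinearMap.inr K K K).comp (LinearMap.fst K K K)).compLeft ℤ

lemma shf_apply (k : ℤ) (f : Sq K) (t : ℤ) : shf K k f t = f (t + k) := rfl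

lemma eps_apply (f : Sq K) (t : ℤ) : eps K f t = (0, (f t).1) := rfl

lemma shf_mul (k l : ℤ) : shf K k * shf K l = shf K (k + l) :=
  LinearMap.ext fun f => funext fun t => congrArg f (add_assoc t k l)

lemma shf_shf (k l : ℤ) (f : Sq K) : shf K k (shf K l f) = shf K (k + l) f :=
  DFunLike.congr_fun (shf_mul K k l) f

lemma shf_zero : shf K 0 = 1 := LinearMap.ext fun f => funext fun t => congrArg f (add_zero t)

lemma shf_pow (k : ℤ) (n : ℕ) : shf K k ^ n = shf K (n * k) := by
  induction n with
  | zero => rw [pow_zero, Nat.cast_zero, zero_mul, shf_zero]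
  | succ n ih => rw [pow_succ, ih, shf_mul]; congr 1; push_cast; ring

lemma eps_eps (f : Sq K) : eps K (eps K f) = 0 := rfl

/-- The operators commuting with translations and with `eps`. -/
def natOp : Subalgebra K (Module.End K (Sq K)) :=
  Subalgebra.centralizer K (Set.range (shf K) ∪ {eps K})

lemma shf_mem (k : ℤ) : shf K k ∈ natOp K := by
  rw [natOp, Subalgebra.mem_centralizer_iff]
  rintro _ (⟨l, rfl⟩ | h)
  · rw [shf_mul, shf_mul, add_comm]
  · rw [Set.mem_singleton_iff.1 h]
    rfl

lemma eps_mem : eps K ∈ natOp K := by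
  rw [natOp, Subalgebra.mem_centralizer_iff]
  rintro _ (⟨l, rfl⟩ | h)
  · rfl
  · rw [Set.mem_singleton_iff.1 h]

variable {K}

lemma natOp_shf {x : Module.End K (Sq K)} (hx : x ∈ natOp K) (k : ℤ) (f : Sq K) :
    x (shf K k f) = shf K k (x f) :=
  (DFunLike.congr_fun ((Subalgebra.mem_centralizer_iff K).1 hx _ (Or.inl ⟨k, rfl⟩)) f).symm

lemma natOp_eps {x : Module.End K (Sq K)} (hx : x ∈ natOp K) (f : Sq K) :
    x (eps K f) = eps K (x f) :=
  (DFunLike.congr_fun ((Subalgebra.mem_centralizer_iff K).1 hx _ (Or.inr rfl)) f).symm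

variable (K)

/-- The equivariant sequences. -/
def eqv : Submodule K (Sq K) where
  carrier := {f | ∀ q : ℤ, shf K (s * q) f = f + q • eps K f}
  add_mem' {f g} hf hg q := by rw [map_add, hf q, hg q, map_add, smul_add]; abel
  zero_mem' q := by simp
  smul_mem' c f hf q := by rw [map_smul, hf q, map_smul, smul_add, smul_comm]

variable {K s}

lemma natOp_eqv {x : Module.End K (Sq K)} (hx : x ∈ natOp K) {f : Sq K} (hf : f ∈ eqv K s) :
    x f ∈ eqv K s := fun q => by
  rw [← natOp_shf hx, hf q, map_add, map_zsmul, natOp_eps hx]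

/-- Action of a matrix of formal combinations on families of sequences. -/
def ap (R : ℕ → Row) (F : ℕ → Sq K) (i : ℕ) : Sq K := ev (fun i' k => shf K k (F i')) (R i)

/-- Product of matrices of formal combinations. -/
def tc (R R' : ℕ → Row) (i : ℕ) : Row := lbind (fun i' k => sh k (R' i')) (R i)

lemma ap_tc (R R' : ℕ → Row) (F : ℕ → Sq K) (i : ℕ) : ap (tc R R') F i = ap R (ap R' F) i := by
  rw [ap, tc, ev_lbind, ap]
  refine ev_congr fun x _ => ?_
  rw [ev_sh, ap, ← LinearMap.toAddMonoidHom_coe, map_ev]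
  refine ev_congr fun y _ => ?_
  rw [LinearMap.toAddMonoidHom_coe, shf_shf, add_comm]

lemma natOp_ap {x : Module.End K (Sq K)} (hx : x ∈ natOp K) (R : ℕ → Row) (F : ℕ → Sq K) (i : ℕ) :
    x (ap R F i) = ap R (fun i' => x (F i')) i := by
  rw [ap, ← LinearMap.toAddMonoidHom_coe, map_ev]
  exact ev_congr fun y _ => natOp_shf hx _ _

lemma ap_mem (R : ℕ → Row) (F : ℕ → Sq K) (i : ℕ) (hF : ∀ i, F i ∈ eqv K s) :
    ap R F i ∈ eqv K s := by
  rw [ap]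
  induction R i with
  | nil => exact zero_mem _
  | cons x l ih =>
    rw [ev_cons]
    exact add_mem (zsmul_mem (natOp_eqv (shf_mem K _) (hF _)) _) ih

lemma ap_add (R : ℕ → Row) (F G : ℕ → Sq K) (i : ℕ) :
    ap R (fun i => F i + G i) i = ap R F i + ap R G i := by
  simp only [ap, map_add, ev_add]

variable (K) in
/-- The operator defined by a formal combination. -/
def pol (r : Row) : Module.End K (Sq K) := ev (fun _ k => shf K k) r

lemma pol_mem (r : Row) : pol K r ∈ natOp K := by
  rw [pol]
  induction r with
  | nil => exact zero_mem _
  | cons x l ih =>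
    rw [ev_cons]
    exact add_mem (zsmul_mem (shf_mem K _) _) ih

/-- The diagonal matrix with a given entry. -/
def dg (r : Row) (i : ℕ) : Row := r.map fun x => (x.1, i, x.2.2)

lemma ap_dg (r : Row) (F : ℕ → Sq K) (i : ℕ) : ap (dg r) F i = pol K r (F i) := by
  rw [ap, dg]
  induction r with
  | nil => rfl
  | cons x l ih =>
    rw [List.map_cons, ev_cons, ih, pol, pol, ev_cons]
    rfl

/-- Test for equality of formal combinations. -/
def rowEq (l m : Row) : Bool := isZero (fun _ _ => true) (l ++ m.map fun x => (-x.1, x.2))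

lemma ev_eq_of_rowEq {l m : Row} (h : rowEq l m = true) {A : Type*} [AddCommGroup A]
    (φ : ℕ → ℤ → A) : ev φ l = ev φ m := by
  have h1 := ev_eq_zero (φ := φ) _ h fun i k h => by simp at h
  have h2 : ∀ m : Row, ev φ (m.map fun x => (-x.1, x.2)) = -ev φ m := fun m => by
    induction m with
    | nil => simp
    | cons x l ih => rw [List.map_cons, ev_cons, ev_cons, ih, neg_smul, neg_add]
  rwa [ev_append, h2, add_neg_eq_zero] at h1

lemma ap_eq_of_rowEq {R R' : ℕ → Row} {i : ℕ} (h : rowEq (R i) (R' i) = true) (F : ℕ → Sq K) :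
    ap R F i = ap R' F i := ev_eq_of_rowEq h _

lemma exists_unit {u u' : Row} {m : ℕ}
    (h : rowEq (tc (dg u') (dg u) 0) [(1, 0, 0), (1, 0, m)] = true) (hs : m = 0 ∨ Odd s) :
    ∃ x ∈ natOp K, ∃ c : ℤ, ∀ f ∈ eqv K s, x (pol K u f) = (2 : K) • f + c • eps K f := by
  have hu : ∀ f, pol K u' (pol K u f) = f + shf K m f := fun f => by
    have := ap_eq_of_rowEq (R' := fun _ => [(1, 0, 0), (1, 0, (m : ℤ))]) h fun _ => f
    rw [ap_tc, ap_dg, ap_dg] at this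
    rw [this]
    simp [ap, shf_zero]
  rcases hs with rfl | hs
  · refine ⟨pol K u', pol_mem _, 0, fun f _ => ?_⟩
    rw [hu, Nat.cast_zero, shf_zero, zero_smul, add_zero, two_smul]
    rfl
  · refine ⟨(∑ i ∈ Finset.range s, (-shf K m) ^ i) * pol K u', mul_mem (sum_mem fun i _ =>
      pow_mem (neg_mem (shf_mem K _)) _) (pol_mem _), m, fun f hf => ?_⟩
    have h1 := geom_sum_mul_neg (-shf K m) s
    have h3 : (-shf K m) ^ s = -(shf K m ^ s) := by
      have h4 : (-shf K m) = (-1 : K) • shf K m := (neg_one_smul K _).symm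
      rw [h4, smul_pow, hs.neg_one_pow, neg_one_smul]
    rw [h3, sub_neg_eq_add, sub_neg_eq_add, shf_pow] at h1
    have h2 := DFunLike.congr_fun h1 f
    rw [Module.End.mul_apply, hu]
    refine h2.trans ?_
    rw [LinearMap.add_apply, hf m, two_smul, add_assoc]
    rfl

lemma pol_quartic : pol K [(1, 0, 4), (-1, 0, 0)] = shf K 4 - 1 := by
  simp [pol, shf_zero, sub_eq_add_neg]

lemma exists_quartic (h2 : (2 : K) ≠ 0) {f : Sq K} (hf : f ∈ eqv K s) (h0 : eps K f = 0) :
    ∃ g ∈ eqv K s, pol K [(1, 0, 4), (-1, 0, 0)] g = f := by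
  have hs : (s : ℤ) ≠ 0 := Nat.cast_ne_zero.2 (NeZero.ne s)
  have hf1 : ∀ t, (f t).1 = 0 := fun t => congrArg Prod.snd (congrFun h0 t)
  have hp : ∀ q t : ℤ, f (t + s * q) = f t := fun q t => by
    have := congrFun (hf q) t
    rwa [h0, smul_zero, add_zero] at this
  let g : Sq K := fun t => ((f t).2, (t / s : ℤ) • (f t).2)
  have hg : g ∈ eqv K s := fun q => funext fun t => by
    change ((f (t + s * q)).2, ((t + s * q) / s : ℤ) • (f (t + s * q)).2) =
      ((f t).2, (t / s : ℤ) • (f t).2) + q • ((0 : K), (f t).2)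
    rw [hp, Int.add_mul_ediv_left _ _ hs, add_smul, Prod.smul_mk, smul_zero, Prod.mk_add_mk,
      add_zero]
  have h4 : (4 : K) ≠ 0 := by
    rw [show (4 : K) = 2 * 2 by norm_num]
    exact mul_ne_zero h2 h2
  refine ⟨(4 : K)⁻¹ • (∑ i ∈ Finset.range s, shf K 4 ^ i) g, Submodule.smul_mem _ _
    (natOp_eqv (sum_mem fun i _ => pow_mem (shf_mem K _) _) hg), ?_⟩
  have h3 := DFunLike.congr_fun (mul_geom_sum (shf K 4) s) g
  rw [shf_pow, LinearMap.sub_apply, hg 4] at h3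
  rw [pol_quartic, map_smul]
  refine (congrArg _ h3).trans ?_
  rw [Module.End.one_apply, add_sub_cancel_left, inv_smul_eq_iff₀ h4]
  funext t
  change (4 : ℤ) • ((0 : K), (f t).2) = (4 : K) • f t
  rw [show f t = (0, (f t).2) from Prod.ext (hf1 t) rfl, ← Int.cast_smul_eq_zsmul K]
  norm_num

lemma eps_eq_zero_of_quartic (h2 : (2 : K) ≠ 0) {f : Sq K} (hf : f ∈ eqv K s)
    (h : pol K [(1, 0, 4), (-1, 0, 0)] f = 0) : eps K f = 0 := by
  have h4 : (4 : K) ≠ 0 := by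
    rw [show (4 : K) = 2 * 2 by norm_num]
    exact mul_ne_zero h2 h2
  have h3 := DFunLike.congr_fun (geom_sum_mul (shf K 4) s) f
  rw [← pol_quartic, Module.End.mul_apply, h, map_zero, shf_pow, LinearMap.sub_apply, hf 4,
    Module.End.one_apply, add_sub_cancel_left, ← Int.cast_smul_eq_zsmul K, Int.cast_ofNat] at h3
  exact (smul_eq_zero.1 h3.symm).resolve_left h4

lemma exists_cubic (hs : ¬3 ∣ s) {f : Sq K} (hf : f ∈ eqv K s) (h0 : eps K f = 0)
    (h : pol K [(1, 0, 0), (1, 0, 1), (1, 0, 2)] f = 0) :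
    ∃ g ∈ eqv K s, pol K [(1, 0, 0), (1, 0, 1), (1, 0, 2)] g = 0 ∧ eps K g = f := by
  have hpol : ∀ (g : Sq K) t, pol K [(1, 0, 0), (1, 0, 1), (1, 0, 2)] g t =
      g t + (g (t + 1) + g (t + 2)) := fun g t => by
    simp [pol, shf_zero, shf_apply]
  have hf1 : ∀ t, (f t).1 = 0 := fun t => congrArg Prod.snd (congrFun h0 t)
  have hp : Function.Periodic f s := fun t => by
    have := congrFun (hf 1) t
    rwa [h0, smul_zero, add_zero, mul_one] at this
  have h3 : Function.Periodic f 3 := fun t => by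
    have e1 := (hpol f t).symm.trans (congrFun h t)
    have e2 := (hpol f (t + 1)).symm.trans (congrFun h (t + 1))
    rw [add_assoc, add_assoc, one_add_one_eq_two, show (1 + 2 : ℤ) = 3 from rfl,
      ← add_assoc] at e2
    rw [add_comm] at e1
    exact add_left_cancel (e2.trans e1.symm)
  have h1 : Function.Periodic f 1 := by
    obtain ⟨a, b, hab⟩ : IsCoprime (3 : ℤ) s := by
      rw [show (3 : ℤ) = (3 : ℕ) from rfl, Nat.isCoprime_iff_coprime]
      exact (Nat.Prime.coprime_iff_not_dvd Nat.prime_three).2 hs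
    rw [← hab]
    exact (h3.int_mul a).add_period (hp.int_mul b)
  obtain ⟨c, hc⟩ : ∃ c : K, ∀ t, f t = (0, c) := ⟨(f 0).2, fun t => by
    have := h1.int_mul_eq t
    rw [mul_one, Int.cast_id] at this
    exact Prod.ext (hf1 t) (by rw [this])⟩
  have hc3 : 3 * c = 0 := by
    have := congrArg Prod.snd ((hpol f 0).symm.trans (congrFun h 0))
    rw [hc, hc, hc] at this
    change c + (c + c) = 0 at this
    linear_combination this
  by_cases h3 : (3 : K) = 0
  · have hsK : (s : K) ≠ 0 := fun h => by
      obtain ⟨a, b, hab⟩ : IsCoprime (3 : ℤ) s := by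
        rw [show (3 : ℤ) = (3 : ℕ) from rfl, Nat.isCoprime_iff_coprime]
        exact (Nat.Prime.coprime_iff_not_dvd Nat.prime_three).2 hs
      have := congrArg (Int.cast : ℤ → K) hab
      push_cast at this
      rw [h3, h, mul_zero, mul_zero, add_zero] at this
      exact zero_ne_one this
    refine ⟨fun t => (c, (t : K) * (s : K)⁻¹ * c), fun q => funext fun t => ?_,
      funext fun t => ?_, funext fun t => (hc t).symm⟩
    · change (c, ((t + s * q : ℤ) : K) * (s : K)⁻¹ * c) =
        (c, (t : K) * (s : K)⁻¹ * c) + q • ((0 : K), c)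
      rw [Prod.smul_mk, smul_zero, Prod.mk_add_mk, add_zero, zsmul_eq_mul]
      refine Prod.ext rfl ?_
      push_cast
      field_simp
    · rw [hpol]
      refine Prod.ext ?_ ?_
      · change c + (c + c) = 0
        linear_combination hc3
      · change (t : K) * (s : K)⁻¹ * c + (((t + 1 : ℤ) : K) * (s : K)⁻¹ * c +
          ((t + 2 : ℤ) : K) * (s : K)⁻¹ * c) = 0
        push_cast
        linear_combination ((t : K) + 1) * (s : K)⁻¹ * hc3
  · refine ⟨0, zero_mem _, map_zero _, funext fun t => ?_⟩
    rw [hc, (mul_eq_zero.1 hc3).resolve_left h3]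
    rfl

end Sequences

section HomotopyData
set_option linter.unusedSectionVars false

/-- The generators carrying a nonzero cochain of winding number `j`. -/
def cv (n : ℕ) (j : ℤ) (i : ℕ) : Bool :=
  Nat.blt i (numGens n) && conb (ga n i) (gb n i - 6 * j)

/-- The differential on cochains of winding number `j`. -/
def dd (n : ℕ) (j : ℤ) (i : ℕ) : Row :=
  bif cv (n + 1) j i then (dRow n i).filter fun x => cv n j x.2.1 else []

/-- A homotopy `h`, `h'` on cochains in degree `n + 1` and winding number `j` between `u` and a
map factoring through a single sequence, where `u' * u = 1 + ρ ^ m`. -/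
structure Htpy where
  /-- the degree below -/
  n : ℕ
  /-- the winding number -/
  j : ℕ
  /-- the multiplier -/
  u : Row
  /-- the complementary multiplier -/
  u' : Row
  /-- the exponent -/
  m : ℕ
  /-- the homotopy from degree `n + 1` -/
  h : List Row
  /-- the homotopy from degree `n + 2` -/
  h' : List Row
  /-- the inclusion of the defect -/
  k : List Row
  /-- the projection to the defect -/
  p : Row
  /-- the first correction -/
  a : List Row
  /-- the second correction -/
  b : List Row

/-- The matrix with given rows. -/
def tb (l : List Row) (i : ℕ) : Row := l.getD i []

namespace Htpy

/-- The homotopy identity. -/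
def valid (c : Htpy) : Bool :=
  rowEq (tc (dg c.u') (dg c.u) 0) [(1, 0, 0), (1, 0, c.m)] && (c.m == 0 || c.j % 2 == 1) &&
  (List.range 9).all fun i => !cv (c.n + 1) c.j i ||
    rowEq (dg c.u i) (tc (dd c.n c.j) (tb c.h) i ++ tc (tb c.h') (dd (c.n + 1) c.j) i ++
      tc (tb c.k) (fun _ => c.p) i)

/-- The defect vanishes. -/
def isUnit (c : Htpy) : Bool := c.valid && c.p.isEmpty

/-- The defect is killed by `ρ ^ 4 - 1` up to boundaries. -/
def isCoker (c : Htpy) : Bool :=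
  c.valid && (List.range 9).all fun i => !cv (c.n + 1) c.j i ||
    rowEq (tc (tb c.k) (dg [(1, 0, 4), (-1, 0, 0)]) i) (tc (dd c.n c.j) (tb c.a) i)

/-- The defect of a cocycle is killed by `ρ ^ 4 - 1`. -/
def isKer (c : Htpy) : Bool :=
  c.valid && rowEq (tc (dg [(1, 0, 4), (-1, 0, 0)]) (fun _ => c.p) 0)
    (tc (fun _ => tb c.a 0) (dd (c.n + 1) c.j) 0)

/-- The defect of a cocycle is killed by `ρ ^ 2 + ρ + 1`. -/
def isCubic (c : Htpy) : Bool :=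
  c.valid && rowEq (tc (dg [(1, 0, 0), (1, 0, 1), (1, 0, 2)]) (fun _ => c.p) 0)
    (tc (fun _ => tb c.a 0) (dd (c.n + 1) c.j) 0) && c.j % 3 == 2 &&
  (List.range 9).all fun i => rowEq (tc (dd (c.n + 1) c.j) (tb c.k) i)
    (tc (tb c.b) (dg [(1, 0, 0), (1, 0, 1), (1, 0, 2)]) i)

end Htpy

/-- Homotopies without defect. -/
def unitHtpies : List Htpy := [
    ⟨2, 1, [(1, 0, 0), (1, 0, 3)], [(1, 0, 0)], 3, [[], [], [], [(1, 0, 0), (1, 0, 3)], [(1, 1,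
    0), (1, 1, 3)], [(1, 3, 0), (1, 3, 3)]], [[], [], [(1, 0, 0), (1, 0, 3), (-1, 1, 0), (1, 1,
    1), (-1, 1, 2), (1, 2, 0), (-1, 2, 1), (1, 2, 2), (1, 3, 0), (-1, 3, 1), (1, 3, 2), (-1, 8,
    0), (1, 8, 1), (-1, 8, 2)], [], [(1, 1, 0), (-1, 1, 1), (1, 1, 2), (-1, 2, 0), (1, 2, 1),
    (-1, 2, 2), (-1, 3, 0), (1, 3, 1), (-1, 3, 2), (1, 8, 0), (-1, 8, 1), (1, 8, 2)], [(1, 1, 0),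
    (-1, 1, 1), (1, 1, 2), (-1, 2, 0), (1, 2, 1), (-1, 2, 2), (1, 3, 1), (-1, 3, 2), (1, 3, 3),
    (1, 8, 0), (-1, 8, 1), (1, 8, 2)], [(1, 1, 0), (1, 1, 3)], [(1, 1, 0), (-1, 1, 1), (1, 1, 2),
    (1, 2, 1), (-1, 2, 2), (1, 2, 3), (1, 3, 1), (-1, 3, 2), (1, 3, 3), (1, 8, 0), (-1, 8, 1),
    (1, 8, 2)]], [], [], [], []⟩,
    ⟨10, 5, [(1, 0, 0), (1, 0, 3)], [(1, 0, 0)], 3, [[(1, 0, 0), (-1, 0, 2), (1, 5, 0), (1, 5,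
    1)], [], [], [], [], [(1, 0, 1), (1, 0, 2), (-1, 5, 0), (1, 5, 2)]], [], [], [], [], []⟩,
    ⟨10, 6, [(1, 0, 0)], [(2, 0, 0)], 0, [], [[(-1, 0, 0)], [], [], [], [], [(1, 3, 0)]], [], [],
    [], []⟩,
    ⟨12, 7, [(1, 0, 0)], [(2, 0, 0)], 0, [], [[], [], [], [], [], [(1, 3, 0)]], [], [], [], []⟩,
    ⟨16, 8, [(1, 0, 0)], [(2, 0, 0)], 0, [[], [], [], [], [], [(1, 0, 0)], [], [(1, 5, 0)]], [],
    [], [], [], []⟩,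
    ⟨16, 9, [(1, 0, 0), (1, 0, 3)], [(1, 0, 0)], 3, [], [[(-1, 0, 0), (1, 0, 1), (-1, 0, 2), (1,
    2, 0), (-1, 2, 1), (1, 2, 2), (-1, 3, 0), (1, 3, 1), (-1, 3, 2), (1, 5, 0), (-1, 5, 1), (1,
    5, 2)], [], [], [], [], [(-1, 0, 1), (1, 0, 2), (-1, 0, 3), (1, 2, 1), (-1, 2, 2), (1, 2, 3),
    (1, 3, 0), (-1, 3, 1), (1, 3, 2), (-1, 5, 0), (1, 5, 1), (-1, 5, 2)], [(1, 0, 1), (-1, 0, 2),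
    (1, 0, 3), (1, 2, 0), (-1, 2, 1), (1, 2, 2), (-1, 3, 0), (1, 3, 1), (-1, 3, 2), (1, 5, 0),
    (-1, 5, 1), (1, 5, 2)], [(1, 0, 0), (-1, 0, 1), (1, 0, 2), (1, 1, 0), (1, 1, 3), (-1, 2, 0),
    (1, 2, 1), (-1, 2, 2), (1, 3, 0), (-1, 3, 1), (1, 3, 2), (-1, 5, 0), (1, 5, 1), (-1, 5, 2)],
    [(1, 5, 0), (1, 5, 3)]], [], [], [], []⟩,
    ⟨18, 9, [(1, 0, 0)], [(2, 0, 0)], 0, [[], [], [], [], [(1, 0, 0)], [], [(1, 1, 0)], [(1, 2,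
    0)]], [], [], [], [], []⟩,
    ⟨18, 10, [(1, 0, 0)], [(2, 0, 0)], 0, [], [[], [], [], [], [], [(1, 1, 0)]], [], [], [], []⟩,
    ⟨3, 1, [(1, 0, 0), (1, 0, 3)], [(1, 0, 0)], 3, [[], [], [(1, 0, 0), (1, 0, 3), (-1, 1, 0),
    (1, 1, 1), (-1, 1, 2), (1, 2, 0), (-1, 2, 1), (1, 2, 2), (1, 3, 0), (-1, 3, 1), (1, 3, 2),
    (-1, 8, 0), (1, 8, 1), (-1, 8, 2)], [], [(1, 1, 0), (-1, 1, 1), (1, 1, 2), (-1, 2, 0), (1, 2,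
    1), (-1, 2, 2), (-1, 3, 0), (1, 3, 1), (-1, 3, 2), (1, 8, 0), (-1, 8, 1), (1, 8, 2)], [(1, 1,
    0), (-1, 1, 1), (1, 1, 2), (-1, 2, 0), (1, 2, 1), (-1, 2, 2), (1, 3, 1), (-1, 3, 2), (1, 3,
    3), (1, 8, 0), (-1, 8, 1), (1, 8, 2)], [(1, 1, 0), (1, 1, 3)], [(1, 1, 0), (-1, 1, 1), (1, 1,
    2), (1, 2, 1), (-1, 2, 2), (1, 2, 3), (1, 3, 1), (-1, 3, 2), (1, 3, 3), (1, 8, 0), (-1, 8,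
    1), (1, 8, 2)]], [], [], [], [], []⟩,
    ⟨3, 2, [(1, 0, 0)], [(2, 0, 0)], 0, [], [[], [], [], [(1, 0, 0)], [], [], [], [], [(1, 2,
    0)]], [], [], [], []⟩,
    ⟨7, 3, [(1, 0, 0)], [(2, 0, 0)], 0, [[], [], [], [], [(1, 0, 0)]], [], [], [], [], []⟩,
    ⟨9, 4, [(1, 0, 0)], [(2, 0, 0)], 0, [[], [], [], [(1, 0, 0)], [], [], [(1, 5, 0)]], [], [],
    [], [], []⟩,
    ⟨9, 5, [(1, 0, 0), (1, 0, 3)], [(1, 0, 0)], 3, [], [[(1, 0, 0), (-1, 0, 2), (1, 5, 0), (1, 5,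
    1)], [], [], [], [], [(1, 0, 1), (1, 0, 2), (-1, 5, 0), (1, 5, 2)]], [], [], [], []⟩]

/-- Homotopies whose defect factors through a cokernel of `ρ ^ 4 - 1`. -/
def cokerHtpies : List Htpy := [
    ⟨0, 0, [(1, 0, 0)], [(2, 0, 0)], 0, [[], [(1, 0, 0)], [(1, 0, 0), (1, 2, 0)], [(1, 1, 0)],
    [(1, 1, 0), (1, 4, 0)], [(1, 0, 0), (1, 2, 0), (1, 3, 0)]], [[], [], [], [], [], [(1, 0,
    0)]], [[], [], [], [], [], [], [(1, 0, 0)]], [(-1, 0, 0), (-1, 2, 0), (-1, 3, 0), (1, 6, 0)],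
    [[(-1, 0, 0), (-1, 0, 1), (-1, 0, 2), (-1, 0, 3)], [(-1, 0, 0), (-1, 0, 1), (-1, 0, 2), (-1,
    0, 3)], [(-1, 0, 0), (-1, 0, 1), (-1, 0, 2), (-1, 0, 3)], [(-1, 0, 0), (-1, 0, 1), (-1, 0,
    2), (-1, 0, 3)], [(-1, 0, 0), (-1, 0, 1), (-1, 0, 2), (-1, 0, 3)], [(-1, 0, 0), (-1, 0, 1),
    (-1, 0, 2), (-1, 0, 3)]], []⟩,
    ⟨6, 3, [(1, 0, 0)], [(2, 0, 0)], 0, [[(-1, 0, -1), (-1, 1, -1), (1, 2, -1), (1, 3, -2), (-1,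
    3, -1), (1, 5, -1), (-1, 7, -2)], [(-1, 0, -1), (1, 0, 0), (-1, 1, -1), (1, 2, -1), (1, 3,
    -2), (-1, 3, -1), (1, 5, -1), (-1, 7, -2)], [], [(-1, 3, -1), (1, 7, -1)], [(-1, 0, -1), (-1,
    1, -1), (-1, 1, 0), (1, 2, -1), (1, 3, -2), (1, 5, -1), (-1, 7, -2), (-1, 7, -1)], [(-1, 0,
    -1), (1, 0, 0), (-1, 1, -1), (1, 2, -1), (-1, 2, 0), (1, 3, -2), (-1, 3, -1), (1, 5, -1),
    (-1, 7, -2)], [], [], [(1, 3, 0)]], [[], [], [], [], [(1, 0, 0)]], [[], [], [], [], [], [],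
    [(1, 0, 0)]], [(1, 0, -1), (-1, 0, 0), (1, 0, 1), (1, 1, -1), (-1, 2, -1), (1, 2, 0), (-1, 3,
    -2), (1, 3, -1), (-1, 3, 0), (-1, 5, -1), (1, 6, 0), (1, 7, -2)], [[(-1, 0, 0), (1, 0, 2)],
    [(-1, 0, 0), (-1, 0, 3)], [(-1, 0, 2), (-1, 0, 3)], [(1, 0, 1), (1, 0, 2)], [(-1, 0, 0), (-1,
    0, 1)], [(-1, 0, 0), (1, 0, 2)], [], [], [(-1, 0, 2), (-1, 0, 3)]], []⟩,
    ⟨8, 4, [(1, 0, 0)], [(2, 0, 0)], 0, [[], [], [], [], [(1, 0, 0)], [(1, 1, 0)]], [[], [], [],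
    [(1, 0, 0)], [], [], [(1, 5, 0)]], [[], [], [], [], [], [(1, 0, 0)], [(1, 0, 0)]], [(-1, 1,
    0), (1, 5, 0)], [[], [], [], [(1, 0, 0), (1, 0, 1), (1, 0, 2), (1, 0, 3)], [(-1, 0, 0), (-1,
    0, 1), (-1, 0, 2), (-1, 0, 3)], [(-1, 0, 0), (-1, 0, 1), (-1, 0, 2), (-1, 0, 3)]], []⟩,
    ⟨12, 6, [(1, 0, 0)], [(2, 0, 0)], 0, [[], [], [], [], [], [(1, 0, 0)], [(1, 1, 0)]], [], [[],
    [], [(1, 0, 0)]], [(1, 0, 0), (-1, 1, 0), (1, 2, 0)], [[], [(-1, 0, 0), (-1, 0, 1), (-1, 0,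
    2), (-1, 0, 3)], [], [], [], [(1, 0, 0), (1, 0, 1), (1, 0, 2), (1, 0, 3)]], []⟩,
    ⟨14, 7, [(1, 0, 0)], [(2, 0, 0)], 0, [[(1, 4, -1), (-1, 5, -1)], [(1, 0, -1), (1, 3, -1), (1,
    4, -2), (-1, 4, -1), (-1, 5, -2), (1, 6, -1), (-1, 8, -1)], [], [], [(1, 0, -1), (1, 0, 0),
    (1, 3, -1), (1, 4, -2), (-1, 5, -2), (-1, 5, -1), (1, 6, -1), (-1, 8, -1)], [(-1, 0, -1),
    (-1, 3, -1), (1, 3, 0), (-1, 4, -2), (1, 4, -1), (1, 5, -2), (-1, 6, -1), (1, 8, -1)], [(1,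
    4, 0)], [(1, 0, 0), (1, 3, 0), (1, 4, -1), (-1, 5, -1), (1, 6, 0)]], [], [[], [], [], [], [],
    [], [], [(1, 0, 0)]], [(-1, 0, -1), (-1, 3, -1), (1, 3, 0), (-1, 4, -2), (1, 4, -1), (-1, 4,
    0), (1, 5, -2), (-1, 6, -1), (1, 7, 0), (1, 8, -1), (-1, 8, 0)], [[(-1, 0, 1), (-1, 0, 2)],
    [(-1, 0, 0), (-1, 0, 3)], [(-1, 0, 2), (-1, 0, 3)], [], [(-1, 0, 0), (-1, 0, 1)], [(1, 0, 0),
    (-1, 0, 2)], [(-1, 0, 2), (-1, 0, 3)], [(-1, 0, 1), (-1, 0, 2)]], []⟩,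
    ⟨20, 10, [(1, 0, 0)], [(2, 0, 0)], 0, [[], [], [(1, 1, 0)], [(1, 0, 0)], [(1, 0, 0), (1, 3,
    0)], [(1, 1, 0), (1, 2, 0)], [(1, 0, 0), (1, 3, 0), (1, 4, 0)]], [], [[], [], [], [], [],
    [(1, 0, 0)]], [(-1, 0, 0), (1, 1, 0), (1, 2, 0), (-1, 3, 0), (-1, 4, 0), (1, 5, 0)], [[(-1,
    0, 0), (-1, 0, 1), (-1, 0, 2), (-1, 0, 3)], [], [], [(-1, 0, 0), (-1, 0, 1), (-1, 0, 2), (-1,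
    0, 3)], [(-1, 0, 0), (-1, 0, 1), (-1, 0, 2), (-1, 0, 3)], [], [(-1, 0, 0), (-1, 0, 1), (-1,
    0, 2), (-1, 0, 3)]], []⟩]

/-- Homotopies whose defect factors through a kernel of `ρ ^ 4 - 1`. -/
def kerHtpies : List Htpy := [
    ⟨7, 4, [(1, 0, 0)], [(2, 0, 0)], 0, [], [[], [], [], [], [(1, 0, 0)], [(1, 1, 0)]], [[], [],
    [], [(1, 0, 0)], [(-1, 0, 0)], [(-1, 0, 0)]], [(1, 3, 0)], [[(-1, 1, 0), (-1, 1, 1), (-1, 1,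
    2), (-1, 1, 3), (1, 5, 0), (1, 5, 1), (1, 5, 2), (1, 5, 3)]], []⟩,
    ⟨13, 7, [(1, 0, 0)], [(2, 0, 0)], 0, [[], [], [], [], [], [(1, 3, 0)]], [[(1, 4, -1), (-1, 5,
    -1)], [(1, 0, -1), (1, 3, -1), (1, 4, -2), (-1, 4, -1), (-1, 5, -2), (1, 6, -1), (-1, 8,
    -1)], [], [], [(1, 0, -1), (1, 0, 0), (1, 3, -1), (1, 4, -2), (-1, 5, -2), (-1, 5, -1), (1,
    6, -1), (-1, 8, -1)], [(-1, 0, -1), (-1, 3, -1), (1, 3, 0), (-1, 4, -2), (1, 4, -1), (1, 5,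
    -2), (-1, 6, -1), (1, 8, -1)], [(1, 4, 0)], [(1, 0, 0), (1, 3, 0), (1, 4, -1), (-1, 5, -1),
    (1, 6, 0)]], [[(1, 0, -1)], [(1, 0, -2), (-1, 0, -1), (1, 0, 0)], [(1, 0, 0)], [], [(1, 0,
    -2)], [(-1, 0, -2), (1, 0, -1)], [(1, 0, 0)], [(1, 0, -1)]], [(1, 2, 0)], [[(1, 0, 1), (1, 0,
    2), (1, 3, 1), (-1, 3, 3), (1, 4, 0), (1, 4, 3), (-1, 5, 0), (-1, 5, 1), (1, 6, 1), (1, 6,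
    2), (-1, 7, 2), (-1, 7, 3), (-1, 8, 1), (1, 8, 3)]], []⟩,
    ⟨19, 10, [(1, 0, 0)], [(2, 0, 0)], 0, [[], [], [], [], [], [(1, 1, 0)]], [[], [], [(1, 1,
    0)], [(1, 0, 0)], [(1, 0, 0), (1, 3, 0)], [(1, 1, 0), (1, 2, 0)], [(1, 0, 0), (1, 3, 0), (1,
    4, 0)]], [[(1, 0, 0)], [], [], [(1, 0, 0)], [(1, 0, 0)], [], [(1, 0, 0)]], [(1, 0, 0)], [[(1,
    0, 0), (1, 0, 1), (1, 0, 2), (1, 0, 3), (-1, 1, 0), (-1, 1, 1), (-1, 1, 2), (-1, 1, 3), (-1,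
    2, 0), (-1, 2, 1), (-1, 2, 2), (-1, 2, 3), (1, 3, 0), (1, 3, 1), (1, 3, 2), (1, 3, 3), (1, 4,
    0), (1, 4, 1), (1, 4, 2), (1, 4, 3), (-1, 5, 0), (-1, 5, 1), (-1, 5, 2), (-1, 5, 3)]], []⟩]

/-- Homotopies whose defect factors through a kernel of `ρ ^ 2 + ρ + 1`. -/
def cubicHtpies : List Htpy := [
    ⟨4, 2, [(1, 0, 0)], [(2, 0, 0)], 0, [[], [], [], [(1, 0, 0)], [], [], [], [], [(1, 2, 0)]],
    [[], [], [], [(-1, 0, 0), (1, 1, 0), (1, 3, 0)], [(1, 1, 0)], [(1, 0, 0), (-1, 1, 0)], [(1,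
    2, 0)], [(1, 0, 1), (-1, 1, 1), (1, 2, 0), (-1, 3, 1), (1, 5, 0)]], [[], [(1, 0, 0)], [],
    [(1, 0, 0), (1, 0, 1)], [], [(-1, 0, 0)], [], [(-1, 0, 1), (-1, 0, 2)]], [(1, 0, 0), (1, 1,
    0)], [[(1, 0, 0), (1, 0, 1), (-1, 1, 0), (-1, 1, 1), (1, 2, 0), (-1, 3, 0), (-1, 3, 1), (-1,
    4, 0), (1, 5, 0)]], [[], [], [], [], [(-1, 0, 0)]]⟩,
    ⟨14, 8, [(1, 0, 0)], [(2, 0, 0)], 0, [], [[], [], [], [(-1, 0, 0)], [], [(-1, 0, 1), (1, 2,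
    0), (1, 4, 0)], [(1, 0, 0), (1, 1, 0)], [(1, 0, 1), (-1, 3, 0), (-1, 4, 0)], [(1, 0, 1), (-1,
    4, 0)]], [[], [], [], [(1, 0, 0)], [(1, 0, 0)], [(1, 0, 0), (1, 0, 1)], [(-1, 0, 0)], [(-1,
    0, 0), (-1, 0, 1)], [(-1, 0, 0), (-1, 0, 1)]], [(1, 4, 0)], [[(1, 0, 1), (1, 0, 2), (-1, 2,
    1), (-1, 4, 0), (-1, 4, 1), (-1, 6, 0)]], [[], [], [], [], [], [], [(-1, 0, 0)], [(-1, 0,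
    0)]]⟩,
    ⟨20, 11, [(1, 0, -1), (-1, 0, 1), (1, 0, 3)], [(1, 0, 1), (1, 0, 3)], 6, [], [[(-1, 0, -1),
    (-1, 0, 2), (1, 1, -1), (1, 2, 0), (1, 3, -1), (1, 4, 0), (-1, 5, -1), (-1, 5, 0), (1, 5,
    1)], [(-2, 0, 2), (1, 1, -1), (1, 1, 2), (-1, 2, -1), (1, 2, 0), (1, 2, 1), (1, 3, -1), (1,
    3, 2), (-1, 4, -1), (1, 4, 0), (1, 4, 1), (-2, 5, 0)], [(-1, 0, 1), (1, 0, 2), (1, 0, 3),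
    (-1, 1, 2), (1, 2, -1), (-1, 2, 1), (-1, 3, -1), (1, 3, 1), (-1, 3, 2), (-1, 3, 3), (1, 4,
    -1), (-1, 4, 1), (-1, 5, -1), (1, 5, 0), (1, 5, 1)], [], [(1, 0, 1), (1, 0, 2), (1, 0, 3),
    (-1, 1, 0), (-1, 1, 1), (-1, 2, 1), (-1, 2, 2), (-1, 3, -1), (-1, 3, 0), (-1, 3, 3), (-1, 4,
    1), (-1, 4, 2), (1, 5, -1), (1, 5, 0), (1, 5, 1)], [(-1, 0, 0), (1, 0, 1), (1, 0, 2), (-1, 1,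
    1), (-1, 2, 2), (-1, 3, 1), (-1, 4, 2), (1, 5, -1), (1, 5, 2)]], [[], [(1, 0, 0)], [(-1, 0,
    0), (-1, 0, 1)], [(1, 0, 0)], [(-1, 0, 0), (-1, 0, 1)]], [(1, 3, -1), (-1, 3, 1), (1, 3, 3)],
    [[(1, 0, 2), (1, 0, 3), (1, 0, 4), (-1, 1, 1), (-1, 1, 2), (-1, 2, 2), (-1, 2, 3), (-1, 3,
    -1), (-1, 3, 0), (-1, 3, 3), (-1, 3, 4), (1, 4, -1), (-1, 4, 1), (-1, 4, 2), (1, 5, 0), (1,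
    5, 1), (1, 5, 2)]], [[], [], [(-1, 0, 0)], [], [(1, 0, 0)]]⟩]

lemma unitHtpies_valid : (unitHtpies.all fun c => c.isUnit) = true := by decide +kernel

lemma cokerHtpies_valid : (cokerHtpies.all fun c => c.isCoker) = true := by decide +kernel

lemma kerHtpies_valid : (kerHtpies.all fun c => c.isKer) = true := by decide +kernel

lemma cubicHtpies_valid : (cubicHtpies.all fun c => c.isCubic) = true := by decide +kernel

/-- The homotopies used in odd degrees. -/
def oddHtpies : List Htpy := unitHtpies ++ (cokerHtpies ++ cubicHtpies)

/-- The homotopies used in even degrees. -/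
def evenHtpies : List Htpy := unitHtpies ++ kerHtpies

/-- Every winding number occurring in the relevant degrees has a homotopy. -/
def htpyCover (r : ℕ) : Bool :=
  (List.range 9).all fun i => !Nat.blt i (numGens (r + 1)) ||
    decide (ga (r + 1) i < gb (r + 1) i) && decide (gb (r + 1) i < ga (r + 1) i + 72) &&
    (List.range 12).all fun j => !cv (r + 1) j i ||
      (!(r % 2 == 0) || oddHtpies.any fun c => c.n == r && c.j == j) &&
      (!([3, 7, 9, 13, 19].contains r) || evenHtpies.any fun c => c.n == r && c.j == j)

lemma htpyCover_lt : ((List.range 21).all htpyCover) = true := by decide +kernel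

lemma cv_add (n m : ℕ) (j : ℤ) (i : ℕ) : cv (n + 22 * m) (j + 12 * m) i = cv n j i := by
  rw [cv, cv, numGens_add, ga_add, gb_add]
  congr 2
  ring

lemma dd_add (n m : ℕ) (j : ℤ) : dd (n + 22 * m) (j + 12 * m) = dd n j := by
  funext i
  rw [dd, dd, add_right_comm, cv_add, dRow_add]
  simp only [cv_add]

end HomotopyData

section Coordinates
set_option linter.unusedSectionVars false
variable {K : Type u} [Field K] {s : ℕ} [NeZero s]

lemma lt_nine_of_cv {n : ℕ} {j : ℤ} {i : ℕ} (h : cv n j i = true) : i < 9 := by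
  rw [cv, Bool.and_eq_true, Nat.blt_eq] at h
  exact h.1.trans_le (numGens_le n)

lemma ap_zero (R : ℕ → Row) (i : ℕ) : ap R (fun _ => (0 : Sq K)) i = 0 := by
  rw [ap]
  induction R i with
  | nil => rfl
  | cons x l ih => rw [ev_cons, ih, map_zero, smul_zero, add_zero]

lemma ap_smul (R : ℕ → Row) (a : K) (F : ℕ → Sq K) (i : ℕ) :
    ap R (fun i => a • F i) i = a • ap R F i :=
  (natOp_ap (Subalgebra.algebraMap_mem (natOp K) a) R F i).symm

lemma ap_congr {R : ℕ → Row} {F G : ℕ → Sq K} (h : ∀ i, F i = G i) (i : ℕ) :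
    ap R F i = ap R G i := by rw [funext h]

lemma bimp {a b : Bool} (h : (!a || b) = true) (ha : a = true) : b = true := by
  rwa [ha, Bool.not_true, Bool.false_or] at h

namespace Htpy
variable (c : Htpy)

lemma exists_homotopy (hc : c.valid = true) (hs : c.j % 2 = 1 → Odd s) :
    ∃ x ∈ natOp K, ∃ e : ℤ, ∀ F : ℕ → Sq K, (∀ i, F i ∈ eqv K s) →
      (∀ i, ap (dd (c.n + 1) c.j) F i = 0) → ∀ i, cv (c.n + 1) c.j i = true →
      (2 : K) • F i + e • eps K (F i) = ap (dd c.n c.j) (fun i => x (ap (tb c.h) F i)) i +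
        ap (tb c.k) (fun _ => x (ap (fun _ => c.p) F 0)) i := by
  rw [valid, Bool.and_eq_true, Bool.and_eq_true, Bool.or_eq_true, beq_iff_eq, beq_iff_eq] at hc
  obtain ⟨⟨h1, h2⟩, h3⟩ := hc
  obtain ⟨x, hx, e, hxe⟩ := exists_unit (K := K) h1 (h2.imp_right hs)
  refine ⟨x, hx, e, fun F hF hd i hi => ?_⟩
  have h4 := ap_eq_of_rowEq (bimp (List.all_eq_true.1 h3 i
    (List.mem_range.2 (lt_nine_of_cv hi))) hi) F (R := dg c.u)
    (R' := fun i => tc (dd c.n c.j) (tb c.h) i ++ tc (tb c.h') (dd (c.n + 1) c.j) i ++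
      tc (tb c.k) (fun _ => c.p) i)
  have h5 : ∀ R R' : ℕ → Row, ap (fun i => R i ++ R' i) F i = ap R F i + ap R' F i :=
    fun R R' => ev_append _ _ _
  rw [h5 (fun i => _ ++ _), h5, ap_dg, ap_tc, ap_tc, ap_tc, ap_congr hd, ap_zero, add_zero] at h4
  rw [← hxe _ (hF i), h4, map_add, natOp_ap hx, natOp_ap hx]
  rfl

/-- A solution of `F = eps G + δ H` with `G` a cocycle. -/
def Splits (K : Type u) [Field K] (s : ℕ) [NeZero s] (n : ℕ) (j : ℤ) (F G : ℕ → Sq K) : Prop :=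
  (∀ i, G i ∈ eqv K s) ∧ (∀ i, ap (dd (n + 1) j) G i = 0) ∧
    ∃ H : ℕ → Sq K, (∀ i, H i ∈ eqv K s) ∧
      ∀ i, cv (n + 1) j i = true → F i = eps K (G i) + ap (dd n j) H i

lemma splits_zero {n : ℕ} {j : ℤ} {F H : ℕ → Sq K} (hH : ∀ i, H i ∈ eqv K s)
    (h : ∀ i, cv (n + 1) j i = true → F i = ap (dd n j) H i) :
    Splits K s n j F fun _ => 0 :=
  ⟨fun _ => zero_mem _, ap_zero _, H, hH, fun i hi => by rw [h i hi, map_zero, zero_add]⟩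

lemma half_smul (h2 : (2 : K) ≠ 0) {f g : Sq K} (h : (2 : K) • f = g) : f = (2 : K)⁻¹ • g := by
  rw [← h, inv_smul_smul₀ h2]

variable {c} {F : ℕ → Sq K}

lemma splits_of_isUnit (h2 : (2 : K) ≠ 0) (hc : c.isUnit = true) (hs : c.j % 2 = 1 → Odd s)
    (hF : ∀ i, F i ∈ eqv K s) (h0 : ∀ i, eps K (F i) = 0)
    (hd : ∀ i, ap (dd (c.n + 1) c.j) F i = 0) : Splits K s c.n c.j F fun _ => 0 := by
  rw [isUnit, Bool.and_eq_true, List.isEmpty_iff] at hc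
  obtain ⟨x, hx, e, h⟩ := exists_homotopy (K := K) c hc.1 hs
  refine splits_zero (H := fun i => (2 : K)⁻¹ • x (ap (tb c.h) F i))
    (fun i => Submodule.smul_mem _ _ (natOp_eqv hx (ap_mem _ _ _ hF))) fun i hi => ?_
  have h3 := h F hF hd i hi
  rw [h0, smul_zero, add_zero, hc.2, show ap (fun _ => []) F 0 = 0 from rfl, map_zero, ap_zero,
    add_zero] at h3
  rw [ap_smul]
  exact half_smul h2 h3

lemma splits_of_isCoker (h2 : (2 : K) ≠ 0) (hc : c.isCoker = true) (hs : c.j % 2 = 1 → Odd s)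
    (hF : ∀ i, F i ∈ eqv K s) (h0 : ∀ i, eps K (F i) = 0)
    (hd : ∀ i, ap (dd (c.n + 1) c.j) F i = 0) : Splits K s c.n c.j F fun _ => 0 := by
  rw [isCoker, Bool.and_eq_true] at hc
  obtain ⟨x, hx, e, h⟩ := exists_homotopy (K := K) c hc.1 hs
  have hX := natOp_eqv hx (ap_mem (fun _ => c.p) F 0 hF)
  obtain ⟨Y, hY, hYX⟩ := exists_quartic h2 hX (by
    rw [← natOp_eps hx, natOp_ap (eps_mem K), ap_congr h0, ap_zero, map_zero])
  refine splits_zero (H := fun i => (2 : K)⁻¹ • (x (ap (tb c.h) F i) + ap (tb c.a) (fun _ => Y) i))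
    (fun i => Submodule.smul_mem _ _ (add_mem (natOp_eqv hx (ap_mem _ _ _ hF))
      (ap_mem _ _ _ fun _ => hY))) fun i hi => ?_
  have h3 := h F hF hd i hi
  have h4 := ap_eq_of_rowEq (bimp (List.all_eq_true.1 hc.2 i
    (List.mem_range.2 (lt_nine_of_cv hi))) hi) fun _ => Y
  rw [ap_tc, ap_tc, ap_congr fun i => ap_dg _ (fun _ => Y) i, ap_congr fun i => hYX] at h4
  rw [h0, smul_zero, add_zero, h4, ← ap_add] at h3
  rw [ap_smul]
  exact half_smul h2 h3

lemma splits_of_isCubic (h2 : (2 : K) ≠ 0) (hc : c.isCubic = true) (hs : c.j % 2 = 1 → Odd s)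
    (hs3 : c.j % 3 = 2 → ¬3 ∣ s) (hF : ∀ i, F i ∈ eqv K s) (h0 : ∀ i, eps K (F i) = 0)
    (hd : ∀ i, ap (dd (c.n + 1) c.j) F i = 0) : ∃ G, Splits K s c.n c.j F G := by
  rw [isCubic, Bool.and_eq_true, Bool.and_eq_true, Bool.and_eq_true, beq_iff_eq] at hc
  obtain ⟨⟨⟨h1, h5⟩, h6⟩, h7⟩ := hc
  obtain ⟨x, hx, e, h⟩ := exists_homotopy (K := K) c h1 hs
  have hX := natOp_eqv hx (ap_mem (fun _ => c.p) F 0 hF)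
  obtain ⟨Z, hZ, hZ0, hZX⟩ := exists_cubic (hs3 h6) hX (by
    rw [← natOp_eps hx, natOp_ap (eps_mem K), ap_congr h0, ap_zero, map_zero]) (by
    have h8 := ap_eq_of_rowEq h5 F
    rw [ap_tc, ap_dg, ap_tc, ap_congr hd, ap_zero] at h8
    rw [← ap_dg _ (fun _ => x (ap (fun _ => c.p) F 0)) 0, ← natOp_ap hx,
      ap_dg _ (fun _ => ap (fun _ => c.p) F 0) 0, h8, map_zero])
  refine ⟨fun i => (2 : K)⁻¹ • ap (tb c.k) (fun _ => Z) i, fun i => Submodule.smul_mem _ _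
    (ap_mem _ _ _ fun _ => hZ), fun i => ?_, fun i => (2 : K)⁻¹ • x (ap (tb c.h) F i),
    fun i => Submodule.smul_mem _ _ (natOp_eqv hx (ap_mem _ _ _ hF)), fun i hi => ?_⟩
  · rw [ap_smul, ← ap_tc]
    rcases lt_or_ge i 9 with hi | hi
    · rw [ap_eq_of_rowEq (List.all_eq_true.1 h7 i (List.mem_range.2 hi)), ap_tc,
        ap_congr fun i => ap_dg _ (fun _ => Z) i, ap_congr fun i => hZ0, ap_zero, smul_zero]
    · have hcv : cv (c.n + 1 + 1) c.j i = false := by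
        rw [Bool.eq_false_iff]
        exact fun h => absurd (lt_nine_of_cv h) (not_lt.2 hi)
      rw [ap_tc, ap, dd, hcv]
      exact smul_zero _
  · have h3 := h F hF hd i hi
    rw [h0, smul_zero, add_zero] at h3
    rw [ap_smul, map_smul, natOp_ap (eps_mem K), ap_congr fun _ => hZX, ← smul_add, add_comm]
    exact half_smul h2 h3

lemma cubicHtpies_degree : ∀ c ∈ cubicHtpies, c.n ∈ [4, 14, 20] := by
  rw [cubicHtpies]
  simp

/-- The `eps`-part of a cocycle bounds. -/
def Bounds (K : Type u) [Field K] (s : ℕ) [NeZero s] (n : ℕ) (j : ℤ) (F : ℕ → Sq K) : Prop :=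
  ∃ H : ℕ → Sq K, (∀ i, H i ∈ eqv K s) ∧
    ∀ i, cv (n + 1) j i = true → eps K (F i) = eps K (ap (dd n j) H i)

lemma bounds_of_exists_homotopy (h2 : (2 : K) ≠ 0) (hc : c.valid = true)
    (hs : c.j % 2 = 1 → Odd s) (hF : ∀ i, F i ∈ eqv K s)
    (h0 : eps K (ap (fun _ => c.p) F 0) = 0)
    (hd : ∀ i, ap (dd (c.n + 1) c.j) F i = 0) : Bounds K s c.n c.j F := by
  obtain ⟨x, hx, e, h⟩ := exists_homotopy (K := K) c hc hs
  refine ⟨fun i => (2 : K)⁻¹ • x (ap (tb c.h) F i), fun i => Submodule.smul_mem _ _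
    (natOp_eqv hx (ap_mem _ _ _ hF)), fun i hi => ?_⟩
  have h3 := congrArg (eps K) (h F hF hd i hi)
  rw [map_add, map_add, map_smul, map_zsmul, eps_eps, smul_zero, add_zero,
    natOp_ap (eps_mem K) (tb c.k)] at h3
  rw [ap_congr (R := tb c.k) (G := fun _ => 0) fun _ => by rw [← natOp_eps hx, h0, map_zero],
    ap_zero, add_zero] at h3
  rw [ap_smul, map_smul]
  exact half_smul h2 h3

lemma bounds_of_isUnit (h2 : (2 : K) ≠ 0) (hc : c.isUnit = true) (hs : c.j % 2 = 1 → Odd s)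
    (hF : ∀ i, F i ∈ eqv K s) (hd : ∀ i, ap (dd (c.n + 1) c.j) F i = 0) :
    Bounds K s c.n c.j F := by
  rw [isUnit, Bool.and_eq_true, List.isEmpty_iff] at hc
  exact bounds_of_exists_homotopy h2 hc.1 hs hF (by rw [hc.2]; exact map_zero _) hd

lemma bounds_of_isKer (h2 : (2 : K) ≠ 0) (hc : c.isKer = true) (hs : c.j % 2 = 1 → Odd s)
    (hF : ∀ i, F i ∈ eqv K s) (hd : ∀ i, ap (dd (c.n + 1) c.j) F i = 0) :
    Bounds K s c.n c.j F := by
  rw [isKer, Bool.and_eq_true] at hc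
  refine bounds_of_exists_homotopy h2 hc.1 hs hF ?_ hd
  refine eps_eq_zero_of_quartic h2 (ap_mem _ _ _ hF) ?_
  have h8 := ap_eq_of_rowEq hc.2 F
  rwa [ap_tc, ap_dg, ap_tc, ap_congr hd, ap_zero] at h8

lemma splits_add (n m : ℕ) (j : ℤ) (F G : ℕ → Sq K) :
    Splits K s (n + 22 * m) (j + 12 * m) F G ↔ Splits K s n j F G := by
  rw [Splits, Splits, add_right_comm, dd_add, dd_add]
  simp only [cv_add]

lemma bounds_add (n m : ℕ) (j : ℤ) (F : ℕ → Sq K) :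
    Bounds K s (n + 22 * m) (j + 12 * m) F ↔ Bounds K s n j F := by
  rw [Bounds, Bounds, add_right_comm, dd_add]
  simp only [cv_add]

end Htpy

open Htpy

lemma exists_htpy (n : ℕ) (j : ℤ) (hn : n % 22 ≠ 21) (i : ℕ) (hi : cv (n + 1) j i = true) :
    ∃ m j₀ : ℕ, n = n % 22 + 22 * m ∧ j = j₀ + 12 * m ∧
      (n % 2 = 0 → ∃ c ∈ oddHtpies, c.n = n % 22 ∧ c.j = j₀) ∧
      (n % 22 ∈ [3, 7, 9, 13, 19] → ∃ c ∈ evenHtpies, c.n = n % 22 ∧ c.j = j₀) := by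
  obtain ⟨r, m, hr, rfl⟩ := exists_eq_mod_add n
  have hr' : (r + 22 * m) % 22 = r := by omega
  rw [hr'] at hn ⊢
  obtain ⟨j₀, rfl⟩ : ∃ j₀, j = j₀ + 12 * (m : ℤ) := ⟨j - 12 * m, by ring⟩
  rw [add_right_comm, cv_add] at hi
  have hi' := hi
  rw [cv, Bool.and_eq_true, Nat.blt_eq, conb_iff] at hi'
  have h1 := List.all_eq_true.1 (List.all_eq_true.1 htpyCover_lt r (List.mem_range.2 (by omega)))
    i (List.mem_range.2 (lt_nine_of_cv hi))
  simp only [show Nat.blt i (numGens (r + 1)) = true from Nat.blt_eq ▸ hi'.1, Bool.not_true, Bool.false_or, Bool.and_eq_true,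
    decide_eq_true_eq] at h1
  obtain ⟨⟨h1, h2⟩, h3⟩ := h1
  obtain ⟨k, rfl⟩ : ∃ k : ℕ, j₀ = k := ⟨j₀.toNat, by have := hi'.2.2.1; omega⟩
  have h4 := bimp (List.all_eq_true.1 h3 k (List.mem_range.2 (by have := hi'.2.1; omega))) hi
  rw [Bool.and_eq_true] at h4
  refine ⟨m, k, rfl, rfl, fun h => ?_, fun h => ?_⟩
  · have h5 := bimp h4.1 (by rw [beq_iff_eq]; omega)
    simpa only [List.any_eq_true, Bool.and_eq_true, beq_iff_eq] using h5
  · have h5 := bimp h4.2 (by rwa [List.contains_iff_mem])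
    simpa only [List.any_eq_true, Bool.and_eq_true, beq_iff_eq] using h5

lemma odd_of_dvd {j₀ m : ℕ} (hj : (s : ℤ) ∣ j₀ + 12 * m) (h : j₀ % 2 = 1) : Odd s := by
  by_contra h3
  rw [Nat.not_odd_iff_even, even_iff_two_dvd] at h3
  have := (Int.natCast_dvd_natCast.2 h3).trans hj
  omega

lemma not_three_dvd {j₀ m : ℕ} (hj : (s : ℤ) ∣ j₀ + 12 * m) (h : j₀ % 3 = 2) : ¬3 ∣ s := by
  intro h3
  have := (Int.natCast_dvd_natCast.2 h3).trans hj
  omega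

lemma exists_splits (h2 : (2 : K) ≠ 0) {n : ℕ} {j : ℤ} (hj : (s : ℤ) ∣ j) {F : ℕ → Sq K}
    (hF : ∀ i, F i ∈ eqv K s) (hd : ∀ i, ap (dd (n + 1) j) F i = 0) (hn : n % 2 = 0)
    (h0 : ∀ i, eps K (F i) = 0) :
    ∃ G, Splits K s n j F G ∧ ((∀ i, G i = 0) ∨ n % 22 ∈ [4, 14, 20]) := by
  by_cases hi : ∃ i, cv (n + 1) j i = true
  · obtain ⟨i, hi⟩ := hi
    obtain ⟨m, j₀, h1, rfl, h3, -⟩ := exists_htpy n j (by omega) i hi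
    obtain ⟨c, hc, h4, rfl⟩ := h3 hn
    have h5 (h) : n % 22 ∈ [4, 14, 20] := h4 ▸ cubicHtpies_degree c h
    generalize (n % 22 ∈ [4, 14, 20]) = P at h5 ⊢
    rw [← h4] at h1
    rw [h1] at hd ⊢
    rw [add_right_comm, dd_add] at hd
    simp only [splits_add]
    rw [oddHtpies, List.mem_append, List.mem_append] at hc
    rcases hc with hc | hc | hc
    · exact ⟨_, splits_of_isUnit h2 (List.all_eq_true.1 unitHtpies_valid c hc) (odd_of_dvd hj)
        hF h0 hd, Or.inl fun _ => rfl⟩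
    · exact ⟨_, splits_of_isCoker h2 (List.all_eq_true.1 cokerHtpies_valid c hc) (odd_of_dvd hj)
        hF h0 hd, Or.inl fun _ => rfl⟩
    · obtain ⟨G, hG⟩ := splits_of_isCubic h2 (List.all_eq_true.1 cubicHtpies_valid c hc)
        (odd_of_dvd hj) (not_three_dvd hj) hF h0 hd
      exact ⟨G, hG, Or.inr (h5 hc)⟩
  · push Not at hi
    exact ⟨_, splits_zero (H := fun _ => 0) (fun _ => zero_mem _) fun i h => absurd h (hi i),
      Or.inl fun _ => rfl⟩

lemma exists_bounds (h2 : (2 : K) ≠ 0) {n : ℕ} {j : ℤ} (hj : (s : ℤ) ∣ j) {F : ℕ → Sq K}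
    (hF : ∀ i, F i ∈ eqv K s) (hd : ∀ i, ap (dd (n + 1) j) F i = 0)
    (hn : n % 22 ∈ [3, 7, 9, 13, 19]) : Bounds K s n j F := by
  by_cases hi : ∃ i, cv (n + 1) j i = true
  · obtain ⟨i, hi⟩ := hi
    obtain ⟨m, j₀, h1, rfl, -, h3⟩ := exists_htpy n j (by
      rintro h
      rw [h] at hn
      exact absurd hn (by decide)) i hi
    obtain ⟨c, hc, h4, rfl⟩ := h3 hn
    rw [← h4] at h1
    rw [h1] at hd ⊢
    rw [add_right_comm, dd_add] at hd
    rw [bounds_add]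
    rw [evenHtpies, List.mem_append] at hc
    rcases hc with hc | hc
    · exact bounds_of_isUnit h2 (List.all_eq_true.1 unitHtpies_valid c hc) (odd_of_dvd hj) hF hd
    · exact bounds_of_isKer h2 (List.all_eq_true.1 kerHtpies_valid c hc) (odd_of_dvd hj) hF hd
  · push Not at hi
    exact ⟨fun _ => 0, fun _ => zero_mem _, fun i h => absurd h (hi i)⟩

end Coordinates

section Synthesis
set_option linter.unusedSectionVars false
open CategoryTheory MulOpposite
variable (K : Type u) [Field K] (s : ℕ) [NeZero s]

lemma not_con_of_cv {n i : ℕ} {q : ℤ} (hi : i < numGens n) (h : cv n (s * q) i = false) (t : ℤ) :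
    ¬con (6 * t + ga n i) (6 * t + gb n i - 6 * s * q) := by
  rw [add_sub_assoc, con_add']
  rw [cv, show Nat.blt i (numGens n) = true from Nat.blt_eq ▸ hi, Bool.true_and, conb_eq_false, ← mul_assoc] at h
  exact h

lemma con_of_cv {n i : ℕ} {q : ℤ} (h : cv n (s * q) i = true) (t : ℤ) :
    con (6 * t + ga n i) (6 * t + gb n i - 6 * s * q) := by
  rw [add_sub_assoc, con_add']
  rw [cv, Bool.and_eq_true, conb_iff, ← mul_assoc] at h
  exact h.2

/-- The cochain of winding number `s * q` with given coefficients. -/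
noncomputable def syn (n : ℕ) (q : ℤ) (F : ℕ → Sq K) : Q K s n ⟶ WExt K s :=
  qObj.lift fun σ => mt K s (6 * (σ.2.val : ℤ) + ga n σ.1)
    (6 * (σ.2.val : ℤ) + gb n σ.1 - 6 * s * q) (F σ.1 σ.2.val)

variable {K s}

lemma eqv_apply {f : Sq K} (hf : f ∈ eqv K s) (q t : ℤ) : f (t + s * q) = tw K q (f t) := by
  refine (congrFun (hf q) t).trans ?_
  change f t + q • ((0 : K), (f t).1) = ((f t).1, (f t).2 + q * (f t).1)
  ext
  · simp
  · simp

lemma syn_gn {n : ℕ} {q : ℤ} {F : ℕ → Sq K} (hF : ∀ i, F i ∈ eqv K s) {i : ℕ}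
    (hi : i < numGens n) (t : ℤ) : (syn K s n q F).hom (gn K s n i t) =
      mt K s (6 * t + ga n i) (6 * t + gb n i - 6 * s * q) (F i t) := by
  have h9 := hi.trans_le (numGens_le n)
  rw [gn, dif_pos h9, qgen, syn, qObj.lift_gen, qe_cast K s n i hi h9]
  obtain ⟨q', hq⟩ := exists_val_intCast s t
  have h1 : mt K s (6 * t + ga n i) (6 * t + gb n i - 6 * s * q) (F i t) =
      mt K s (6 * (((t : ZMod s).val : ℕ) : ℤ) + ga n i)
        (6 * (((t : ZMod s).val : ℕ) : ℤ) + gb n i - 6 * s * q) (F i ((t : ZMod s).val : ℕ)) := by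
    conv_lhs => rw [hq, eqv_apply (hF i)]
    rw [← mt_add K s (6 * (((t : ZMod s).val : ℕ) : ℤ) + ga n i)
      (6 * (((t : ZMod s).val : ℕ) : ℤ) + gb n i - 6 * s * q) q']
    congr 2 <;> ring
  rw [h1.symm]
  by_cases h : con (6 * t + ga n i) (6 * t + gb n i - 6 * s * q)
  · have h2 := ptz_smul_mt K s (con_self _) h (con_self _) (F i t)
    rwa [ptz_self, ptz_self, ← vert_add_mul K (6 * t + gb n i - 6 * s * q) q,
      sub_add_cancel] at h2
  · rw [mt_of_not K s h, smul_zero]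

lemma syn_gn_of_not {n : ℕ} {q : ℤ} {F : ℕ → Sq K} (hF : ∀ i, F i ∈ eqv K s) {i : ℕ}
    (hi : cv n (s * q) i = false) (t : ℤ) : (syn K s n q F).hom (gn K s n i t) = 0 := by
  by_cases h : i < numGens n
  · rw [syn_gn hF h, mt_of_not K s (not_con_of_cv s h hi t)]
  · rw [gn_of_not K s n i t h, map_zero]

lemma lt_of_cv {n : ℕ} {j : ℤ} {i : ℕ} (h : cv n j i = true) : i < numGens n := by
  rw [cv, Bool.and_eq_true, Nat.blt_eq] at h
  exact h.1

lemma syn_congr {n : ℕ} {q : ℤ} {F G : ℕ → Sq K} (hF : ∀ i, F i ∈ eqv K s)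
    (hG : ∀ i, G i ∈ eqv K s) (h : ∀ i, cv n (s * q) i = true → F i = G i) :
    syn K s n q F = syn K s n q G := by
  refine q_hom_ext fun i t => ?_
  cases hi : cv n (s * q) i
  · rw [syn_gn_of_not hF hi, syn_gn_of_not hG hi]
  · rw [syn_gn hF (lt_of_cv hi), syn_gn hG (lt_of_cv hi), h i hi]

lemma syn_add {n : ℕ} {q : ℤ} {F G : ℕ → Sq K} (hF : ∀ i, F i ∈ eqv K s)
    (hG : ∀ i, G i ∈ eqv K s) :
    syn K s n q (fun i => F i + G i) = syn K s n q F + syn K s n q G := by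
  refine q_hom_ext fun i t => ?_
  have hFG : ∀ i, F i + G i ∈ eqv K s := fun i => add_mem (hF i) (hG i)
  cases hi : cv n (s * q) i
  · rw [syn_gn_of_not hFG hi, ModuleCat.hom_add, LinearMap.add_apply, syn_gn_of_not hF hi,
      syn_gn_of_not hG hi, add_zero]
  · rw [syn_gn hFG (lt_of_cv hi), ModuleCat.hom_add, LinearMap.add_apply, syn_gn hF (lt_of_cv hi),
      syn_gn hG (lt_of_cv hi), ← map_add]
    rfl

lemma syn_zero (n : ℕ) (q : ℤ) : syn K s n q (fun _ => 0) = 0 := by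
  have h0 : ∀ i : ℕ, (fun _ => 0 : ℕ → Sq K) i ∈ eqv K s := fun i => zero_mem _
  refine q_hom_ext fun i t => ?_
  cases hi : cv n (s * q) i
  · rw [syn_gn_of_not h0 hi]
    rfl
  · rw [syn_gn h0 (lt_of_cv hi)]
    exact map_zero _

lemma syn_tm {n : ℕ} {q : ℤ} {F : ℕ → Sq K} (hF : ∀ i, F i ∈ eqv K s) (t x y : ℤ) (i : ℕ) (k : ℤ)
    (h : cnb n x y i k = true) : (syn K s n q F).hom (tm K s n t x y i k) =
      bif cv n (s * q) i then mt K s (6 * t + x) (6 * t + y - 6 * s * q) (F i (t + k)) else 0 := by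
  rw [cnb_iff] at h
  cases hi : cv n (s * q) i
  · rw [tm, map_smul, syn_gn_of_not hF hi, smul_zero]
    rfl
  · rw [tm, map_smul, syn_gn hF h.2.2, ← ptz_add K s _ (6 * t + y) (-q)]
    have e1 : con (6 * t + x) (6 * (t + k) + ga n i) := by
      rw [show 6 * (t + k) + ga n i = 6 * t + (ga n i + 6 * k) by ring, con_add']
      exact h.2.1
    have e2 : con (6 * (t + k) + gb n i - 6 * s * q) (6 * t + y - 6 * s * q) := by
      rw [show 6 * (t + k) + gb n i - 6 * s * q = 6 * (t - s * q) + (gb n i + 6 * k) by ring,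
        show 6 * t + y - 6 * s * q = 6 * (t - s * q) + y by ring, con_add']
      exact h.1
    rw [mul_neg, ← sub_eq_add_neg, ← sub_eq_add_neg]
    exact ptz_smul_mt K s e1 (con_of_cv s hi _) e2 _

lemma ap_apply (R : ℕ → Row) (F : ℕ → Sq K) (i : ℕ) (t : ℤ) :
    ap R F i t = ev (fun i' k => F i' (t + k)) (R i) :=
  map_ev (Pi.evalAddMonoidHom (fun _ => K × K) t) (fun i' k => shf K k (F i')) (R i)

lemma qd_syn {n : ℕ} {q : ℤ} {F : ℕ → Sq K} (hF : ∀ i, F i ∈ eqv K s) :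
    qd K s n ≫ syn K s n q F = syn K s (n + 1) q (ap (dd n (s * q)) F) := by
  have hF' : ∀ i, ap (dd n (s * q)) F i ∈ eqv K s := fun i => ap_mem _ _ _ hF
  refine q_hom_ext fun i t => ?_
  rw [ModuleCat.comp_apply, qd_gn, ← LinearMap.toAddMonoidHom_coe (syn K s n q F).hom, map_ev,
    LinearMap.toAddMonoidHom_coe]
  rw [ev_congr (ψ := fun i' k => bif cv n (s * q) i' then mt K s (6 * t + ga (n + 1) i)
    (6 * t + gb (n + 1) i - 6 * s * q) (F i' (t + k)) else 0) fun z hz => syn_tm hF t _ _ z.2.1 z.2.2 (dRow_valid n i z hz)]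
  by_cases h : i < numGens (n + 1)
  · rw [syn_gn hF' h]
    cases hi : cv (n + 1) (s * q) i
    · rw [mt_of_not K s (not_con_of_cv s h hi t)]
      simp only [mt_of_not K s (not_con_of_cv s h hi t), Bool.cond_self]
      rw [ev_const (c := 0) fun _ _ => rfl, smul_zero]
    · rw [ap_apply, dd, hi, cond_true, map_ev, ← ev_filter fun x => cv n (s * q) x.2.1]
      · refine ev_congr fun z hz => ?_
        rw [(List.mem_filter.1 hz).2]
        rfl
      · intro z _ hz
        rw [hz]
        rfl
  · rw [dRow_of_not n i h, ev_nil, gn_of_not K s _ i t h, map_zero]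

end Synthesis

section Analysis
set_option linter.unusedSectionVars false
open CategoryTheory MulOpposite
variable {K : Type u} [Field K] {s : ℕ} [NeZero s]

/-- The coefficients of winding number `s * q` of a cochain. -/
noncomputable def ana (n : ℕ) (q : ℤ) (f : Q K s n ⟶ WExt K s) (i : ℕ) : Sq K := fun t =>
  bif cv n (s * q) i then
    mco K s (6 * t + ga n i) (6 * t + gb n i - 6 * s * q) (f.hom (gn K s n i t)) else 0

lemma ana_mem (n : ℕ) (q : ℤ) (f : Q K s n ⟶ WExt K s) (i : ℕ) : ana n q f i ∈ eqv K s := by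
  intro q'
  funext t
  change ana n q f i (t + s * q') = ana n q f i t + q' • ((0 : K), (ana n q f i t).1)
  have h : ana n q f i (t + s * q') = tw K q' (ana n q f i t) := by
    unfold ana
    cases cv n (s * q) i
    · exact (map_zero _).symm
    · rw [cond_true, cond_true, gn_add, ← mco_add K s (6 * t + ga n i)]
      congr 2 <;> ring
  rw [h]
  change ((ana n q f i t).1, (ana n q f i t).2 + q' * (ana n q f i t).1) = _
  ext
  · simp
  · simp

lemma exists_finset (n : ℕ) : ∃ S : Finset ℤ, ∀ i < numGens n, ∀ t q : ℤ,
    con (6 * t + ga n i) (6 * t + gb n i - 6 * s * q) → q ∈ S := by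
  refine ⟨(Finset.range 9).biUnion fun i =>
    Finset.Icc (-(|gb n i - ga n i| + 6)) (|gb n i - ga n i| + 6), fun i hi t q h => ?_⟩
  refine Finset.mem_biUnion.2 ⟨i, Finset.mem_range.2 (hi.trans_le (numGens_le n)), ?_⟩
  rw [Finset.mem_Icc, ← abs_le]
  have h1 : |(s : ℤ) * q| ≤ |gb n i - ga n i| + 6 := by
    have h1 := h.1
    have h2 := h.2.1
    rw [mul_assoc] at h1 h2
    generalize (s : ℤ) * q = z at h1 h2
    rw [abs_le]
    have := le_abs_self (gb n i - ga n i)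
    have := neg_abs_le (gb n i - ga n i)
    omega
  refine le_trans ?_ h1
  rw [abs_mul]
  refine le_mul_of_one_le_left (abs_nonneg q) ?_
  have := NeZero.pos s
  rw [Nat.abs_cast]
  omega

lemma exists_eq_sum_syn {n : ℕ} (f : Q K s n ⟶ WExt K s) :
    ∃ S : Finset ℤ, f = ∑ q ∈ S, syn K s n q (ana n q f) := by
  obtain ⟨S, hS⟩ := exists_finset (s := s) n
  refine ⟨S, q_hom_ext fun i t => ?_⟩
  rw [ModuleCat.hom_sum, LinearMap.sum_apply]
  by_cases hi : i < numGens n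
  · conv_lhs => rw [← vert_smul_gn, map_smul, vert_smul_wext K s _ _ S (hS i hi t)]
    refine Finset.sum_congr rfl fun q _ => ?_
    rw [syn_gn (ana_mem n q f) hi]
    cases h : cv n (s * q) i
    · rw [mt_of_not K s (not_con_of_cv s hi h t), mt_of_not K s (not_con_of_cv s hi h t)]
    · rw [ana, h, cond_true]
  · rw [gn_of_not K s n i t hi, map_zero]
    exact (Finset.sum_eq_zero fun q _ => map_zero _).symm

lemma ana_syn {n : ℕ} {q : ℤ} {F : ℕ → Sq K} (hF : ∀ i, F i ∈ eqv K s) {i : ℕ}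
    (hi : cv n (s * q) i = true) : ana n q (syn K s n q F) i = F i := by
  funext t
  rw [ana, hi, cond_true, syn_gn hF (lt_of_cv hi), mco_mt K s (con_of_cv s hi t)]

lemma ana_syn_ne {n : ℕ} {q q' : ℤ} (hq : q ≠ q') {F : ℕ → Sq K} (hF : ∀ i, F i ∈ eqv K s) {i : ℕ}
    (hi : cv n (s * q) i = true) : ana n q (syn K s n q' F) i = 0 := by
  funext t
  rw [ana, hi, cond_true, syn_gn hF (lt_of_cv hi), mco_mt_ne]
  · rfl
  · intro h
    have hs : (6 * (s : ℤ)) ≠ 0 := by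
      have := NeZero.ne s
      omega
    exact hq (mul_left_cancel₀ hs (sub_right_injective h))

lemma ana_sum (n : ℕ) (q : ℤ) (S : Finset ℤ) (f : ℤ → (Q K s n ⟶ WExt K s)) (i : ℕ) :
    ana n q (∑ q' ∈ S, f q') i = ∑ q' ∈ S, ana n q (f q') i := by
  funext t
  rw [Finset.sum_apply]
  unfold ana
  cases cv n (s * q) i
  · exact Finset.sum_const_zero.symm
  · simp only [cond_true]
    rw [ModuleCat.hom_sum, LinearMap.sum_apply, map_sum]

lemma exists_eq_sum_cocycle {n : ℕ} (f : Q K s n ⟶ WExt K s) (hf : qd K s n ≫ f = 0) :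
    ∃ S : Finset ℤ, f = ∑ q ∈ S, syn K s n q (ana n q f) ∧
      ∀ q ∈ S, ∀ i, ap (dd n (s * q)) (ana n q f) i = 0 := by
  obtain ⟨S, hS⟩ := exists_eq_sum_syn f
  refine ⟨S, hS, fun q hq i => ?_⟩
  cases hi : cv (n + 1) (s * q) i
  · rw [ap, dd, hi]
    rfl
  · have hm : ∀ q i, ap (dd n (s * q)) (ana n q f) i ∈ eqv K s := fun q i =>
      ap_mem _ _ _ (ana_mem n q f)
    have h : ana (n + 1) q (qd K s n ≫ f) i = ap (dd n (s * q)) (ana n q f) i := by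
      conv_lhs => rw [hS, Preadditive.comp_sum, ana_sum]
      rw [Finset.sum_eq_single q]
      · rw [qd_syn (ana_mem n q f), ana_syn (hm q) hi]
      · intro q' _ hne
        rw [qd_syn (ana_mem n q' f), ana_syn_ne hne.symm (hm q') hi]
      · exact fun h => absurd hq h
    rw [← h, hf]
    funext t
    rw [ana, hi, cond_true]
    exact map_zero _

/-- The inclusion into the winding extension. -/
noncomputable abbrev wInc (K : Type u) [Field K] (s : ℕ) [NeZero s] :=
  derivInc (wind K s) (wind_mul K s)

/-- The projection of the winding extension. -/
noncomputable abbrev wProj (K : Type u) [Field K] (s : ℕ) [NeZero s] :=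
  derivProj (wind K s) (wind_mul K s)

lemma inc_proj_mt (u v : ℤ) (f : K × K) :
    (wInc K s).hom ((wProj K s).hom (mt K s u v f)) = mt K s u v (0, f.1) := by
  rw [mt, AddMonoidHom.coe_mk, ZeroHom.coe_mk, wPair, derivProj_apply, derivInc_apply]
  simp

lemma syn_proj_inc {n : ℕ} {q : ℤ} {F : ℕ → Sq K} (hF : ∀ i, F i ∈ eqv K s) :
    syn K s n q F ≫ wProj K s ≫ wInc K s = syn K s n q (fun i => eps K (F i)) := by
  have hF' : ∀ i, eps K (F i) ∈ eqv K s := fun i => natOp_eqv (eps_mem K) (hF i)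
  refine q_hom_ext fun i t => ?_
  rw [ModuleCat.comp_apply, ModuleCat.comp_apply]
  by_cases hi : i < numGens n
  · rw [syn_gn hF hi, syn_gn hF' hi, inc_proj_mt]
    rfl
  · rw [gn_of_not K s n i t hi, map_zero, map_zero, map_zero, map_zero]

lemma eps_ana_inc {n : ℕ} (q : ℤ) (f : Q K s n ⟶ regBimod K (Alg K s)) (i : ℕ) :
    eps K (ana n q (f ≫ wInc K s) i) = 0 := by
  funext t
  rw [eps_apply, ana]
  cases cv n (s * q) i
  · rfl
  · rw [cond_true, ModuleCat.comp_apply, mco_inc]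
    rfl

open Htpy

/-- An odd cocycle is, up to boundaries in the winding extension, the image of a cocycle in the
winding extension, which vanishes except in a few degrees. -/
lemma exists_lift (h2 : (2 : K) ≠ 0) {n : ℕ} (hn : n % 2 = 0)
    (f : Q K s (n + 1) ⟶ regBimod K (Alg K s)) (hf : qd K s (n + 1) ≫ f = 0) :
    ∃ (g : Q K s (n + 1) ⟶ WExt K s) (h : Q K s n ⟶ WExt K s), qd K s (n + 1) ≫ g = 0 ∧
      f ≫ wInc K s = g ≫ wProj K s ≫ wInc K s + qd K s n ≫ h ∧
      (g = 0 ∨ n % 22 ∈ [4, 14, 20]) := by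
  obtain ⟨S, hS, hd⟩ := exists_eq_sum_cocycle (f ≫ wInc K s)
    (by rw [← Category.assoc, hf, Limits.zero_comp])
  set F := fun q => ana (n + 1) q (f ≫ wInc K s) with hF
  have hFm : ∀ q i, F q i ∈ eqv K s := fun q i => ana_mem _ _ _ _
  have key : ∀ q, ∃ G H : ℕ → Sq K, q ∈ S → (∀ i, G i ∈ eqv K s) ∧ (∀ i, H i ∈ eqv K s) ∧
      (∀ i, ap (dd (n + 1) (s * q)) G i = 0) ∧ (∀ i, cv (n + 1) (s * q) i = true →
        F q i = eps K (G i) + ap (dd n (s * q)) H i) ∧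
      ((∀ i, G i = 0) ∨ n % 22 ∈ [4, 14, 20]) := fun q => by
    by_cases hq : q ∈ S
    · obtain ⟨G, ⟨h3, h4, H, h5, h6⟩, h7⟩ := exists_splits h2 (dvd_mul_right (s : ℤ) q) (hFm q)
        (hd q hq) hn (eps_ana_inc q f)
      exact ⟨G, H, fun _ => ⟨h3, h5, h4, h6, h7⟩⟩
    · exact ⟨fun _ => 0, fun _ => 0, fun h => absurd h hq⟩
  choose G H hGH using key
  refine ⟨∑ q ∈ S, syn K s (n + 1) q (G q), ∑ q ∈ S, syn K s n q (H q), ?_, ?_, ?_⟩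
  · rw [Preadditive.comp_sum]
    refine Finset.sum_eq_zero fun q hq => ?_
    obtain ⟨h3, h5, h4, h6, h7⟩ := hGH q hq
    rw [qd_syn h3, show ap (dd (n + 1) (s * q)) (G q) = fun _ => 0 from funext h4, syn_zero]
  · rw [hS, Preadditive.sum_comp, Preadditive.comp_sum, ← Finset.sum_add_distrib]
    refine Finset.sum_congr rfl fun q hq => ?_
    obtain ⟨h3, h5, h4, h6, h7⟩ := hGH q hq
    have h8 : ∀ i, eps K (G q i) ∈ eqv K s := fun i => natOp_eqv (eps_mem K) (h3 i)
    have h9 : ∀ i, ap (dd n (s * q)) (H q) i ∈ eqv K s := fun i => ap_mem _ _ _ h5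
    rw [qd_syn h5, syn_proj_inc h3, ← syn_add h8 h9]
    exact syn_congr (hFm q) (fun i => add_mem (h8 i) (h9 i)) h6
  · by_cases h : n % 22 ∈ [4, 14, 20]
    · exact Or.inr h
    · refine Or.inl (Finset.sum_eq_zero fun q hq => ?_)
      obtain ⟨h3, h5, h4, h6, h7⟩ := hGH q hq
      rw [show G q = fun _ => 0 from funext (h7.resolve_right h), syn_zero]

/-- In certain even degrees cocycles in the winding extension project to boundaries. -/
lemma exists_proj_boundary (h2 : (2 : K) ≠ 0) {n : ℕ} (hn : n % 22 ∈ [3, 7, 9, 13, 19])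
    (g : Q K s (n + 1) ⟶ WExt K s) (hg : qd K s (n + 1) ≫ g = 0) :
    ∃ h : Q K s n ⟶ regBimod K (Alg K s), qd K s n ≫ h = g ≫ wProj K s := by
  obtain ⟨S, hS, hd⟩ := exists_eq_sum_cocycle g hg
  set F := fun q => ana (n + 1) q g with hF
  have hFm : ∀ q i, F q i ∈ eqv K s := fun q i => ana_mem _ _ _ _
  have key : ∀ q, ∃ H : ℕ → Sq K, q ∈ S → (∀ i, H i ∈ eqv K s) ∧
      ∀ i, cv (n + 1) (s * q) i = true →
        eps K (F q i) = eps K (ap (dd n (s * q)) H i) := fun q => by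
    by_cases hq : q ∈ S
    · obtain ⟨H, h3, h4⟩ := exists_bounds h2 (dvd_mul_right (s : ℤ) q) (hFm q) (hd q hq) hn
      exact ⟨H, fun _ => ⟨h3, h4⟩⟩
    · exact ⟨fun _ => 0, fun h => absurd h hq⟩
  choose H hH using key
  refine ⟨(∑ q ∈ S, syn K s n q (H q)) ≫ wProj K s, ?_⟩
  have := (deriv_shortExact (wind K s) (wind_mul K s)).mono_f
  rw [← cancel_mono (wInc K s), Category.assoc, Category.assoc, Category.assoc, hS]
  rw [← Category.assoc, Preadditive.comp_sum, Preadditive.sum_comp, Preadditive.sum_comp]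
  refine Finset.sum_congr rfl fun q hq => ?_
  obtain ⟨h3, h4⟩ := hH q hq
  have h9 : ∀ i, ap (dd n (s * q)) (H q) i ∈ eqv K s := fun i => ap_mem _ _ _ h3
  rw [qd_syn h3, syn_proj_inc h9, syn_proj_inc (hFm q)]
  exact syn_congr (fun i => natOp_eqv (eps_mem K) (h9 i))
    (fun i => natOp_eqv (eps_mem K) (hFm q i)) fun i hi => (h4 i hi).symm

end Analysis

section Assembly
set_option linter.unusedSectionVars false
open CategoryTheory CategoryTheory.Abelian

/-- The category of bimodules over an algebra. -/
abbrev BimodCat (k A : Type u) [Field k] [Ring A] [Algebra k A] := ModuleCat.{u} (A ⊗[k] Aᵐᵒᵖ)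

variable (K : Type u) [Field K] (s : ℕ) [NeZero s] [HasExt.{w} (BimodCat K (Alg K s))]

/-- The Hochschild class of degree one defined by the winding derivation. -/
noncomputable abbrev windClass : Ext.{w} (regBimod K (Alg K s)) (regBimod K (Alg K s)) 1 :=
  (deriv_shortExact (wind K s) (wind_mul K s)).extClass

variable {K s}

lemma exists_decomp (h2 : (2 : K) ≠ 0) {n : ℕ} (hn : n % 2 = 0)
    (x : Ext.{w} (regBimod K (Alg K s)) (regBimod K (Alg K s)) (n + 1)) :
    ∃ (a : Ext.{w} (regBimod K (Alg K s)) (regBimod K (Alg K s)) n)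
      (z : Ext.{w} (regBimod K (Alg K s)) (regBimod K (Alg K s)) (n + 1)),
      x = a.comp (windClass K s) rfl + z ∧ z.comp (windClass K s) rfl = 0 ∧
        (z = 0 ∨ n % 22 ∈ [4, 14, 20]) := by
  obtain ⟨f, hf, rfl⟩ := (qRes K s).extMk_surjective x (n + 1 + 1) rfl
  obtain ⟨g, h, hg, hfg, hz⟩ : ∃ (g : (qRes K s).complex.X (n + 1) ⟶ WExt K s)
      (h : (qRes K s).complex.X n ⟶ WExt K s),
      (qRes K s).complex.d (n + 1 + 1) (n + 1) ≫ g = 0 ∧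
      f ≫ wInc K s = (g ≫ wProj K s) ≫ wInc K s + (qRes K s).complex.d (n + 1) n ≫ h ∧
      (g = 0 ∨ n % 22 ∈ [4, 14, 20]) := by
    obtain ⟨g, h, hg, hfg, hz⟩ := exists_lift h2 hn f
      ((congrArg (· ≫ f) (qComplex_d K s (n + 1))).symm.trans hf)
    refine ⟨g, h, (congrArg (· ≫ g) (qComplex_d K s (n + 1))).trans hg, ?_, hz⟩
    refine hfg.trans (congrArg₂ _ (Category.assoc _ _ _).symm ?_)
    exact (congrArg (· ≫ h) (qComplex_d K s n)).symm
  have hgp : (qRes K s).complex.d (n + 1 + 1) (n + 1) ≫ (g ≫ wProj K s) = 0 := by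
    rw [← Category.assoc, hg, Limits.zero_comp]
  obtain ⟨a, ha⟩ := Ext.covariant_sequence_exact₁ (regBimod K (Alg K s))
    (deriv_shortExact (wind K s) (wind_mul K s))
    ((qRes K s).extMk f (n + 1 + 1) rfl hf - (qRes K s).extMk (g ≫ wProj K s) (n + 1 + 1) rfl hgp)
    (by
      rw [ProjectiveResolution.sub_extMk]
      refine (ProjectiveResolution.extMk_comp_mk₀ _ _ _ _ _ _).trans ?_
      rw [ProjectiveResolution.extMk_eq_zero_iff _ _ _ _ _ n rfl]
      exact ⟨h, (eq_sub_iff_add_eq'.mpr hfg.symm).trans (Preadditive.sub_comp _ _ _).symm⟩) rfl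
  refine ⟨a, (qRes K s).extMk (g ≫ wProj K s) (n + 1 + 1) rfl hgp, ?_, ?_, ?_⟩
  · exact (sub_add_cancel _ _).symm.trans (congrArg (· + _) ha.symm)
  · rw [← ProjectiveResolution.extMk_comp_mk₀ _ g _ rfl hg (wProj K s),
      Ext.comp_assoc _ _ _ (add_zero _) (zero_add 1) (by omega)]
    rw [(deriv_shortExact (wind K s) (wind_mul K s)).comp_extClass, Ext.comp_zero]
  · refine hz.imp_left fun h0 => ?_
    subst h0
    simp only [Limits.zero_comp]
    exact ProjectiveResolution.extMk_zero _ _ _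

lemma eq_zero_of_comp_windClass (h2 : (2 : K) ≠ 0) {n : ℕ} (hn : n % 22 ∈ [3, 7, 9, 13, 19])
    (z : Ext.{w} (regBimod K (Alg K s)) (regBimod K (Alg K s)) (n + 1))
    (hz : z.comp (windClass K s) rfl = 0) : z = 0 := by
  obtain ⟨y, rfl⟩ := Ext.covariant_sequence_exact₃ (regBimod K (Alg K s))
    (deriv_shortExact (wind K s) (wind_mul K s)) z rfl hz
  obtain ⟨g, hg, rfl⟩ := (qRes K s).extMk_surjective y (n + 1 + 1) rfl
  obtain ⟨h, hh⟩ := exists_proj_boundary h2 hn g (by rw [← qComplex_d]; exact hg)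
  refine (ProjectiveResolution.extMk_comp_mk₀ _ _ _ _ _ _).trans ?_
  rw [ProjectiveResolution.extMk_eq_zero_iff _ _ _ _ _ n rfl]
  exact ⟨h, (congrArg (· ≫ h) (qComplex_d K s n)).trans hh⟩

lemma ext_add_self (h2 : (2 : K) = 0) {n : ℕ}
    (x : Ext.{w} (regBimod K (Alg K s)) (regBimod K (Alg K s)) n) : x + x = 0 := by
  have : 𝟙 (regBimod K (Alg K s)) + 𝟙 _ = 0 := by
    ext (a : Alg K s)
    change a + a = 0
    rw [← two_smul K, h2, zero_smul]
  rw [← Ext.mk₀_id_comp x, ← Ext.add_comp, ← Ext.mk₀_add, this, Ext.mk₀_zero, Ext.zero_comp]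

lemma comp_comm_of_eq_zero {m n p : ℕ} (h : m + n = p) (h' : n + m = p)
    (x : Ext.{w} (regBimod K (Alg K s)) (regBimod K (Alg K s)) m)
    (y : Ext.{w} (regBimod K (Alg K s)) (regBimod K (Alg K s)) n) (hxy : x.comp y h = 0) :
    y.comp x h' = 0 :=
  (ext_comp_comm h h' x y).trans ((congrArg _ hxy).trans (smul_zero _))

lemma eq_zero_of_add_self (h2 : (2 : K) ≠ 0) {n : ℕ}
    (x : Ext.{w} (regBimod K (Alg K s)) (regBimod K (Alg K s)) n) (hx : x + x = 0) : x = 0 := by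
  let _ : Linear K (BimodCat K (Alg K s)) := ModuleCat.linearOverField
  rw [← one_smul K x, ← inv_mul_cancel₀ h2, mul_smul, two_smul, hx, smul_zero]

lemma windClass_comp_self (h2 : (2 : K) ≠ 0) :
    (windClass.{u, w} K s).comp (windClass K s) (rfl : 1 + 1 = 2) = 0 := by
  refine eq_zero_of_add_self h2 _ ?_
  have := ext_comp_comm rfl rfl (windClass.{u, w} K s) (windClass K s)
  exact eq_neg_iff_add_eq_zero.mp (this.trans (by simp))

lemma comp_windClass_of_odd (h2 : (2 : K) ≠ 0) {n : ℕ} (hn : n % 2 = 0)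
    (x : Ext.{w} (regBimod K (Alg K s)) (regBimod K (Alg K s)) (n + 1)) :
    x.comp (windClass K s) rfl = 0 := by
  obtain ⟨a, z, rfl, hz, -⟩ := exists_decomp h2 hn x
  rw [Ext.add_comp, hz, add_zero, Ext.comp_assoc _ _ _ rfl rfl (by omega),
    windClass_comp_self h2, Ext.comp_zero]

/-- Outside characteristic two, products of odd Hochschild classes vanish. -/
lemma comp_eq_zero_of_odd (h2 : (2 : K) ≠ 0) {m n p : ℕ} (hm : m % 2 = 0) (hn : n % 2 = 0)
    (x : Ext.{w} (regBimod K (Alg K s)) (regBimod K (Alg K s)) (m + 1))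
    (y : Ext.{w} (regBimod K (Alg K s)) (regBimod K (Alg K s)) (n + 1))
    (h : m + 1 + (n + 1) = p) : x.comp y h = 0 := by
  have key : ∀ {i j : ℕ} (hi : i % 2 = 0)
      (a : Ext.{w} (regBimod K (Alg K s)) (regBimod K (Alg K s)) j)
      (b : Ext.{w} (regBimod K (Alg K s)) (regBimod K (Alg K s)) (i + 1))
      (h : j + 1 + (i + 1) = p), (a.comp (windClass K s) rfl).comp b h = 0 := fun hi a b h => by
    rw [Ext.comp_assoc _ _ _ rfl (add_comm 1 _) (by omega),
      comp_comm_of_eq_zero rfl _ _ _ (comp_windClass_of_odd h2 hi b), Ext.comp_zero]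
  obtain ⟨a, x', rfl, -, hx⟩ := exists_decomp h2 hm x
  obtain ⟨b, y', rfl, -, hy⟩ := exists_decomp h2 hn y
  rw [Ext.add_comp, key hn, zero_add]
  refine comp_comm_of_eq_zero (by omega) h _ _ ?_
  rw [Ext.add_comp, key hm, zero_add]
  rcases hx with rfl | hx
  · rw [Ext.comp_zero]
  rcases hy with rfl | hy
  · rw [Ext.zero_comp]
  obtain rfl : p = n + m + 1 + 1 := by omega
  refine eq_zero_of_comp_windClass h2 ?_ _ ?_
  · simp only [List.mem_cons, List.not_mem_nil, or_false] at hx hy ⊢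
    omega
  · rw [Ext.comp_assoc _ _ _ _ rfl (by omega), comp_windClass_of_odd h2 hm, Ext.comp_zero]

lemma ext_comp_comm_alg {m n p : ℕ} (hmn : m + n = p) (hnm : n + m = p)
    (x : Ext.{w} (regBimod K (Alg K s)) (regBimod K (Alg K s)) m)
    (y : Ext.{w} (regBimod K (Alg K s)) (regBimod K (Alg K s)) n) :
    x.comp y hmn = y.comp x hnm := by
  refine Eq.trans ?_ (ext_comp_comm hmn hnm x y).symm
  rcases Nat.even_or_odd (m * n) with he | ho
  · rw [he.neg_one_pow, one_smul]
  · rw [ho.neg_one_pow, neg_one_smul]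
    by_cases h2 : (2 : K) = 0
    · exact eq_neg_iff_add_eq_zero.mpr (ext_add_self h2 _)
    · obtain ⟨⟨i, rfl⟩, ⟨j, rfl⟩⟩ := Nat.odd_mul.mp ho
      rw [comp_eq_zero_of_odd h2 (by omega) (by omega), neg_zero]

end Assembly

section StandardExt
open CategoryTheory CategoryTheory.Abelian

/-- Commutativity of the self-extension ring of a module. -/
def ExtComm (Λ : Type u) [Ring Λ] (M : Type u) [AddCommGroup M] [Module Λ M] : Prop :=
  letI := HasDerivedCategory.standard (ModuleCat.{u} Λ)
  haveI : HasExt.{u + 1} (ModuleCat.{u} Λ) := hasExt_of_hasDerivedCategory _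
  ∀ (m n p : ℕ) (hmn : m + n = p) (hnm : n + m = p)
    (x : Ext (ModuleCat.of Λ M) (ModuleCat.of Λ M) m)
    (y : Ext (ModuleCat.of Λ M) (ModuleCat.of Λ M) n), x.comp y hmn = y.comp x hnm

attribute [local instance] TensorProduct.Algebra.module in
/-- Commutativity of the Hochschild cohomology ring of an algebra. -/
def HochschildComm (k A : Type u) [Field k] [Ring A] [Algebra k A] : Prop :=
  ExtComm (A ⊗[k] Aᵐᵒᵖ) A

lemma hochschildComm_alg (K : Type u) [Field K] (s : ℕ) [NeZero s] :
    HochschildComm K (Alg K s) := by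
  let _ := HasDerivedCategory.standard (BimodCat K (Alg K s))
  let _ : HasExt.{u + 1} (BimodCat K (Alg K s)) := hasExt_of_hasDerivedCategory _
  intro m n p hmn hnm x y
  exact ext_comp_comm_alg hmn hnm x y

end StandardExt

open CategoryTheory in
/-- The Hochschild cohomology ring `HH^*(R_s) = ⊕ₜ Ext_Λ^t(R, R)`
of `R = R_s` is commutative: for all homogeneous elements `x ∈ HH^m`, `y ∈ HH^n`,
the Yoneda products `x·y` and `y·x` agree (in `HH^{m+n} = HH^{n+m}`). -/
theorem hochschild_comm (K : Type u) [Field K] (s : ℕ) (hs : 0 < s) :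
    letI := HasDerivedCategory.standard (ModuleCat.{u} (Env K s))
    haveI : HasExt.{u + 1} (ModuleCat.{u} (Env K s)) :=
      hasExt_of_hasDerivedCategory _
    ∀ (m n p : ℕ) (hmn : m + n = p) (hnm : n + m = p)
      (x : Abelian.Ext (ModuleCat.of (Env K s) (Alg K s))
        (ModuleCat.of (Env K s) (Alg K s)) m)
      (y : Abelian.Ext (ModuleCat.of (Env K s) (Alg K s))
        (ModuleCat.of (Env K s) (Alg K s)) n),
      x.comp y hmn = y.comp x hnm := by
  have : NeZero s := ⟨hs.ne'⟩
  change ExtComm (Env K s) (Alg K s)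
  exact hochschildComm_alg K s

end E6
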